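/- There exist constants 0 < β < ∞ and c > 0 such that for all n = 2^{j₀}, m = 2^{−i₀}n as above, and all k with n/m ≤ k ≤ 2n/m, if j is the index with the x-coordinates of H_k contained in I_j, then P(Q_n ∩ H_k ≠ ∅) ≥ c·2^{(1−β)j}·m²·n^{−2}. -/

import Mathlib

/-!
Critical site percolation on the triangular lattice realized on `ℤ²`.
A configuration assigns to each site `true` (open) or `false` (closed),
and `P` is the product Bernoulli(1/2) measure, axiomatized by
`IsBernoulliHalf` below (finite cylinder events have product probability).
-/

open MeasureTheory
open scoped ENNReal

/-- Sites of the lattice: vertices of `ℤ²`. -/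
abbrev Site : Type := ℤ × ℤ

/-- A percolation configuration: `true` = open, `false` = closed. -/
abbrev Config : Type := Site → Bool

/-- Adjacency for the triangular lattice realized on `ℤ²`:
the neighbors of `(x,y)` are `(x±1,y)`, `(x,y±1)`, `(x+1,y-1)`, `(x-1,y+1)`. -/
def Adj (a b : Site) : Prop :=
  (b.1 - a.1, b.2 - a.2) ∈
    ({(1, 0), (-1, 0), (0, 1), (0, -1), (1, -1), (-1, 1)} : Set (ℤ × ℤ))

/-- A (nonempty, self-avoiding) lattice path: a list of distinct sites in which
consecutive sites are neighbors. -/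
def IsPath (p : List Site) : Prop := p ≠ [] ∧ p.Nodup ∧ p.Chain' Adj

/-- A path all of whose vertices lie in the set `S`. -/
def PathIn (S : Set Site) (p : List Site) : Prop := IsPath p ∧ ∀ v ∈ p, v ∈ S

/-- All sites of `p` are open in `ω`. -/
def IsOpenOn (ω : Config) (p : List Site) : Prop := ∀ v ∈ p, ω v = true

/-- All sites of `p` are closed in `ω`. -/
def IsClosedOn (ω : Config) (p : List Site) : Prop := ∀ v ∈ p, ω v = false

/-- The first vertex of `p` lies in `A`. -/
def FirstIn (A : Set Site) (p : List Site) : Prop := ∃ a ∈ A, p.head? = some a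

/-- The last vertex of `p` lies in `A`. -/
def LastIn (A : Set Site) (p : List Site) : Prop := ∃ a ∈ A, p.getLast? = some a

/-- `μ` is the product Bernoulli(1/2) measure on configurations: a probability
measure for which every finite cylinder event has the product probability. -/
def IsBernoulliHalf (μ : Measure Config) : Prop :=
  IsProbabilityMeasure μ ∧
    ∀ (S : Finset Site) (f : Site → Bool),
      μ {ω | ∀ v ∈ S, ω v = f v} = (1 / 2 : ℝ≥0∞) ^ S.card

/-- The lattice rectangle `[x₀,x₁] × [y₀,y₁]`. -/
def rect (x₀ x₁ y₀ y₁ : ℤ) : Set Site :=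
  {v | x₀ ≤ v.1 ∧ v.1 ≤ x₁ ∧ y₀ ≤ v.2 ∧ v.2 ≤ y₁}

/-- The left side of a rectangle. -/
def rectLeft (x₀ x₁ y₀ y₁ : ℤ) : Set Site := {v ∈ rect x₀ x₁ y₀ y₁ | v.1 = x₀}

/-- The right side of a rectangle. -/
def rectRight (x₀ x₁ y₀ y₁ : ℤ) : Set Site := {v ∈ rect x₀ x₁ y₀ y₁ | v.1 = x₁}

/-- The top side of a rectangle. -/
def rectTop (x₀ x₁ y₀ y₁ : ℤ) : Set Site := {v ∈ rect x₀ x₁ y₀ y₁ | v.2 = y₁}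

/-- The bottom side of a rectangle. -/
def rectBot (x₀ x₁ y₀ y₁ : ℤ) : Set Site := {v ∈ rect x₀ x₁ y₀ y₁ | v.2 = y₀}

/-- A horizontal open crossing of the rectangle `[x₀,x₁] × [y₀,y₁]`:
an open path in the rectangle from its left side to its right side. -/
def HorizCrossing (x₀ x₁ y₀ y₁ : ℤ) (ω : Config) (p : List Site) : Prop :=
  PathIn (rect x₀ x₁ y₀ y₁) p ∧ IsOpenOn ω p ∧
    FirstIn (rectLeft x₀ x₁ y₀ y₁) p ∧ LastIn (rectRight x₀ x₁ y₀ y₁) p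

/-- `v` is a pivotal site for the box `B(n) = [-n,n]²`: some horizontal open
crossing of `B(n)` contains `v`, and there are two disjoint closed paths in
`B(n)` started from `v` (i.e. starting at a neighbor of `v`), one to the top
side and one to the bottom side of `B(n)`. -/
def Pivotal (n : ℤ) (ω : Config) (v : Site) : Prop :=
  (∃ p, HorizCrossing (-n) n (-n) n ω p ∧ v ∈ p) ∧
    ∃ q₁ q₂ : List Site,
      PathIn (rect (-n) n (-n) n) q₁ ∧ IsClosedOn ω q₁ ∧
        FirstIn {w | Adj v w} q₁ ∧ LastIn (rectTop (-n) n (-n) n) q₁ ∧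
      PathIn (rect (-n) n (-n) n) q₂ ∧ IsClosedOn ω q₂ ∧
        FirstIn {w | Adj v w} q₂ ∧ LastIn (rectBot (-n) n (-n) n) q₂ ∧
      List.Disjoint q₁ q₂

/-- `Q_n`: the set of pivotal sites for `B(n)`. -/
def Qset (n : ℤ) (ω : Config) : Set Site := {v | Pivotal n ω v}

/-- The block `H_k`: `{(x,y) ∈ B(n) : -n+(k-1)m < x ≤ -n+km, -n ≤ y ≤ -n+m}`. -/
def Hblock (n m : ℤ) (k : ℕ) : Set Site :=
  {v | -n + ((k : ℤ) - 1) * m < v.1 ∧ v.1 ≤ -n + (k : ℤ) * m ∧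
        -n ≤ v.2 ∧ v.2 ≤ -n + m}

/-- The dyadic interval `I_j` (for `n = 2^j₀`, `m = 2^{j₀-i₀}`):
`I_j = (n - 2^{-j}n, n - 2^{-j-1}n]` for `j < i₀` and `I_{i₀} = (n-m, n]`. -/
def Iset (j₀ i₀ j : ℕ) : Set ℤ :=
  if j = i₀ then Set.Ioc ((2 : ℤ) ^ j₀ - 2 ^ (j₀ - i₀)) ((2 : ℤ) ^ j₀)
  else Set.Ioc ((2 : ℤ) ^ j₀ - 2 ^ (j₀ - j)) ((2 : ℤ) ^ j₀ - 2 ^ (j₀ - j - 1))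

lemma adj_iff {a b : Site} : Adj a b ↔
    (b.1 = a.1 + 1 ∧ b.2 = a.2) ∨ (b.1 = a.1 - 1 ∧ b.2 = a.2) ∨
    (b.1 = a.1 ∧ b.2 = a.2 + 1) ∨ (b.1 = a.1 ∧ b.2 = a.2 - 1) ∨
    (b.1 = a.1 + 1 ∧ b.2 = a.2 - 1) ∨ (b.1 = a.1 - 1 ∧ b.2 = a.2 + 1) := by
  simp only [Adj, Set.mem_insert_iff, Set.mem_singleton_iff, Prod.mk.injEq]
  omega

lemma Adj.symm {a b : Site} (h : Adj a b) : Adj b a := by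
  rw [adj_iff] at *; omega

/-- `a` and `b` are joined by a lattice path inside `S`. -/
def Conn (S : Set Site) (a b : Site) : Prop :=
  a ∈ S ∧ Relation.ReflTransGen (fun u v => Adj u v ∧ v ∈ S) a b

namespace Conn

variable {S S' : Set Site} {a b c : Site}

lemma refl (h : a ∈ S) : Conn S a a := ⟨h, .refl⟩

lemma left_mem (h : Conn S a b) : a ∈ S := h.1

lemma right_mem (h : Conn S a b) : b ∈ S := by
  rcases Relation.ReflTransGen.cases_tail h.2 with h' | ⟨c, -, hc⟩
  · exact h' ▸ h.1
  · exact hc.2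

lemma trans (h : Conn S a b) (h' : Conn S b c) : Conn S a c := ⟨h.1, h.2.trans h'.2⟩

lemma tail (h : Conn S a b) (h' : Adj b c) (hc : c ∈ S) : Conn S a c :=
  ⟨h.1, h.2.tail ⟨h', hc⟩⟩

lemma single (ha : a ∈ S) (h' : Adj a b) (hb : b ∈ S) : Conn S a b := (refl ha).tail h' hb

@[elab_as_elim]
lemma induct {P : ∀ b, Conn S a b → Prop} (h : Conn S a b) (h0 : ∀ h, P a h)
    (h1 : ∀ u v (hu : Conn S a u) (huv : Adj u v) (hv : v ∈ S), P u hu → P v (hu.tail huv hv)) :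
    P b h := by
  obtain ⟨ha, h⟩ := h
  induction h with
  | refl => exact h0 _
  | tail hu huv ih => exact h1 _ _ ⟨ha, hu⟩ huv.1 huv.2 ih

lemma symm (h : Conn S a b) : Conn S b a := by
  induction h using Conn.induct with
  | h0 h => exact refl h.left_mem
  | h1 u v hu huv hv ih => exact (single hv huv.symm hu.right_mem).trans ih

lemma mono (h : Conn S a b) (hS : S ⊆ S') : Conn S' a b := by
  induction h using Conn.induct with
  | h0 h => exact refl (hS h.left_mem)
  | h1 u v _ huv hv ih => exact ih.tail huv (hS hv)

/-- The path lies in the component of its starting point. -/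
lemma comp (h : Conn S a b) : Conn {z | Conn S a z} a b := by
  induction h using Conn.induct with
  | h0 h => exact refl (refl h.left_mem)
  | h1 u v hu huv hv ih => exact ih.tail huv (hu.tail huv hv)

/-- A path from the complement of `E` to `E` has a first entrance into `E`. -/
lemma exit (h : Conn S a b) {E : Set Site} (ha : a ∉ E) (hb : b ∈ E) :
    ∃ p u, Conn (S \ E) a p ∧ Adj p u ∧ u ∈ S ∧ u ∈ E := by
  have key : Conn (S \ E) a b ∨ ∃ p u, Conn (S \ E) a p ∧ Adj p u ∧ u ∈ S ∧ u ∈ E := by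
    clear hb
    induction h using Conn.induct with
    | h0 h => exact .inl (refl ⟨h.left_mem, ha⟩)
    | h1 u v hu huv hv ih =>
      rcases ih with ih | ih
      · by_cases hvE : v ∈ E
        · exact .inr ⟨u, v, ih, huv, hv, hvE⟩
        · exact .inl (ih.tail huv ⟨hv, hvE⟩)
      · exact .inr ih
  rcases key with h | h
  · exact absurd hb h.right_mem.2
  · exact h

lemma map (h : Conn S a b) (f : Site → Site) (hf : ∀ u v, Adj u v → Adj (f u) (f v))
    (hS : ∀ u ∈ S, f u ∈ S') : Conn S' (f a) (f b) := by
  induction h using Conn.induct with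
  | h0 h => exact refl (hS _ h.left_mem)
  | h1 u v _ huv hv ih => exact ih.tail (hf _ _ huv) (hS _ hv)

/-- The first time an integer valued function with increments at most one reaches `t`. -/
lemma first_hit (h : Conn S a b) (f : Site → ℤ) (t : ℤ)
    (hf : ∀ u v, Adj u v → f v ≤ f u + 1) (ha : f a ≤ t) (hb : t ≤ f b) :
    ∃ c, f c = t ∧ Conn (S ∩ {z | f z ≤ t}) a c := by
  by_cases h0 : f a = t
  · exact ⟨a, h0, refl ⟨h.left_mem, ha⟩⟩
  · obtain ⟨p, u, hp, hpu, huS, hu⟩ := h.exit (E := {z | t ≤ f z})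
      (by simp only [Set.mem_ofPred_eq]; omega) hb
    have h1 := hp.right_mem.2
    have h2 := hf _ _ hpu
    simp only [Set.mem_ofPred_eq] at h1 hu
    refine ⟨u, by omega, (hp.mono ?_).tail hpu ⟨huS, by simp only [Set.mem_ofPred_eq]; omega⟩⟩
    rintro z ⟨hz, hz'⟩
    simp only [Set.mem_ofPred_eq] at hz'
    exact ⟨hz, by simp only [Set.mem_ofPred_eq]; omega⟩

/-- A horizontal segment is connected. -/
lemma hseg (x x' y : ℤ) (hx : x ≤ x') (h : ∀ i, x ≤ i → i ≤ x' → ((i, y) : Site) ∈ S) :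
    Conn S (x, y) (x', y) := by
  obtain ⟨k, rfl⟩ := Int.le.dest hx
  clear hx
  induction k with
  | zero => simpa using refl (h x le_rfl (by simp))
  | succ k ih =>
    refine (ih fun i h1 h2 => h i h1 (by push_cast; omega)).tail ?_ (h _ (by omega) le_rfl)
    rw [adj_iff]; push_cast; omega

/-- A vertical segment is connected. -/
lemma vseg (x y y' : ℤ) (hy : y ≤ y') (h : ∀ i, y ≤ i → i ≤ y' → ((x, i) : Site) ∈ S) :
    Conn S (x, y) (x, y') := by
  obtain ⟨k, rfl⟩ := Int.le.dest hy
  clear hy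
  induction k with
  | zero => simpa using refl (h y le_rfl (by simp))
  | succ k ih =>
    refine (ih fun i h1 h2 => h i h1 (by push_cast; omega)).tail ?_ (h _ (by omega) le_rfl)
    rw [adj_iff]; push_cast; omega

end Conn

section Crossing

variable {x₀ x₁ y₀ y₁ : ℤ}

/-- Signed count of the passages of an edge `u → v` from row `z.2` to row `z.2 + 1`, left of `z`. -/
def edgeCount (u v z : Site) : ℤ :=
  (if u.2 = z.2 ∧ v.2 = z.2 + 1 ∧ u.1 < z.1 then 1 else 0) -
    (if v.2 = z.2 ∧ u.2 = z.2 + 1 ∧ v.1 < z.1 then 1 else 0)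

lemma edgeCount_sub {u v z z' : Site} (huv : Adj u v) (h1 : z'.1 = z.1 ∨ z'.1 = z.1 - 1)
    (h2 : z'.2 = z.2 + 1) (hz : ¬ (z.1 = u.1 ∧ z.2 = u.2) ∧ ¬ (z.1 = v.1 ∧ z.2 = v.2))
    (hz' : ¬ (z'.1 = u.1 ∧ z'.2 = u.2) ∧ ¬ (z'.1 = v.1 ∧ z'.2 = v.2)) :
    edgeCount u v z - edgeCount u v z' = (if v.2 = z'.2 ∧ v.1 < z'.1 then 1 else 0) -
      (if u.2 = z'.2 ∧ u.1 < z'.1 then 1 else 0) := by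
  obtain ⟨a, b⟩ := u
  obtain ⟨a', b'⟩ := v
  obtain ⟨p, q⟩ := z
  obtain ⟨p', q'⟩ := z'
  rw [adj_iff] at huv
  simp only [edgeCount] at *
  subst h2
  rcases huv with ⟨rfl, rfl⟩ | ⟨rfl, rfl⟩ | ⟨rfl, rfl⟩ | ⟨rfl, rfl⟩ | ⟨rfl, rfl⟩ | ⟨rfl, rfl⟩ <;>
    rcases h1 with rfl | rfl <;> split_ifs <;> omega

lemma exists_flow {T : Set Site} {c d : Site} (hT : ∀ v ∈ T, x₀ ≤ v.1 ∧ v.1 ≤ x₁)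
    (h : Conn T c d) : ∃ F : Site → ℤ,
      (∀ z : Site, z.1 ≤ x₀ → F z = 0) ∧
      (∀ z : Site, x₁ ≤ z.1 → z ∉ T →
        F z = (if z.2 < d.2 then 1 else 0) - (if z.2 < c.2 then 1 else 0)) ∧
      ∀ z z' : Site, z ∉ T → z' ∉ T → (z'.1 = z.1 + 1 ∧ z'.2 = z.2 → F z = F z') ∧
        ((z'.1 = z.1 ∨ z'.1 = z.1 - 1) ∧ z'.2 = z.2 + 1 →
          F z - F z' = (if d.2 = z'.2 ∧ d.1 < z'.1 then 1 else 0) -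
            (if c.2 = z'.2 ∧ c.1 < z'.1 then 1 else 0)) := by
  induction h using Conn.induct with
  | h0 h => exact ⟨fun _ => 0, by simp, by simp, by simp⟩
  | h1 u v hu huv hv ih =>
    obtain ⟨F, h1, h2, h3⟩ := ih
    have hu' := hT _ hu.right_mem
    have hv' := hT _ hv
    have hne : ∀ z : Site, z ∉ T → ¬ (z.1 = u.1 ∧ z.2 = u.2) ∧ ¬ (z.1 = v.1 ∧ z.2 = v.2) := by
      intro z hz
      exact ⟨fun h => hz ((Prod.ext h.1 h.2 : z = u) ▸ hu.right_mem),
        fun h => hz ((Prod.ext h.1 h.2 : z = v) ▸ hv)⟩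
    rw [adj_iff] at huv
    refine ⟨fun z => F z + edgeCount u v z, fun z hz => ?_, fun z hz hzT => ?_,
      fun z z' hz hz' => ⟨fun hh => ?_, fun hh => ?_⟩⟩
    · dsimp only
      rw [h1 z hz, edgeCount]
      split_ifs <;> omega
    · have := hne z hzT
      dsimp only
      rw [h2 z hz hzT, edgeCount]
      split_ifs <;> omega
    · have := hne z hz
      have := hne z' hz'
      have h4 := (h3 z z' hz hz').1 hh
      simp only [h4, edgeCount]
      split_ifs <;> omega
    · have := hne z hz
      have := hne z' hz'
      have h4 := (h3 z z' hz hz').2 hh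
      have h5 := edgeCount_sub (adj_iff.2 huv) hh.1 hh.2 (hne z hz) (hne z' hz')
      dsimp only
      omega

/-- A path from left to right and a path from bottom to top share a site. -/
theorem crossing_meet {S T : Set Site} {a b c d : Site}
    (hS : ∀ v ∈ S, y₀ ≤ v.2 ∧ v.2 ≤ y₁) (hT : ∀ v ∈ T, x₀ ≤ v.1 ∧ v.1 ≤ x₁)
    (hab : Conn S a b) (ha : a.1 ≤ x₀) (hb : x₁ ≤ b.1)
    (hcd : Conn T c d) (hc : c.2 ≤ y₀) (hd : y₁ ≤ d.2) : ∃ z, z ∈ S ∧ z ∈ T := by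
  by_contra! hdis
  set d' : Site := (d.1, d.2 + 1)
  have hT' : ∀ v ∈ insert d' T, x₀ ≤ v.1 ∧ v.1 ≤ x₁ := by
    rintro v (hv | hv)
    · rw [hv]; exact hT d hcd.right_mem
    · exact hT _ hv
  have hcd' : Conn (insert d' T) c d' :=
    (hcd.mono (Set.subset_insert _ _)).tail (by rw [adj_iff]; simp [d']) (Set.mem_insert _ _)
  have hdis' : ∀ z ∈ S, z ∉ insert d' T := by
    rintro z hz (h | h)
    · have := hS _ hz; simp only [h, d'] at this; omega
    · exact hdis z hz h
  obtain ⟨F, h1, h2, h3⟩ := exists_flow hT' hcd'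
  have hconst : F b = 0 := by
    clear hb
    induction hab using Conn.induct with
    | h0 h => exact h1 _ ha
    | h1 u v hu huv hv ih =>
      have hu1 := hS _ hu.right_mem
      have hv1 := hS _ hv
      have hu2 := hdis' _ hu.right_mem
      have hv2 := hdis' _ hv
      have k1 := h3 u v hu2 hv2
      have k2 := h3 v u hv2 hu2
      have hd'2 : d'.2 = d.2 + 1 := rfl
      rw [adj_iff] at huv
      clear h1 h2 h3
      rcases huv with h | h | h | h | h | h
      · rw [← k1.1 h, ih]
      · rw [k2.1 (by omega), ih]
      · have := k1.2 (by omega)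
        rw [if_neg (by omega), if_neg (by omega)] at this; omega
      · have := k2.2 (by omega)
        rw [if_neg (by omega), if_neg (by omega)] at this; omega
      · have := k2.2 (by omega)
        rw [if_neg (by omega), if_neg (by omega)] at this; omega
      · have := k1.2 (by omega)
        rw [if_neg (by omega), if_neg (by omega)] at this; omega
  have hbS := hS _ hab.right_mem
  have := h2 b hb (hdis' _ hab.right_mem)
  have hd'2 : d'.2 = d.2 + 1 := rfl
  rw [if_pos (by omega), if_neg (by omega), hconst] at this
  omega

lemma fin_three : ∀ p q r : Fin 3, p ≠ q ∧ q ≠ r ∧ p ≠ r →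
    (p = 0 ∧ q = 1 ∧ r = 2) ∨ (p = 0 ∧ q = 2 ∧ r = 1) ∨ (p = 1 ∧ q = 0 ∧ r = 2) ∨
    (p = 1 ∧ q = 2 ∧ r = 0) ∨ (p = 2 ∧ q = 0 ∧ r = 1) ∨ (p = 2 ∧ q = 1 ∧ r = 0) := by
  intro p q r
  fin_cases p <;> fin_cases q <;> fin_cases r <;> simp

lemma sperner_row (l : Site → Fin 3) (x : ℤ) (y : ℤ) (e : Fin 3 → Fin 3 → Bool)
    (he : ∀ a b c, ¬ (a ≠ b ∧ b ≠ c ∧ a ≠ c) → (e a b ^^ e b c ^^ e a c) = false)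
    (hes : ∀ a b, e a b = e b a)
    (hl : ∀ a b c : Site, Adj a b → Adj b c → Adj a c →
      ¬ (l a ≠ l b ∧ l b ≠ l c ∧ l a ≠ l c)) (f : ℤ → ℕ → Bool)
    (hf0 : ∀ y, f y 0 = false)
    (hf : ∀ y k, f y (k + 1) = (f y k ^^ e (l (x + k, y)) (l (x + k + 1, y)))) (k : ℕ) :
    (f y k ^^ f (y + 1) k) =
      (e (l (x + k, y)) (l (x + k, y + 1)) ^^ e (l (x, y)) (l (x, y + 1))) := by
  induction k with
  | zero => simp [hf0]
  | succ k ih =>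
    have t1 := he _ _ _ (hl (x + k, y) (x + k + 1, y) (x + k, y + 1) (by simp [adj_iff])
      (by simp [adj_iff]) (by simp [adj_iff]))
    have t2 := he _ _ _ (hl (x + k + 1, y + 1) (x + k + 1, y) (x + k, y + 1)
      (by simp [adj_iff]) (by simp [adj_iff]) (by simp [adj_iff]))
    rw [hes (l (x + k + 1, y + 1)) (l (x + k + 1, y)),
      hes (l (x + k + 1, y + 1)) (l (x + k, y + 1))] at t2
    rw [hf, hf]
    push_cast
    rw [← add_assoc]
    revert ih t1 t2
    generalize f y k = a1
    generalize f (y + 1) k = a2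
    generalize e (l (x + k, y)) (l (x + k, y + 1)) = a3
    generalize e (l (x, y)) (l (x, y + 1)) = a4
    generalize e (l (x + k, y)) (l (x + k + 1, y)) = a5
    generalize e (l (x + k, y + 1)) (l (x + k + 1, y + 1)) = a6
    generalize e (l (x + k + 1, y)) (l (x + k + 1, y + 1)) = a7
    generalize e (l (x + k + 1, y)) (l (x + k, y + 1)) = a8
    revert a1 a2 a3 a4 a5 a6 a7 a8
    decide

lemma exists_edge : ∃ e : Fin 3 → Fin 3 → Bool,
    (∀ a b c, ¬ (a ≠ b ∧ b ≠ c ∧ a ≠ c) → (e a b ^^ e b c ^^ e a c) = false) ∧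
    (∀ a b, e a b = e b a) ∧ e 0 1 = true ∧ e 1 1 = false ∧ e 1 2 = false ∧ e 0 2 = false ∧
    e 2 2 = false ∧ e 0 0 = false :=
  ⟨fun a b => (a = 0 ∧ b = 1) ∨ (a = 1 ∧ b = 0), by decide⟩

lemma exists_row (g : ℤ → ℕ → Bool) : ∃ f : ℤ → ℕ → Bool, (∀ y, f y 0 = false) ∧
    ∀ y k, f y (k + 1) = (f y k ^^ g y k) :=
  ⟨fun y k => Nat.rec false (fun k r => r ^^ g y k) k, fun _ => rfl, fun _ _ => rfl⟩

/-- Either `U` crosses the rectangle horizontally or its complement crosses it vertically. -/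
theorem hex (U : Set Site) (hx : x₀ ≤ x₁) (hy : y₀ ≤ y₁) :
    (∃ a b : Site, a.1 = x₀ ∧ b.1 = x₁ ∧ Conn (U ∩ rect x₀ x₁ y₀ y₁) a b) ∨
    (∃ a b : Site, a.2 = y₀ ∧ b.2 = y₁ ∧ Conn (rect x₀ x₁ y₀ y₁ \ U) a b) := by
  classical
  by_contra! hcon
  obtain ⟨hA, hB⟩ := hcon
  set R := rect x₀ x₁ y₀ y₁ with hR
  have mR : ∀ v : Site, v ∈ R ↔ x₀ ≤ v.1 ∧ v.1 ≤ x₁ ∧ y₀ ≤ v.2 ∧ v.2 ≤ y₁ := fun v => Iff.rfl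
  set A : Set Site := {v | ∃ a : Site, a.1 = x₀ ∧ Conn (U ∩ R) a v}
  set B : Set Site := {v | ∃ a : Site, a.2 = y₀ ∧ Conn (R \ U) a v}
  set l : Site → Fin 3 := fun v =>
    if v.1 < x₀ then 0 else if x₁ < v.1 then 2 else if v.2 < y₀ then 1 else
      if y₁ < v.2 then 2 else if v ∈ A then 0 else if v ∈ B then 1 else 2 with hl
  have z0 : ∀ v, l v = 0 → v.1 < x₀ ∨ v ∈ A := by
    intro v h
    by_contra! h'
    rw [hl] at h
    simp only [if_neg h'.1.not_gt, if_neg h'.2] at h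
    split_ifs at h <;> exact absurd h (by decide)
  have z1 : ∀ v, l v = 1 → x₀ ≤ v.1 ∧ v.1 ≤ x₁ ∧ v.2 < y₀ ∨ v ∈ B := by
    intro v h
    by_cases h' : v ∈ B
    · exact .inr h'
    rw [hl] at h
    simp only [if_neg h'] at h
    split_ifs at h with h1 h2 h3
    all_goals first | exact absurd h (by decide) | exact .inl ⟨by omega, by omega, h3⟩
  have z2 : ∀ v, l v = 2 → x₁ < v.1 ∨ (x₀ ≤ v.1 ∧ v.1 ≤ x₁ ∧ y₁ < v.2) ∨
      (v ∈ R ∧ v ∉ A ∧ v ∉ B) := by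
    intro v h
    rw [hl] at h
    dsimp only at h
    split_ifs at h with h1 h2 h3 h4 h5 h6
    all_goals first
      | exact absurd h (by decide)
      | exact .inl h2
      | exact .inr (.inl ⟨by omega, by omega, h4⟩)
      | exact .inr (.inr ⟨(mR v).2 (by omega), h5, h6⟩)
  have key : ∀ a b c : Site, Adj a b → Adj b c → Adj a c → l a = 0 → l b = 1 → l c = 2 → False := by
    intro a b c hab hbc hac ha hb hc
    have hab' := adj_iff.1 hab
    have hbc' := adj_iff.1 hbc
    have hac' := adj_iff.1 hac
    rcases z2 c hc with h | h | ⟨hcR, hcA, hcB⟩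
    · rcases z0 a ha with h' | ⟨s, hs, h'⟩
      · omega
      · have := (mR a).1 h'.right_mem.2
        exact hA s a hs (by omega) h'
    · rcases z1 b hb with h' | ⟨s, hs, h'⟩
      · omega
      · have := (mR b).1 h'.right_mem.1
        exact hB s b hs (by omega) h'
    · have hcR' := (mR c).1 hcR
      by_cases hcU : c ∈ U
      · rcases z0 a ha with h' | ⟨s, hs, h'⟩
        · exact hcA ⟨c, by omega, .refl ⟨hcU, hcR⟩⟩
        · exact hcA ⟨s, hs, h'.tail hac ⟨hcU, hcR⟩⟩
      · rcases z1 b hb with h' | ⟨s, hs, h'⟩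
        · exact hcB ⟨c, by omega, .refl ⟨hcR, hcU⟩⟩
        · exact hcB ⟨s, hs, h'.tail hbc ⟨hcR, hcU⟩⟩
  have tri : ∀ a b c : Site, Adj a b → Adj b c → Adj a c →
      ¬ (l a ≠ l b ∧ l b ≠ l c ∧ l a ≠ l c) := by
    intro a b c hab hbc hac h
    rcases fin_three _ _ _ h with ⟨h1, h2, h3⟩ | ⟨h1, h2, h3⟩ | ⟨h1, h2, h3⟩ | ⟨h1, h2, h3⟩ |
      ⟨h1, h2, h3⟩ | ⟨h1, h2, h3⟩
    · exact key a b c hab hbc hac h1 h2 h3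
    · exact key a c b hac hbc.symm hab h1 h3 h2
    · exact key b a c hab.symm hac hbc h2 h1 h3
    · exact key c a b hac.symm hab hbc.symm h3 h1 h2
    · exact key b c a hbc hac.symm hab.symm h2 h3 h1
    · exact key c b a hbc.symm hab.symm hac.symm h3 h2 h1
  obtain ⟨e, he, hes, e01, e11, e12, e02, e22, e00⟩ := exists_edge
  obtain ⟨f, hf0, hf⟩ := exists_row
    fun y k => e (l (x₀ - 1 + k, y)) (l (x₀ - 1 + k + 1, y))
  obtain ⟨w, hw⟩ := Int.le.dest hx
  have hleft : ∀ y, l (x₀ - 1, y) = 0 := fun y => by simp [hl]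
  have hright : ∀ y, l (x₁ + 1, y) = 2 := fun y => by
    simp only [hl]; rw [if_neg (by omega), if_pos (by omega)]
  have hl1 : ∀ i : ℤ, x₀ ≤ i → i ≤ x₁ → l (i, y₀ - 1) = 1 := fun i h1 h2 => by
    simp only [hl]; rw [if_neg (by omega), if_neg (by omega), if_pos (by omega)]
  have hl2 : ∀ i : ℤ, x₀ ≤ i → l (i, y₁ + 1) = 2 := fun i h1 => by
    simp only [hl]; rw [if_neg (by omega)]
    split_ifs <;> first | rfl | omega
  clear_value l
  have hrow : ∀ y, f y (w + 2) = f (y + 1) (w + 2) := by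
    intro y
    have := sperner_row l (x₀ - 1) y e he hes tri f hf0 hf (w + 2)
    have hx' : x₀ - 1 + ((w + 2 : ℕ) : ℤ) = x₁ + 1 := by push_cast; omega
    rw [hx', hright, hright, hleft, hleft, e00, e22] at this
    simpa using this
  have hall : ∀ k : ℕ, f (y₀ - 1) (w + 2) = f (y₀ - 1 + k) (w + 2) := by
    intro k
    induction k with
    | zero => simp
    | succ k ih => rw [ih, hrow]; push_cast; rw [add_assoc]
  have hbot : ∀ k : ℕ, k ≤ w → f (y₀ - 1) (k + 1) = true := by
    intro k
    induction k with
    | zero =>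
      intro _
      rw [hf, hf0]
      simp only [Nat.cast_zero, add_zero, hleft, sub_add_cancel, hl1 x₀ le_rfl hx, e01,
        Bool.false_xor]
    | succ k ih =>
      intro hk
      rw [hf, ih (by omega), hl1 _ (by push_cast; omega) (by push_cast; omega),
        hl1 _ (by push_cast; omega) (by push_cast; omega), e11]
      rfl
  have htop : ∀ k : ℕ, k ≤ w + 1 → f (y₁ + 1) (k + 1) = false := by
    intro k
    induction k with
    | zero =>
      intro _
      rw [hf, hf0]
      simp only [Nat.cast_zero, add_zero, hleft, sub_add_cancel, hl2 x₀ le_rfl, e02,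
        Bool.false_xor]
    | succ k ih =>
      intro hk
      rw [hf, ih (by omega), hl2 _ (by push_cast; omega), hl2 _ (by push_cast; omega), e22]
      rfl
  have hbot' : f (y₀ - 1) (w + 2) = true := by
    rw [hf, hbot w le_rfl]
    have : x₀ - 1 + ((w + 1 : ℕ) : ℤ) + 1 = x₁ + 1 := by push_cast; omega
    rw [this, hright, hl1 _ (by push_cast; omega) (by push_cast; omega), e12]
    rfl
  obtain ⟨q, hq⟩ := Int.le.dest (show y₀ - 1 ≤ y₁ + 1 by omega)
  have := hall q
  rw [hq, hbot', htop (w + 1) le_rfl] at this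
  simp at this

end Crossing

/-- The event `E` depends only on the sites of `Λ`. -/
def LocOn (Λ : Finset Site) (E : Set Config) : Prop :=
  ∀ ω ω' : Config, (∀ v ∈ Λ, ω v = ω' v) → ω ∈ E → ω' ∈ E

/-- The event `E` depends on finitely many sites. -/
def IsLocal (E : Set Config) : Prop := ∃ Λ, LocOn Λ E

/-- The event `E` is favoured by sites of colour `c`. -/
def ColMono (c : Bool) (E : Set Config) : Prop :=
  ∀ ω ω' : Config, (∀ v, ω v = c → ω' v = c) → ω ∈ E → ω' ∈ E

/-- Extension of a configuration on `Λ` by closed sites. -/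
def extCfg (Λ : Finset Site) (f : Λ → Bool) : Config :=
  fun v => if h : v ∈ Λ then f ⟨v, h⟩ else false

lemma extCfg_mem {Λ : Finset Site} (f : Λ → Bool) {v : Site} (h : v ∈ Λ) :
    extCfg Λ f v = f ⟨v, h⟩ := by simp [extCfg, h]

lemma extCfg_not_mem {Λ : Finset Site} (f : Λ → Bool) {v : Site} (h : v ∉ Λ) :
    extCfg Λ f v = false := by simp [extCfg, h]

lemma LocOn.mono {Λ Λ' : Finset Site} {E : Set Config} (h : LocOn Λ E) (hs : Λ ⊆ Λ') :
    LocOn Λ' E := fun ω ω' hω => h ω ω' fun v hv => hω v (hs hv)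

lemma LocOn.inter {Λ : Finset Site} {E F : Set Config} (h : LocOn Λ E) (h' : LocOn Λ F) :
    LocOn Λ (E ∩ F) := fun ω ω' hω he => ⟨h ω ω' hω he.1, h' ω ω' hω he.2⟩

lemma IsLocal.inter {E F : Set Config} (h : IsLocal E) (h' : IsLocal F) : IsLocal (E ∩ F) := by
  classical
  obtain ⟨Λ, h⟩ := h
  obtain ⟨Λ', h'⟩ := h'
  exact ⟨Λ ∪ Λ', (h.mono Finset.subset_union_left).inter (h'.mono Finset.subset_union_right)⟩

lemma ColMono.inter {c : Bool} {E F : Set Config} (h : ColMono c E) (h' : ColMono c F) :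
    ColMono c (E ∩ F) := fun ω ω' hω he => ⟨h ω ω' hω he.1, h' ω ω' hω he.2⟩

open Classical in
/-- The configurations on `Λ` for which `E` holds. -/
noncomputable def cfgs (Λ : Finset Site) (E : Set Config) : Finset (Λ → Bool) :=
  {f | extCfg Λ f ∈ E}

lemma mem_cfgs {Λ : Finset Site} {E : Set Config} {f : Λ → Bool} :
    f ∈ cfgs Λ E ↔ extCfg Λ f ∈ E := by simp [cfgs]

lemma measurableSet_cyl (Λ : Finset Site) (f : Site → Bool) :
    MeasurableSet {ω : Config | ∀ v ∈ Λ, ω v = f v} := by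
  have : {ω : Config | ∀ v ∈ Λ, ω v = f v} = ⋂ v ∈ Λ, (fun ω : Config => ω v) ⁻¹' {f v} := by
    ext; simp
  rw [this]
  exact Finset.measurableSet_biInter _ fun v _ => measurable_pi_apply v (measurableSet_singleton _)

lemma LocOn.eq_biUnion {Λ : Finset Site} {E : Set Config} (hE : LocOn Λ E) :
    E = ⋃ f ∈ cfgs Λ E, {ω : Config | ∀ v ∈ Λ, ω v = extCfg Λ f v} := by
  ext ω
  simp only [Set.mem_iUnion, mem_cfgs, Set.mem_ofPred_eq, exists_prop]
  constructor
  · intro h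
    have h1 : ∀ v ∈ Λ, ω v = extCfg Λ (fun v : Λ => ω v) v := fun v hv => by rw [extCfg_mem _ hv]
    exact ⟨fun v => ω v, hE _ _ h1 h, h1⟩
  · rintro ⟨f, hf, h⟩
    exact hE _ _ (fun v hv => (h v hv).symm) hf

lemma IsLocal.measurableSet {E : Set Config} (hE : IsLocal E) : MeasurableSet E := by
  obtain ⟨Λ, hE⟩ := hE
  rw [hE.eq_biUnion]
  exact Finset.measurableSet_biUnion _ fun f _ => measurableSet_cyl _ _

/-- Any finite set of configurations extended by the two-configuration mixing along `R`. -/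
noncomputable def mixCfg (R : Config → Set Site) (ω ω' : Config) : Config :=
  fun v => open Classical in if v ∈ R ω then ω v else ω' v

lemma mixCfg_mem {R : Config → Set Site} {ω ω' : Config} {v : Site} (h : v ∈ R ω) :
    mixCfg R ω ω' v = ω v := by simp [mixCfg, h]

lemma mixCfg_not_mem {R : Config → Set Site} {ω ω' : Config} {v : Site} (h : v ∉ R ω) :
    mixCfg R ω ω' v = ω' v := by simp [mixCfg, h]

/-- The random set `R` is determined by the configuration inside it. -/
def Stopping (R : Config → Set Site) : Prop :=
  ∀ ω ω' : Config, (∀ v ∈ R ω, ω v = ω' v) → R ω' = R ω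

section

variable {μ : Measure Config} (hμ : IsBernoulliHalf μ)

include hμ

lemma LocOn.real_eq {Λ : Finset Site} {E : Set Config} (hE : LocOn Λ E) :
    μ.real E = (cfgs Λ E).card / 2 ^ Λ.card := by
  have := hμ.1
  conv_lhs => rw [hE.eq_biUnion]
  rw [measureReal_biUnion_finset]
  · have h : ∀ f : Λ → Bool, μ.real {ω : Config | ∀ v ∈ Λ, ω v = extCfg Λ f v} =
        1 / 2 ^ Λ.card := fun f => by
      rw [measureReal_def, hμ.2]; simp
    simp only [h, Finset.sum_const, nsmul_eq_mul]
    ring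
  · intro f _ g _ hfg
    refine Set.disjoint_left.2 fun ω h1 h2 => hfg ?_
    funext ⟨v, hv⟩
    have := (h1 v hv).symm.trans (h2 v hv)
    rwa [extCfg_mem _ hv, extCfg_mem _ hv] at this
  · exact fun f _ => measurableSet_cyl _ _

lemma IsLocal.real_congr {ν : Measure Config} (hν : IsBernoulliHalf ν) {E : Set Config}
    (hE : IsLocal E) : μ.real E = ν.real E := by
  obtain ⟨Λ, hE⟩ := hE
  rw [hE.real_eq hμ, hE.real_eq hν]

/-- Invariance under relabelling the sites and exchanging the colours. -/
lemma IsLocal.real_sym (σ : Site ≃ Site) (c : Bool) {E : Set Config} (hE : IsLocal E) :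
    μ.real {ω | (fun v => ω (σ v) ^^ c) ∈ E} = μ.real E := by
  have := hμ.1
  have hm : Measurable (fun (ω : Config) (v : Site) => ω (σ v) ^^ c) :=
    measurable_pi_lambda _ fun v =>
      (measurable_from_top (f := fun b : Bool => b ^^ c)).comp (measurable_pi_apply (σ v))
  have hν : IsBernoulliHalf (μ.map fun ω v => ω (σ v) ^^ c) := by
    refine ⟨Measure.isProbabilityMeasure_map hm.aemeasurable, fun S f => ?_⟩
    rw [Measure.map_apply hm (measurableSet_cyl _ _), ← Finset.card_map σ.toEmbedding,
      ← hμ.2 (S.map σ.toEmbedding) (fun v => f (σ.symm v) ^^ c)]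
    congr 1
    ext ω
    have hb : ∀ a b : Bool, ((a ^^ c) = b) ↔ a = (b ^^ c) := by
      intro a b; cases c <;> simp
    simp only [Set.mem_preimage, Set.mem_ofPred_eq, Finset.forall_mem_map, hb,
      Equiv.coe_toEmbedding, Equiv.symm_apply_apply]
  rw [IsLocal.real_congr hμ hν hE, measureReal_def, measureReal_def,
    Measure.map_apply hm hE.measurableSet]
  rfl

/-- The FKG inequality for events favoured by open sites. -/
lemma fkg_open {E F : Set Config} (hE : IsLocal E) (hF : IsLocal F) (hE' : ColMono true E)
    (hF' : ColMono true F) : μ.real E * μ.real F ≤ μ.real (E ∩ F) := by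
  classical
  obtain ⟨Λ₁, h1⟩ := hE
  obtain ⟨Λ₂, h2⟩ := hF
  replace h1 := h1.mono (Finset.subset_union_left (s₂ := Λ₂))
  replace h2 := h2.mono (Finset.subset_union_right (s₁ := Λ₁))
  set Λ := Λ₁ ∪ Λ₂
  have hext : ∀ f g : Λ → Bool, f ≤ g → ∀ v, extCfg Λ f v = true → extCfg Λ g v = true := by
    intro f g hfg v hv
    by_cases h : v ∈ Λ
    · rw [extCfg_mem _ h] at *
      have := hfg ⟨v, h⟩
      rw [hv] at this
      exact top_le_iff.1 this
    · rw [extCfg_not_mem _ h] at hv; simp at hv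
  have mono : ∀ E : Set Config, ColMono true E →
      Monotone (fun f : Λ → Bool => if extCfg Λ f ∈ E then (1 : ℝ) else 0) := by
    intro E hE f g hfg
    dsimp only
    split_ifs with h h'
    · exact le_rfl
    · exact absurd (hE _ _ (hext f g hfg) h) h'
    · exact zero_le_one
    · exact le_rfl
  have hnn : ∀ E : Set Config, 0 ≤ (fun f : Λ → Bool => if extCfg Λ f ∈ E then (1 : ℝ) else 0) := by
    intro E f
    simp only [Pi.zero_apply]
    positivity
  have key := fkg _ _ (fun _ : Λ → Bool => (1 : ℝ)) (fun _ => zero_le_one) (hnn E) (hnn F)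
    (mono E hE') (mono F hF') (by simp)
  have hcount : ∀ E : Set Config, (∑ f : Λ → Bool, if extCfg Λ f ∈ E then (1 : ℝ) else 0) =
      (cfgs Λ E).card := by
    intro E
    rw [Finset.sum_boole, cfgs]
  have hprod : ∀ f : Λ → Bool, (if extCfg Λ f ∈ E then (1 : ℝ) else 0) *
      (if extCfg Λ f ∈ F then (1 : ℝ) else 0) = if extCfg Λ f ∈ E ∩ F then 1 else 0 := by
    intro f
    by_cases h : extCfg Λ f ∈ E <;> by_cases h' : extCfg Λ f ∈ F <;> simp [h, h']
  have hEF : (∑ f : Λ → Bool, if extCfg Λ f ∈ E ∩ F then (1 : ℝ) else 0) =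
      (cfgs Λ (E ∩ F)).card := by
    rw [Finset.sum_boole, cfgs]
    congr!
  simp only [one_mul, hprod, hcount, hEF] at key
  simp only [Finset.sum_const, Finset.card_univ, Fintype.card_pi, Fintype.card_bool,
    Finset.prod_const, Fintype.card_coe, nsmul_eq_mul, mul_one] at key
  rw [h1.real_eq hμ, h2.real_eq hμ, (h1.inter h2).real_eq hμ, div_mul_div_comm,
    div_le_div_iff₀ (by positivity) (by positivity)]
  push_cast at key
  nlinarith [key, show (0 : ℝ) < 2 ^ Λ.card by positivity]

/-- The FKG inequality. -/
lemma fkg_col {c : Bool} {E F : Set Config} (hE : IsLocal E) (hF : IsLocal F) (hE' : ColMono c E)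
    (hF' : ColMono c F) : μ.real E * μ.real F ≤ μ.real (E ∩ F) := by
  cases c
  · set φ : Set Config → Set Config := fun E => {ω | (fun v => ω (Equiv.refl _ v) ^^ true) ∈ E}
    have hloc : ∀ E, IsLocal E → IsLocal (φ E) := fun E ⟨Λ, h⟩ =>
      ⟨Λ, fun ω ω' hω h' => h _ _ (fun v hv => by simp [hω v hv]) h'⟩
    have hmono : ∀ E, ColMono false E → ColMono true (φ E) := fun E h ω ω' hω h' =>
      h _ _ (fun v hv => by simpa using hω v (by simpa using hv)) h'
    have := fkg_open hμ (hloc _ hE) (hloc _ hF) (hmono _ hE') (hmono _ hF')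
    rwa [hE.real_sym hμ, hF.real_sym hμ,
      show φ E ∩ φ F = φ (E ∩ F) from rfl, (hE.inter hF).real_sym hμ] at this
  · exact fkg_open hμ hE hF hE' hF'

omit hμ in
open Classical in
lemma card_mix {R : Config → Set Site} (hR : Stopping R) (Λ : Finset Site) (E : Set Config) :
    (Finset.univ.filter fun p : (Λ → Bool) × (Λ → Bool) =>
      mixCfg R (extCfg Λ p.1) (extCfg Λ p.2) ∈ E).card = (cfgs Λ E).card * 2 ^ Λ.card := by
  set Φ : (Λ → Bool) × (Λ → Bool) → (Λ → Bool) × (Λ → Bool) := fun p =>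
    (fun v => if (v : Site) ∈ R (extCfg Λ p.1) then p.1 v else p.2 v,
      fun v => if (v : Site) ∈ R (extCfg Λ p.1) then p.2 v else p.1 v) with hΦ
  have hmix : ∀ p, extCfg Λ (Φ p).1 = mixCfg R (extCfg Λ p.1) (extCfg Λ p.2) := by
    intro p
    funext v
    by_cases hv : v ∈ Λ
    · by_cases h : v ∈ R (extCfg Λ p.1)
      · rw [mixCfg_mem h, extCfg_mem _ hv, extCfg_mem _ hv]; simp [Φ, h]
      · rw [mixCfg_not_mem h, extCfg_mem _ hv, extCfg_mem _ hv]; simp [Φ, h]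
    · rw [extCfg_not_mem _ hv, mixCfg, extCfg_not_mem _ hv, extCfg_not_mem _ hv, ite_self]
  have hinv : Function.Involutive Φ := by
    intro p
    have hR' : R (extCfg Λ (Φ p).1) = R (extCfg Λ p.1) :=
      hR _ _ fun v hv => by rw [hmix, mixCfg_mem hv]
    refine Prod.ext (funext fun v => ?_) (funext fun v => ?_)
    · change (if (v : Site) ∈ R (extCfg Λ (Φ p).1) then (Φ p).1 v else (Φ p).2 v) = p.1 v
      rw [hR']
      by_cases h : (v : Site) ∈ R (extCfg Λ p.1) <;> simp [Φ, h]
    · change (if (v : Site) ∈ R (extCfg Λ (Φ p).1) then (Φ p).2 v else (Φ p).1 v) = p.2 v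
      rw [hR']
      by_cases h : (v : Site) ∈ R (extCfg Λ p.1) <;> simp [Φ, h]
  have : (cfgs Λ E).card * 2 ^ Λ.card = (cfgs Λ E ×ˢ (Finset.univ : Finset (Λ → Bool))).card := by
    rw [Finset.card_product, Finset.card_univ]; simp
  rw [this]
  refine Finset.card_bij' (fun p _ => Φ p) (fun p _ => Φ p) ?_ ?_ (fun p _ => hinv p)
    (fun p _ => hinv p)
  · intro p hp
    simp only [Finset.mem_filter, Finset.mem_univ, true_and] at hp
    simp [mem_cfgs, hmix, hp]
  · intro p hp
    simp only [Finset.mem_product, mem_cfgs, Finset.mem_univ, and_true] at hp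
    simp only [Finset.mem_filter, Finset.mem_univ, true_and, ← hmix, hinv p, hp]

/-- If mixing two independent configurations along a stopping set turns `I` and `F` into `E`,
then `P(I) P(F) ≤ P(E)`. -/
lemma mix_le {R : Config → Set Site} (hR : Stopping R) {I F E : Set Config} (hI : IsLocal I)
    (hF : IsLocal F) (hE : IsLocal E)
    (h : ∀ ω ∈ I, ∀ ω' ∈ F, mixCfg R ω ω' ∈ E) : μ.real I * μ.real F ≤ μ.real E := by
  classical
  obtain ⟨Λ₁, h1⟩ := hI
  obtain ⟨Λ₂, h2⟩ := hF
  obtain ⟨Λ₃, h3⟩ := hE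
  replace h1 := h1.mono (show Λ₁ ⊆ Λ₁ ∪ (Λ₂ ∪ Λ₃) from fun v hv => by simp [hv])
  replace h2 := h2.mono (show Λ₂ ⊆ Λ₁ ∪ (Λ₂ ∪ Λ₃) from fun v hv => by simp [hv])
  replace h3 := h3.mono (show Λ₃ ⊆ Λ₁ ∪ (Λ₂ ∪ Λ₃) from fun v hv => by simp [hv])
  set Λ := Λ₁ ∪ (Λ₂ ∪ Λ₃)
  have hsub : cfgs Λ I ×ˢ cfgs Λ F ⊆ Finset.univ.filter fun p : (Λ → Bool) × (Λ → Bool) =>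
      mixCfg R (extCfg Λ p.1) (extCfg Λ p.2) ∈ E := by
    intro p hp
    simp only [Finset.mem_product, mem_cfgs] at hp
    simpa using h _ hp.1 _ hp.2
  have := Finset.card_le_card hsub
  rw [card_mix hR, Finset.card_product] at this
  rw [h1.real_eq hμ, h2.real_eq hμ, h3.real_eq hμ, div_mul_div_comm,
    div_le_div_iff₀ (by positivity) (by positivity)]
  have h' : ((cfgs Λ I).card : ℝ) * (cfgs Λ F).card ≤ (cfgs Λ E).card * 2 ^ Λ.card := by
    exact_mod_cast this
  nlinarith [h', show (0 : ℝ) < 2 ^ Λ.card by positivity]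

/-- If for each second configuration, mixing with it or with its reflection with exchanged colours
turns `I` into `E`, then `P(I) ≤ 2 P(E)`. -/
lemma mix_half {R : Config → Set Site} (hR : Stopping R) {I E : Set Config} (hI : IsLocal I)
    (hE : IsLocal E) (σ : Site ≃ Site) (hσ : ∀ v, σ (σ v) = v)
    (h : ∀ ω ∈ I, ∀ ω', mixCfg R ω ω' ∈ E ∨ mixCfg R ω (fun v => !(ω' (σ v))) ∈ E) :
    μ.real I ≤ 2 * μ.real E := by
  classical
  obtain ⟨Λ₁, h1⟩ := hI
  obtain ⟨Λ₂, h2⟩ := hE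
  set Λ := (Λ₁ ∪ Λ₂) ∪ (Λ₁ ∪ Λ₂).map σ.toEmbedding with hΛ
  have hΛσ : ∀ v, v ∈ Λ → σ v ∈ Λ := by
    intro v hv
    simp only [hΛ, Finset.mem_union, Finset.mem_map, Equiv.coe_toEmbedding] at hv ⊢
    rcases hv with hv | ⟨u, hu, rfl⟩
    · exact .inr ⟨v, hv, rfl⟩
    · rw [hσ]; exact .inl hu
  replace h1 := h1.mono (show Λ₁ ⊆ Λ from fun v hv => by simp [hΛ, hv])
  replace h2 := h2.mono (show Λ₂ ⊆ Λ from fun v hv => by simp [hΛ, hv])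
  set G := Finset.univ.filter fun p : (Λ → Bool) × (Λ → Bool) =>
      mixCfg R (extCfg Λ p.1) (extCfg Λ p.2) ∈ E with hG
  let ψ : (Λ → Bool) → (Λ → Bool) := fun g v => !(g ⟨σ v, hΛσ v v.2⟩)
  have hψ : Function.Involutive ψ := by
    intro g
    funext v
    simp [ψ, hσ]
  have hsub : cfgs Λ I ×ˢ (Finset.univ : Finset (Λ → Bool)) ⊆
      G ∪ G.map ⟨fun p => (p.1, ψ p.2), fun p q hpq => by
        simp only [Prod.mk.injEq] at hpq
        exact Prod.ext hpq.1 (hψ.injective hpq.2)⟩ := by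
    intro p hp
    simp only [Finset.mem_product, mem_cfgs, Finset.mem_univ, and_true] at hp
    rcases h _ hp (extCfg Λ p.2) with h' | h'
    · exact Finset.mem_union_left _ (by simpa [hG] using h')
    · refine Finset.mem_union_right _ (Finset.mem_map.2 ⟨(p.1, ψ p.2), ?_, ?_⟩)
      · simp only [hG, Finset.mem_filter, Finset.mem_univ, true_and]
        refine h2 _ _ (fun v hv => ?_) h'
        by_cases hvR : v ∈ R (extCfg Λ p.1)
        · rw [mixCfg_mem hvR, mixCfg_mem hvR]
        · rw [mixCfg_not_mem hvR, mixCfg_not_mem hvR, extCfg_mem _ hv, extCfg_mem _ (hΛσ v hv)]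
      · exact Prod.ext rfl (hψ p.2)
  have := (Finset.card_le_card hsub).trans (Finset.card_union_le _ _)
  rw [Finset.card_map, hG, card_mix hR, Finset.card_product, Finset.card_univ] at this
  simp only [Fintype.card_pi, Fintype.card_bool, Finset.prod_const, Finset.card_univ,
    Fintype.card_coe] at this
  rw [h1.real_eq hμ, h2.real_eq hμ, ← mul_div_assoc]
  gcongr
  have h' : ((cfgs Λ I).card : ℝ) * 2 ^ Λ.card ≤ (2 * (cfgs Λ E).card) * 2 ^ Λ.card := by
    have : (cfgs Λ I).card * 2 ^ Λ.card ≤ (2 * (cfgs Λ E).card) * 2 ^ Λ.card := by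
      rw [mul_assoc]; omega
    exact_mod_cast this
  exact le_of_mul_le_mul_right h' (by positivity)

end

/-- There is a path of colour `c` inside `X` from `A` to `B`. -/
def joinEv (c : Bool) (X A B : Set Site) : Set Config :=
  {ω | ∃ a ∈ A, ∃ b ∈ B, Conn ({v | ω v = c} ∩ X) a b}

lemma joinEv_isLocal {c : Bool} {X A B : Set Site} (hX : X.Finite) : IsLocal (joinEv c X A B) := by
  refine ⟨hX.toFinset, fun ω ω' h => ?_⟩
  rintro ⟨a, ha, b, hb, hab⟩
  refine ⟨a, ha, b, hb, hab.mono ?_⟩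
  rintro v ⟨hv, hvX⟩
  exact ⟨(h v (by simpa using hvX)).symm.trans hv, hvX⟩

lemma joinEv_colMono {c : Bool} {X A B : Set Site} : ColMono c (joinEv c X A B) := by
  rintro ω ω' h ⟨a, ha, b, hb, hab⟩
  exact ⟨a, ha, b, hb, hab.mono fun v hv => ⟨h v hv.1, hv.2⟩⟩

lemma rect_finite (x₀ x₁ y₀ y₁ : ℤ) : (rect x₀ x₁ y₀ y₁).Finite := by
  refine ((Set.finite_Icc x₀ x₁).prod (Set.finite_Icc y₀ y₁)).subset ?_
  rintro v ⟨h1, h2, h3, h4⟩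
  exact ⟨⟨h1, h2⟩, h3, h4⟩

lemma joinEv_real_le {μ : Measure Config} (hμ : IsBernoulliHalf μ) {c c' : Bool}
    {X A B X' A' B' : Set Site} (hX : X.Finite) (σ : Site ≃ Site)
    (hσ : ∀ u v, Adj u v → Adj (σ u) (σ v)) (h1 : ∀ v ∈ X, σ v ∈ X') (h2 : ∀ v ∈ X, v ∈ A → σ v ∈ A')
    (h3 : ∀ v ∈ X, v ∈ B → σ v ∈ B') : μ.real (joinEv c X A B) ≤ μ.real (joinEv c' X' A' B') := by
  have := hμ.1
  rw [← (joinEv_isLocal hX).real_sym hμ σ (c ^^ c')]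
  refine measureReal_mono ?_
  rintro ω ⟨a, ha, b, hb, hab⟩
  refine ⟨σ a, h2 _ hab.left_mem.2 ha, σ b, h3 _ hab.right_mem.2 hb, hab.map σ hσ ?_⟩
  rintro u ⟨hu, huX⟩
  refine ⟨?_, h1 _ huX⟩
  simp only [Set.mem_ofPred_eq] at hu ⊢
  revert hu; cases c <;> cases c' <;> simp

/-- Left-right crossing of a rectangle. -/
def lrEv (c : Bool) (x₀ x₁ y₀ y₁ : ℤ) : Set Config :=
  joinEv c (rect x₀ x₁ y₀ y₁) {v | v.1 = x₀} {v | v.1 = x₁}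

/-- Bottom-top crossing of a rectangle. -/
def tbEv (c : Bool) (x₀ x₁ y₀ y₁ : ℤ) : Set Config :=
  joinEv c (rect x₀ x₁ y₀ y₁) {v | v.2 = y₀} {v | v.2 = y₁}

/-- The closed cluster of `Bs` in `X`. -/
def clus (X Bs : Set Site) (ω : Config) : Set Site :=
  {v | ∃ b ∈ Bs, Conn ({v | ω v = false} ∩ X) b v}

/-- The sites examined when exploring the closed cluster of `Bs` in `X`. -/
def expl (X Bs : Set Site) (ω : Config) : Set Site :=
  {v | v ∈ X ∧ (v ∈ Bs ∨ ∃ k ∈ clus X Bs ω, Adj k v)}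

section

variable {X Bs : Set Site} {ω ω' : Config}

lemma clus_sub {v : Site} (h : v ∈ clus X Bs ω) : ω v = false ∧ v ∈ X := by
  obtain ⟨b, _, h⟩ := h
  exact h.right_mem

lemma clus_tail {u v : Site} (h : u ∈ clus X Bs ω) (huv : Adj u v) (hv : ω v = false) (hvX : v ∈ X) :
    v ∈ clus X Bs ω := by
  obtain ⟨b, hb, h⟩ := h
  exact ⟨b, hb, h.tail huv ⟨hv, hvX⟩⟩

lemma clus_sub_expl {v : Site} (h : v ∈ clus X Bs ω) : v ∈ expl X Bs ω := by
  obtain ⟨b, hb, h⟩ := h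
  induction h using Conn.induct with
  | h0 h => exact ⟨h.left_mem.2, .inl hb⟩
  | h1 u v hu huv hv ih => exact ⟨hv.2, .inr ⟨u, ⟨b, hb, hu⟩, huv⟩⟩

lemma mem_clus_of_expl {v : Site} (h : v ∈ expl X Bs ω) (hv : ω v = false) : v ∈ clus X Bs ω := by
  obtain ⟨hX, h | ⟨k, hk, hkv⟩⟩ := h
  · exact ⟨v, h, .refl ⟨hv, hX⟩⟩
  · exact clus_tail hk hkv hv hX

/-- A site of the cluster is connected to the base within the cluster. -/
lemma clus_conn {v : Site} (h : v ∈ clus X Bs ω) : ∃ b ∈ Bs, Conn (clus X Bs ω) b v := by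
  obtain ⟨b, hb, h⟩ := h
  exact ⟨b, hb, h.comp.mono fun z hz => ⟨b, hb, hz⟩⟩

/-- An explored site is connected to the base by the cluster and itself. -/
lemma expl_conn {v : Site} (h : v ∈ expl X Bs ω) :
    ∃ b ∈ Bs, Conn (insert v (clus X Bs ω)) b v := by
  obtain ⟨hX, h | ⟨k, hk, hkv⟩⟩ := h
  · exact ⟨v, h, .refl (Set.mem_insert _ _)⟩
  · obtain ⟨b, hb, h⟩ := clus_conn hk
    exact ⟨b, hb, (h.mono (Set.subset_insert _ _)).tail hkv (Set.mem_insert _ _)⟩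

lemma clus_congr (h : ∀ v ∈ expl X Bs ω, ω v = ω' v) : clus X Bs ω' = clus X Bs ω := by
  ext v
  constructor
  · rintro ⟨b, hb, hv⟩
    induction hv using Conn.induct with
    | h0 hb' =>
      refine ⟨b, hb, .refl ⟨?_, hb'.left_mem.2⟩⟩
      exact (h b ⟨hb'.left_mem.2, .inl hb⟩).trans hb'.left_mem.1
    | h1 u v _ huv hv ih =>
      exact clus_tail ih huv ((h v ⟨hv.2, .inr ⟨u, ih, huv⟩⟩).trans hv.1) hv.2
  · intro hv
    obtain ⟨b, hb, hv⟩ := clus_conn hv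
    refine ⟨b, hb, hv.mono fun z hz => ⟨?_, (clus_sub hz).2⟩⟩
    exact (h z (clus_sub_expl hz)).symm.trans (clus_sub hz).1

lemma expl_congr (h : ∀ v ∈ expl X Bs ω, ω v = ω' v) : expl X Bs ω' = expl X Bs ω := by
  simp only [expl, clus_congr h]

lemma expl_stopping : Stopping (expl X Bs) := fun _ _ => expl_congr

end

/-- Trapezoid of height `h`. -/
def trap (h L : ℤ) : Set Site := {v | 0 ≤ v.2 ∧ v.2 ≤ h ∧ 0 ≤ v.1 ∧ v.1 + v.2 ≤ L}

/-- Left half of the trapezoid. -/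
def trapL (h L : ℤ) : Set Site := {v | 0 ≤ v.2 ∧ v.2 ≤ h ∧ 0 ≤ v.1 ∧ 2 * v.1 + v.2 ≤ L}

/-- The reflection of the lattice exchanging the two halves of the trapezoid. -/
def trapRefl (L : ℤ) : Site ≃ Site where
  toFun v := (L - v.1 - v.2, v.2)
  invFun v := (L - v.1 - v.2, v.2)
  left_inv v := Prod.ext (by dsimp only; ring) rfl
  right_inv v := Prod.ext (by dsimp only; ring) rfl

lemma trapRefl_fst (L : ℤ) (v : Site) : (trapRefl L v).1 = L - v.1 - v.2 := rfl

lemma trapRefl_snd (L : ℤ) (v : Site) : (trapRefl L v).2 = v.2 := rfl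

lemma trapRefl_invol (L : ℤ) (v : Site) : trapRefl L (trapRefl L v) = v :=
  (trapRefl L).left_inv v

lemma trapRefl_adj (L : ℤ) (u v : Site) (h : Adj u v) : Adj (trapRefl L u) (trapRefl L v) := by
  rw [adj_iff] at *
  simp only [trapRefl_fst, trapRefl_snd]
  omega

lemma trapL_sub {h L : ℤ} {v : Site} (hv : v ∈ trapL h L) : v ∈ trap h L := by
  obtain ⟨h1, h2, h3, h4⟩ := hv
  exact ⟨h1, h2, h3, by omega⟩

lemma trapRefl_mem {h L : ℤ} {v : Site} (hv : v ∈ trap h L) : trapRefl L v ∈ trap h L := by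
  obtain ⟨h1, h2, h3, h4⟩ := hv
  refine ⟨h1, h2, ?_, ?_⟩ <;> simp only [trapRefl_fst, trapRefl_snd] <;> omega

lemma mem_trapL_or {h L : ℤ} {v : Site} (hv : v ∈ trap h L) :
    v ∈ trapL h L ∨ trapRefl L v ∈ trapL h L := by
  obtain ⟨h1, h2, h3, h4⟩ := hv
  by_cases hc : 2 * v.1 + v.2 ≤ L
  · exact .inl ⟨h1, h2, h3, hc⟩
  · refine .inr ⟨h1, h2, ?_, ?_⟩ <;> simp only [trapRefl_fst, trapRefl_snd] <;> omega

lemma trapRefl_eq {h L : ℤ} {v : Site} (hv : v ∈ trapL h L) (hv' : trapRefl L v ∈ trapL h L) :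
    trapRefl L v = v := by
  obtain ⟨h1, h2, h3, h4⟩ := hv
  obtain ⟨h1', h2', h3', h4'⟩ := hv'
  simp only [trapRefl_fst, trapRefl_snd] at h4'
  exact Prod.ext (by rw [trapRefl_fst]; omega) rfl

lemma trap_finite (h L : ℤ) : (trap h L).Finite := by
  refine (rect_finite 0 L 0 h).subset ?_
  rintro v ⟨h1, h2, h3, h4⟩
  exact ⟨h3, by omega, h1, h2⟩

/-- Crossing of a trapezoid from its left side to its right side or to the right half of its top. -/
def trapEv (h L : ℤ) : Set Config :=
  joinEv true (trap h L) {v | v.1 = 0} {v | v.1 + v.2 = L ∨ v.2 = h ∧ L ≤ 2 * v.1 + h}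

/-- Crossing of the left half of a trapezoid. -/
def trapLEv (h L : ℤ) : Set Config :=
  joinEv true (trapL h L) {v | v.1 = 0} {v | L - 1 ≤ 2 * v.1 + v.2}

/-- A path started in `A` either stays in `A` or has a first exit from `A`. -/
lemma Conn.stay_or_exit {S A : Set Site} {a b : Site} (h : Conn S a b) (ha : a ∈ A) :
    (b ∈ A ∧ Conn (S ∩ A) a b) ∨ ∃ p u, Conn (S ∩ A) a p ∧ Adj p u ∧ u ∈ S ∧ u ∉ A := by
  induction h using Conn.induct with
  | h0 h => exact .inl ⟨ha, .refl ⟨h.left_mem, ha⟩⟩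
  | h1 u v hu huv hv ih =>
    rcases ih with ⟨hm, ih⟩ | ih
    · by_cases hvA : v ∈ A
      · exact .inl ⟨hvA, ih.tail huv ⟨hv, hvA⟩⟩
      · exact .inr ⟨u, v, ih, huv, hv, hvA⟩
    · exact .inr ih

lemma trapEv_dual {h L : ℤ} (hL : Even L) (hh : Even h) (h2 : 2 ≤ h) (hhL : h < L) {η : Config}
    (hη : η ∉ trapEv h L) : ∃ a b : Site, a.2 = 0 ∧ b.2 = h ∧ 2 * b.1 + h ≤ L ∧
      Conn (trap h L ∩ {v | η v = false}) a b := by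
  obtain ⟨L, rfl⟩ := hL
  obtain ⟨h, rfl⟩ := hh
  rcases hex (x₀ := 0) (x₁ := L + L) (y₀ := 0) (y₁ := h + h + 1)
    ({v | v ∈ trap (h + h) (L + L) ∧ η v = true} ∪ {v | L + L < v.1 + v.2 ∧ v.2 ≤ h + h} ∪
      {v | v.2 = h + h + 1 ∧ L + L - 1 ≤ 2 * v.1 + (h + h)}) (by omega) (by omega) with
    ⟨a, b, ha, hb, hab⟩ | ⟨a, b, ha, hb, hab⟩
  · exfalso
    apply hη
    have haT : a ∈ trap (h + h) (L + L) := by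
      obtain ⟨(h1 | h1) | h1, h3⟩ := hab.left_mem
      · exact h1.1
      · simp only [Set.mem_ofPred_eq] at h1; omega
      · simp only [Set.mem_ofPred_eq] at h1; omega
    have hsub : ∀ z, z ∈ (({v | v ∈ trap (h + h) (L + L) ∧ η v = true} ∪
        {v | L + L < v.1 + v.2 ∧ v.2 ≤ h + h} ∪
        {v | v.2 = h + h + 1 ∧ L + L - 1 ≤ 2 * v.1 + (h + h)}) ∩ rect 0 (L + L) 0 (h + h + 1)) ∩
        trap (h + h) (L + L) → z ∈ {v | η v = true} ∩ trap (h + h) (L + L) := by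
      rintro z ⟨⟨hz1, -⟩, hz⟩
      refine ⟨?_, hz⟩
      obtain ⟨z1, z2, z3, z4⟩ := hz
      rcases hz1 with (hz1 | hz1) | hz1
      · exact hz1.2
      · simp only [Set.mem_ofPred_eq] at hz1; omega
      · simp only [Set.mem_ofPred_eq] at hz1; omega
    rcases hab.stay_or_exit haT with ⟨⟨h1, h2, h3, h4⟩, hc⟩ | ⟨p, u, hp, hpu, ⟨hu, hur⟩, huT⟩
    · refine ⟨a, ha, b, ?_, hc.mono hsub⟩
      simp only [Set.mem_ofPred_eq]
      omega
    · refine ⟨a, ha, p, ?_, hp.mono hsub⟩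
      obtain ⟨h1, h2, h3, h4⟩ := hp.right_mem.2
      simp only [Set.mem_ofPred_eq]
      rw [adj_iff] at hpu
      rcases hu with (hu | hu) | hu
      · exact absurd hu.1 huT
      · simp only [Set.mem_ofPred_eq] at hu; omega
      · simp only [Set.mem_ofPred_eq] at hu; omega
  · obtain ⟨p, u, hp, hpu, hu, hu'⟩ := hab.exit (E := {v | v.2 = h + h + 1})
      (by simp only [Set.mem_ofPred_eq]; omega) hb
    simp only [Set.mem_ofPred_eq] at hu'
    have hsub : ∀ z, z ∈ (rect 0 (L + L) 0 (h + h + 1) \ ({v | v ∈ trap (h + h) (L + L) ∧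
        η v = true} ∪ {v | L + L < v.1 + v.2 ∧ v.2 ≤ h + h} ∪
        {v | v.2 = h + h + 1 ∧ L + L - 1 ≤ 2 * v.1 + (h + h)})) \ {v | v.2 = h + h + 1} →
        z ∈ trap (h + h) (L + L) ∩ {v | η v = false} := by
      rintro z ⟨⟨⟨z1, z2, z3, z4⟩, hz⟩, hz'⟩
      simp only [Set.mem_union, Set.mem_ofPred_eq, not_or] at hz hz'
      have hzT : z ∈ trap (h + h) (L + L) := ⟨z3, by omega, z1, by omega⟩
      exact ⟨hzT, by simpa using fun h' => hz.1.1 ⟨hzT, h'⟩⟩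
    have hpT := (hsub p hp.right_mem).1
    refine ⟨a, p, ha, ?_, ?_, hp.mono hsub⟩
    all_goals
      obtain ⟨h1, h2, h3, h4⟩ := hpT
      have := hu.2
      simp only [Set.mem_union, Set.mem_ofPred_eq, not_or] at this
      rw [adj_iff] at hpu
      omega

/-- The closed cluster of the bottom of the left half trapezoid. -/
abbrev tclus (h L : ℤ) (ω : Config) : Set Site := clus (trapL h L) {v | v.2 = 0} ω

/-- The exploration of the bottom cluster of the left half trapezoid. -/
abbrev texpl (h L : ℤ) (ω : Config) : Set Site := expl (trapL h L) {v | v.2 = 0} ω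

/-- The explored region and its reflection. -/
def symExpl (h L : ℤ) (ω : Config) : Set Site :=
  {v | v ∈ texpl h L ω ∨ trapRefl L v ∈ texpl h L ω}

section

variable {h L : ℤ} {ω : Config}

lemma clus_trapL_top (hω : ω ∈ trapLEv h L) {k : Site} (hk : k ∈ tclus h L ω) : k.2 ≠ h := by
  intro hkh
  obtain ⟨b, hb, hbk⟩ := clus_conn hk
  obtain ⟨a, ha, g, hg, hag⟩ := hω
  have hgL := hag.right_mem.2
  set S : Set Site := {v | 0 ≤ v.2 ∧ v.2 ≤ h ∧ (v ∈ trapL h L → ω v = true)} with hS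
  have h1 : Conn S a g := hag.mono fun z hz => ⟨hz.2.1, hz.2.2.1, fun _ => hz.1⟩
  have h2 : Conn S g (max g.1 L, g.2) := by
    refine Conn.hseg g.1 _ g.2 (le_max_left _ _) fun i hi _ => ?_
    obtain ⟨h1, h2, h3, h4⟩ := hgL
    refine ⟨h1, h2, fun hiL => ?_⟩
    rcases hi.eq_or_lt with rfl | hi
    · exact hag.right_mem.1
    · obtain ⟨-, -, -, h4'⟩ := hiL
      simp only [Set.mem_ofPred_eq] at hg h4'
      omega
  have hK : ∀ v ∈ tclus h L ω, 0 ≤ v.1 ∧ v.1 ≤ L := fun v hv => by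
    obtain ⟨h1, h2, h3, h4⟩ := (clus_sub hv).2
    exact ⟨h3, by omega⟩
  obtain ⟨z, hz, hz'⟩ := crossing_meet (x₀ := 0) (x₁ := L) (y₀ := 0) (y₁ := h)
    (fun v hv => ⟨hv.1, hv.2.1⟩) hK (h1.trans h2) (le_of_eq ha) (le_max_right _ _)
    hbk (le_of_eq hb) hkh.ge
  have := hz.2.2 (clus_sub hz').2
  rw [(clus_sub hz').1] at this
  cases this

lemma expl_trapL_crossing (h0 : 0 ≤ h) (hhL : h < L) (hω : ω ∈ trapLEv h L) :
    ∃ g p : Site, g.1 = 0 ∧ L - 1 ≤ 2 * p.1 + p.2 ∧ Conn (texpl h L ω ∩ {v | ω v = true}) g p := by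
  rcases hex (x₀ := 0) (x₁ := L) (y₀ := 0) (y₁ := h)
    ((texpl h L ω ∩ {v | ω v = true}) ∪ {v | L < 2 * v.1 + v.2}) (by omega) (by omega) with
    ⟨a, b, ha, hb, hab⟩ | ⟨a, b, ha, hb, hab⟩
  · have har := hab.left_mem.2
    have hbr := hab.right_mem.2
    obtain ⟨p, u, hp, hpu, hu, hu'⟩ := hab.exit (E := {v | L < 2 * v.1 + v.2})
      (by have := har.2.2.2; simp only [Set.mem_ofPred_eq]; omega)
      (by have := hbr.2.2.1; simp only [Set.mem_ofPred_eq]; omega)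
    refine ⟨a, p, ha, ?_, hp.mono ?_⟩
    · rw [adj_iff] at hpu
      simp only [Set.mem_ofPred_eq] at hu'
      omega
    · rintro z ⟨⟨hz | hz, -⟩, hz'⟩
      · exact hz
      · exact absurd hz hz'
  · exfalso
    have hmem : ∀ z, z ∈ rect 0 L 0 h \ ((texpl h L ω ∩ {v | ω v = true}) ∪ {v | L < 2 * v.1 + v.2}) →
        z ∈ trapL h L ∧ (z ∈ texpl h L ω → z ∈ tclus h L ω) := by
      rintro z ⟨⟨h1, h2, h3, h4⟩, hz⟩
      simp only [Set.mem_union, Set.mem_inter_iff, Set.mem_ofPred_eq, not_or, not_and] at hz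
      refine ⟨⟨h3, h4, h1, by omega⟩, fun hzX => mem_clus_of_expl hzX ?_⟩
      simpa using hz.1 hzX
    refine clus_trapL_top (k := b) hω ?_ hb
    clear hb
    induction hab using Conn.induct with
    | h0 hab => exact (hmem _ hab.left_mem).2 ⟨(hmem _ hab.left_mem).1, .inl ha⟩
    | h1 u v hu huv hv ih => exact (hmem _ hv).2 ⟨(hmem _ hv).1, .inr ⟨u, ih, huv⟩⟩

lemma symExpl_refl {v : Site} (hv : v ∈ symExpl h L ω) : trapRefl L v ∈ symExpl h L ω := by
  rcases hv with hv | hv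
  · exact .inr (by rwa [trapRefl_invol])
  · exact .inl hv

lemma symExpl_of_adj {s p : Site} (hs : s ∈ tclus h L ω) (hsp : Adj s p) (hp : p ∈ trap h L) : p ∈ symExpl h L ω := by
  by_cases hpL : p ∈ trapL h L
  · exact .inl ⟨hpL, .inr ⟨s, hs, hsp⟩⟩
  have hpL' := (mem_trapL_or hp).resolve_left hpL
  have hsL := (clus_sub hs).2
  have : trapRefl L p = s ∨ Adj s (trapRefl L p) := by
    obtain ⟨h1, h2, h3, h4⟩ := hp
    obtain ⟨h1', h2', h3', h4'⟩ := hsL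
    have hlt : L < 2 * p.1 + p.2 := by
      by_contra! hcon
      exact hpL ⟨h1, h2, h3, hcon⟩
    by_cases hE : trapRefl L p = s
    · exact .inl hE
    · right
      have hE' : ¬ (L - p.1 - p.2 = s.1 ∧ p.2 = s.2) := fun hc => hE (Prod.ext hc.1 hc.2)
      rw [adj_iff] at *
      simp only [trapRefl_fst, trapRefl_snd]
      omega
  rcases this with h1 | h1
  · exact .inr (h1 ▸ clus_sub_expl hs)
  · exact .inr ⟨hpL', .inr ⟨s, hs, h1⟩⟩

lemma symExpl_of_adj' {s p : Site} (hs : trapRefl L s ∈ tclus h L ω) (hsp : Adj s p) (hp : p ∈ trap h L) :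
    p ∈ symExpl h L ω := by
  have := symExpl_refl (symExpl_of_adj hs (trapRefl_adj L s p hsp) (trapRefl_mem hp))
  rwa [trapRefl_invol] at this

lemma symExpl_base {v : Site} (hv : v.2 = 0) (hv' : v ∈ trap h L) : v ∈ symExpl h L ω := by
  rcases mem_trapL_or hv' with h1 | h1
  · exact .inl ⟨h1, .inl hv⟩
  · exact .inr ⟨h1, .inl hv⟩

lemma not_mem_symExpl (hω : ω ∈ trapLEv h L) {t : Site} (ht : t.2 = h)
    (htL : 2 * t.1 + h ≤ L) (hT : t ∈ trap h L) (hc : t ∈ texpl h L ω → ω t = false) : t ∉ symExpl h L ω := by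
  have h1 : t ∉ texpl h L ω := fun hX => clus_trapL_top hω (mem_clus_of_expl hX (hc hX)) ht
  rintro (hX | hX)
  · exact h1 hX
  · have htL' : t ∈ trapL h L := ⟨hT.1, hT.2.1, hT.2.2.1, by omega⟩
    rw [trapRefl_eq htL' hX.1] at hX
    exact h1 hX

lemma trapEv_of_mix (hL : Even L) (hh : Even h) (h2 : 2 ≤ h) (hhL : h < L) (hω : ω ∈ trapLEv h L)
    (ω' : Config) : mixCfg (texpl h L) ω ω' ∈ trapEv h L ∨
      mixCfg (texpl h L) ω (fun v => !(ω' (trapRefl L v))) ∈ trapEv h L := by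
  by_contra! hcon
  obtain ⟨hm1, hm2⟩ := hcon
  set η₁ := mixCfg (texpl h L) ω ω' with hη₁
  set η₂ := mixCfg (texpl h L) ω (fun v => !(ω' (trapRefl L v))) with hη₂
  have h0 : 0 ≤ h := by omega
  obtain ⟨b₁, t₁, hb₁, ht₁, htL₁, hτ₁⟩ := trapEv_dual hL hh h2 hhL hm1
  obtain ⟨b₂, t₂, hb₂, ht₂, htL₂, hτ₂⟩ := trapEv_dual hL hh h2 hhL hm2
  obtain ⟨g, p, hg, hp, hgp⟩ := expl_trapL_crossing h0 hhL hω
  have ht₁D : t₁ ∉ symExpl h L ω := not_mem_symExpl hω ht₁ htL₁ hτ₁.right_mem.1 fun hX => by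
    rw [← hτ₁.right_mem.2, hη₁, mixCfg_mem hX]
  have ht₂D : trapRefl L t₂ ∉ symExpl h L ω := fun hX => by
    have := symExpl_refl hX
    rw [trapRefl_invol] at this
    exact not_mem_symExpl hω ht₂ htL₂ hτ₂.right_mem.1 (fun hX => by
      rw [← hτ₂.right_mem.2, hη₂, mixCfg_mem hX]) this
  -- the two vertical dual paths followed down to the explored region
  obtain ⟨p₁, s, hδ₁, hps, hsS, hsD⟩ := hτ₁.symm.exit ht₁D (symExpl_base hb₁ hτ₁.left_mem.1)
  obtain ⟨p₂, s', hδ₂, hps', hsS', hsD'⟩ := (hτ₂.symm.map (trapRefl L) (trapRefl_adj L)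
    (S' := {v | v ∈ trap h L ∧ η₂ (trapRefl L v) = false}) (fun u hu =>
      ⟨trapRefl_mem hu.1, by rw [trapRefl_invol]; exact hu.2⟩)).exit ht₂D
    (symExpl_refl (symExpl_base hb₂ hτ₂.left_mem.1))
  set P₁ : Set Site := {v | v ∈ trap h L ∧ v ∉ symExpl h L ω ∧ ω' v = false}
  set P₂ : Set Site := {v | v ∈ trap h L ∧ v ∉ symExpl h L ω ∧ ω' v = true}
  have hsub₁ : ∀ z, z ∈ (trap h L ∩ {v | η₁ v = false}) \ symExpl h L ω → z ∈ P₁ := by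
    rintro z ⟨⟨hzT, hz⟩, hzD⟩
    refine ⟨hzT, hzD, ?_⟩
    rwa [Set.mem_ofPred_eq, hη₁, mixCfg_not_mem fun hX => hzD (.inl hX)] at hz
  have hsub₂ : ∀ z, z ∈ {v | v ∈ trap h L ∧ η₂ (trapRefl L v) = false} \ symExpl h L ω →
      z ∈ P₂ := by
    rintro z ⟨⟨hzT, hz⟩, hzD⟩
    refine ⟨hzT, hzD, ?_⟩
    rw [hη₂, mixCfg_not_mem fun hX => hzD (.inr hX), trapRefl_invol] at hz
    simpa using hz
  replace hδ₁ := hδ₁.mono hsub₁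
  replace hδ₂ := hδ₂.mono hsub₂
  have hopen : ∀ z, z ∈ texpl h L ω ∩ {v | ω v = true} → z ∈ trapL h L ∧ z ∉ tclus h L ω := by
    rintro z ⟨hz, hz'⟩
    refine ⟨hz.1, fun hK => ?_⟩
    rw [Set.mem_ofPred_eq, (clus_sub hK).1] at hz'
    cases hz'
  have hs : s ∉ texpl h L ω := fun hX => by
    refine hδ₁.right_mem.2.1 (symExpl_of_adj (mem_clus_of_expl hX ?_) hps.symm hδ₁.right_mem.1)
    rw [← hsS.2, hη₁, mixCfg_mem hX]
  have hs2 : trapRefl L s ∈ texpl h L ω := hsD.resolve_left hs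
  have hs'2 : trapRefl L s' ∉ texpl h L ω := fun hX => by
    refine hδ₂.right_mem.2.1 (symExpl_of_adj' (mem_clus_of_expl hX ?_) hps'.symm hδ₂.right_mem.1)
    rw [← hsS'.2, hη₂, mixCfg_mem hX]
  have hs' : s' ∈ texpl h L ω := hsD'.resolve_right hs'2
  -- the crossing `g → p` of the explored region separates its bottom cluster from the top
  have hs'G : Conn (texpl h L ω ∩ {v | ω v = true}) g s' := by
    set G : Set Site := {z | Conn (texpl h L ω ∩ {v | ω v = true}) g z} with hG
    set S : Set Site := {z | z ∈ G ∨ trapRefl L z ∈ G ∨ 0 ≤ z.2 ∧ z.2 ≤ h ∧ L < z.1 + z.2}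
    obtain ⟨b, hb, hbs⟩ := expl_conn hs'
    have hGs : ∀ z ∈ G, z ∈ trapL h L := fun z hz => (hopen z (Conn.right_mem hz)).1
    have hpT := hGs p hgp
    have hgT := hGs g (.refl hgp.left_mem)
    have c1 : Conn S g p := hgp.comp.mono fun z hz => .inl hz
    have c2 : Conn S p (trapRefl L p) := by
      have hmem : trapRefl L p ∈ S := .inr (.inl (by rwa [trapRefl_invol]))
      by_cases hE : trapRefl L p = p
      · rw [hE]; exact .refl c1.right_mem
      · refine .single c1.right_mem ?_ hmem
        have hE' : ¬ (L - p.1 - p.2 = p.1) := fun hc => hE (Prod.ext hc rfl)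
        have : 2 * p.1 + p.2 ≤ L := hpT.2.2.2
        refine adj_iff.2 (.inl ⟨?_, rfl⟩)
        rw [trapRefl_fst]
        omega
    have c3 : Conn S (trapRefl L p) (trapRefl L g) := by
      refine (hgp.comp.map (trapRefl L) (trapRefl_adj L) fun z hz => ?_).symm
      exact .inr (.inl (by rwa [trapRefl_invol]))
    have c4 : Conn S (trapRefl L g) (L, g.2) := by
      have hgE : trapRefl L g = (L - g.2, g.2) := Prod.ext (by rw [trapRefl_fst, hg]; ring) rfl
      rw [hgE]
      refine Conn.hseg _ _ _ (by have := hgT.1; omega) fun i hi _ => ?_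
      rcases hi.eq_or_lt with rfl | hi
      · rw [← hgE]; exact c3.right_mem
      · exact .inr (.inr ⟨hgT.1, hgT.2.1, by dsimp only; omega⟩)
    have hS : ∀ v ∈ S, 0 ≤ v.2 ∧ v.2 ≤ h := by
      rintro v (hv | hv | hv)
      · exact ⟨(hGs v hv).1, (hGs v hv).2.1⟩
      · exact ⟨(hGs _ hv).1, (hGs _ hv).2.1⟩
      · exact ⟨hv.1, hv.2.1⟩
    have hT : ∀ v ∈ insert s' (tclus h L ω) ∪ P₂, v ∈ trap h L := by
      rintro v ((rfl | hv) | hv)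
      · exact hsS'.1
      · exact trapL_sub (clus_sub hv).2
      · exact hv.1
    obtain ⟨z, hz, hz'⟩ := crossing_meet (x₀ := 0) (x₁ := L) (y₀ := 0) (y₁ := h) hS
      (fun v hv => by obtain ⟨h1, h2, h3, h4⟩ := hT v hv; exact ⟨h3, by omega⟩)
      (((c1.trans c2).trans c3).trans c4) (le_of_eq hg)
      le_rfl ((hbs.mono Set.subset_union_left).trans
        ((Conn.single (.inl (Set.mem_insert _ _)) hps'.symm (.inr hδ₂.right_mem)).trans
          (hδ₂.symm.mono Set.subset_union_right))) (le_of_eq hb) (by rw [trapRefl_snd, ht₂])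
    have hzT := hT z hz'
    rcases hz with hz | hz | hz
    · rcases hz' with (rfl | hz') | hz'
      · exact hz
      · exact absurd hz' (hopen _ (Conn.right_mem hz)).2
      · exact absurd (.inl (Conn.right_mem hz).1) hz'.2.1
    · rcases hz' with (rfl | hz') | hz'
      · exact absurd (Conn.right_mem hz).1 hs'2
      · have h1 := trapRefl_eq (clus_sub hz').2 (hGs _ hz)
        rw [h1] at hz
        exact absurd hz' (hopen _ (Conn.right_mem hz)).2
      · exact absurd (.inr (Conn.right_mem hz).1) hz'.2.1
    · have := hzT.2.2.2
      have := hz.2.2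
      omega
  -- the two dual paths now cross each other
  set S : Set Site := (texpl h L ω ∩ {v | ω v = true}) ∪ P₂ ∪
    {v | v.2 = h + 1 ∧ (trapRefl L t₂).1 ≤ v.1} with hS
  set T : Set Site := {v | trapRefl L v ∈ tclus h L ω} ∪ {s} ∪ P₁ ∪
    {v | v.2 = h + 1 ∧ v.1 = t₁.1} with hT
  have hS' : ∀ v ∈ S, 0 ≤ v.2 ∧ v.2 ≤ h + 1 := by
    rintro v ((hv | hv) | hv)
    · obtain ⟨h1, h2, -, -⟩ := (hopen v hv).1
      exact ⟨h1, by omega⟩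
    · obtain ⟨h1, h2, -, -⟩ := hv.1
      exact ⟨h1, by omega⟩
    · obtain ⟨h1, h2⟩ := hv
      omega
  have ht₁T := hτ₁.right_mem.1
  have hT' : ∀ v ∈ T, 0 ≤ v.1 ∧ v.1 ≤ L := by
    have key : ∀ v ∈ trap h L, 0 ≤ v.1 ∧ v.1 ≤ L := fun v hv => by
      obtain ⟨h1, h2, h3, h4⟩ := hv
      exact ⟨h3, by omega⟩
    rintro v (((hv | rfl) | hv) | hv)
    · have := trapRefl_mem (trapL_sub (clus_sub hv).2)
      rw [trapRefl_invol] at this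
      exact key v this
    · exact key v hsS.1
    · exact key v hv.1
    · rw [hv.2]
      exact key _ ht₁T
  obtain ⟨b, hb, hbs⟩ := expl_conn hs2
  have hadj : ∀ v w : Site, w.1 = v.1 ∧ w.2 = v.2 + 1 → Adj v w := fun v w hvw => by
    rw [adj_iff]; omega
  set q : Site := ((trapRefl L t₂).1, h + 1) with hq
  have c1 : Conn S g s' := hs'G.mono fun z hz => .inl (.inl hz)
  have c2 : Conn S s' (trapRefl L t₂) := (Conn.single c1.right_mem hps'.symm
    (.inl (.inr hδ₂.right_mem))).trans (hδ₂.symm.mono fun z hz => .inl (.inr hz))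
  have c3 : Conn S (trapRefl L t₂) q := .single c2.right_mem
    (hadj _ _ ⟨rfl, by rw [trapRefl_snd, ht₂]⟩) (.inr ⟨rfl, le_rfl⟩)
  have c4 : Conn S q (max q.1 L, h + 1) := Conn.hseg _ _ _ (le_max_left _ _) fun i hi _ =>
    .inr ⟨rfl, hi⟩
  have d1 : Conn T (trapRefl L b) s := by
    have := hbs.map (S' := T) (trapRefl L) (trapRefl_adj L) (by
      rintro u (rfl | hu)
      · exact .inl (.inl (.inr (trapRefl_invol L s)))
      · exact .inl (.inl (.inl (by rwa [Set.mem_ofPred_eq, trapRefl_invol]))))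
    rwa [trapRefl_invol] at this
  have d2 : Conn T s t₁ := (Conn.single d1.right_mem hps.symm
    (.inl (.inr hδ₁.right_mem))).trans (hδ₁.symm.mono fun z hz => .inl (.inr hz))
  have d3 : Conn T t₁ (t₁.1, h + 1) := .single d2.right_mem
    (hadj _ _ ⟨rfl, by dsimp only; rw [ht₁]⟩) (.inr ⟨rfl, rfl⟩)
  obtain ⟨z, hz, hz'⟩ := crossing_meet (x₀ := 0) (x₁ := L) (y₀ := 0) (y₁ := h + 1) hS' hT'
    (((c1.trans c2).trans c3).trans c4) (le_of_eq hg) (le_max_right _ _)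
    ((d1.trans d2).trans d3) (le_of_eq (by rw [trapRefl_snd]; exact hb)) le_rfl
  have htop : ∀ v, v ∈ trap h L → v.2 ≠ h + 1 := fun v hv => by
    have := hv.2.1
    omega
  rcases hz' with ((hz' | hz') | hz') | hz'
  · rcases hz with (hz | hz) | hz
    · have := trapRefl_eq (hopen z hz).1 (clus_sub hz').2
      rw [Set.mem_ofPred_eq, this] at hz'
      exact (hopen z hz).2 hz'
    · exact hz.2.1 (.inr (clus_sub_expl hz'))
    · exact htop _ (trapL_sub (clus_sub hz').2) hz.1
  · rw [Set.mem_singleton_iff] at hz'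
    subst hz'
    rcases hz with (hz | hz) | hz
    · exact hs hz.1
    · exact hz.2.1 hsD
    · exact htop _ hsS.1 hz.1
  · rcases hz with (hz | hz) | hz
    · exact hz'.2.1 (.inl hz.1)
    · exact absurd (hz.2.2.symm.trans hz'.2.2) (by simp)
    · exact htop _ hz'.1 hz.1
  · rcases hz with (hz | hz) | hz
    · exact htop _ (trapL_sub (hopen z hz).1) hz'.1
    · exact htop _ hz.1 hz'.1
    · have h1 := hz.2
      rw [hz'.2, trapRefl_fst] at h1
      have hE : t₁ = trapRefl L t₂ :=
        Prod.ext (by rw [trapRefl_fst]; omega) (by rw [trapRefl_snd, ht₁, ht₂])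
      have := hδ₁.left_mem.2.2
      rw [hE, hδ₂.left_mem.2.2] at this
      cases this

end

/-- Crossing of a trapezoid between its left and right sides. -/
def trapCrossEv (h L : ℤ) : Set Config :=
  joinEv true (trap h L) {v | v.1 = 0} {v | v.1 + v.2 = L}

lemma trapCross_of_two {h L : ℤ} (h0 : 0 ≤ h) (hhL : h < L) {ω : Config}
    (h1 : ω ∈ trapEv h L)
    (h2 : ω ∈ joinEv true (trap h L) {v | v.1 + v.2 = L} {v | v.1 = 0 ∨ v.2 = h ∧ 2 * v.1 + h ≤ L}) :
    ω ∈ trapCrossEv h L := by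
  obtain ⟨a, ha, b, hb, hab⟩ := h1
  obtain ⟨c, hc, d, hd, hcd⟩ := h2
  rcases hb with hb | ⟨hb, hb'⟩
  · exact ⟨a, ha, b, hb, hab⟩
  rcases hd with hd | ⟨hd, hd'⟩
  · exact ⟨d, hd, c, hc, hcd.symm⟩
  set U := {v | ω v = true} ∩ trap h L with hU
  suffices h : ∃ z, Conn U a z ∧ Conn U c z by
    obtain ⟨z, hz, hz'⟩ := h
    exact ⟨a, ha, c, hc, hz.trans hz'.symm⟩
  set S : Set Site := {z | Conn U a z} ∪ {z | z.2 = h + 1 ∧ b.1 ≤ z.1} with hS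
  set T : Set Site := {z | Conn U c z} ∪ {z | z.1 + z.2 = L + 1 ∧ 0 ≤ z.2 ∧ z.2 ≤ h} ∪
    {(d.1, h + 1)} with hT
  have key : ∀ {x v : Site}, Conn U x v → 0 ≤ v.2 ∧ v.2 ≤ h ∧ 0 ≤ v.1 ∧ v.1 + v.2 ≤ L :=
    fun hv => hv.right_mem.2
  have hadj : ∀ v w : Site, w.1 = v.1 ∧ w.2 = v.2 + 1 → Adj v w := fun v w hvw => by
    rw [adj_iff]; omega
  have hS' : ∀ v ∈ S, 0 ≤ v.2 ∧ v.2 ≤ h + 1 := by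
    rintro v (hv | ⟨hv, -⟩)
    · have := key hv; omega
    · omega
  have hT' : ∀ v ∈ T, 0 ≤ v.1 ∧ v.1 ≤ L + 1 := by
    rintro v ((hv | ⟨hv, hv', hv''⟩) | rfl)
    · have := key hv; omega
    · omega
    · have := key hcd
      dsimp only
      omega
  have c1 : Conn S a b := hab.comp.mono fun z hz => .inl hz
  have c2 : Conn S b (b.1, h + 1) := .single c1.right_mem (hadj _ _ ⟨rfl, by rw [hb]⟩)
    (.inr ⟨rfl, le_rfl⟩)
  have c3 : Conn S (b.1, h + 1) (max b.1 (L + 1), h + 1) :=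
    Conn.hseg _ _ _ (le_max_left _ _) fun i hi _ => .inr ⟨rfl, hi⟩
  have d0 : ∀ k : ℕ, (k : ℤ) ≤ h → Conn T (L + 1, 0) (L + 1 - k, k) := fun k => by
    induction k with
    | zero => exact fun _ => by simpa using Conn.refl (.inl (.inr ⟨by simp, le_rfl, h0⟩))
    | succ k ih =>
      intro hk
      push_cast at hk ⊢
      refine (ih (by omega)).tail (by rw [adj_iff]; dsimp only; omega) ?_
      exact .inl (.inr ⟨by dsimp only; ring, by dsimp only; omega, hk⟩)
  have hcT := key (Conn.refl hcd.left_mem)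
  have d1 : Conn T (L + 1, 0) (c.1 + 1, c.2) := by
    have := d0 c.2.toNat (by omega)
    rwa [Int.toNat_of_nonneg hcT.1, show L + 1 - c.2 = c.1 + 1 by
      simp only [Set.mem_ofPred_eq] at hc; omega] at this
  have d2 : Conn T (c.1 + 1, c.2) c := .single d1.right_mem (by rw [adj_iff]; dsimp only; omega)
    (.inl (.inl (.refl hcd.left_mem)))
  have d3 : Conn T c d := hcd.comp.mono fun z hz => .inl (.inl hz)
  have d4 : Conn T d (d.1, h + 1) := .single d3.right_mem (hadj _ _ ⟨rfl, by rw [hd]⟩) (.inr rfl)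
  obtain ⟨z, hz, hz'⟩ := crossing_meet (x₀ := 0) (x₁ := L + 1) (y₀ := 0) (y₁ := h + 1) hS' hT'
    ((c1.trans c2).trans c3) (le_of_eq ha) (le_max_right _ _)
    (((d1.trans d2).trans d3).trans d4) le_rfl le_rfl
  rcases hz with hz | ⟨hz, hzb⟩
  · rcases hz' with (hz' | ⟨hz', -, -⟩) | rfl
    · exact ⟨z, hz, hz'⟩
    · have := key hz; omega
    · have := key hz; dsimp only at this; omega
  · rcases hz' with (hz' | ⟨-, -, hz'⟩) | rfl
    · have := key hz'; omega
    · omega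
    · refine ⟨b, hab, ?_⟩
      dsimp only at hzb
      have : b = d := Prod.ext (by omega) (by rw [hb, hd])
      rwa [this]

lemma mem_trapLEv {h L : ℤ} (hhL : h < L) {ω : Config} {a b : Site}
    (hab : Conn ({v | ω v = true} ∩ {v | 0 ≤ v.2 ∧ v.2 ≤ h ∧ 0 ≤ v.1}) a b) (ha : a.1 = 0)
    (hb : L - 1 ≤ 2 * b.1 + b.2) : ω ∈ trapLEv h L := by
  have hsub : ∀ z, z ∈ ({v | ω v = true} ∩ {v : Site | 0 ≤ v.2 ∧ v.2 ≤ h ∧ 0 ≤ v.1}) ∩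
      {v | 2 * v.1 + v.2 ≤ L} → z ∈ {v | ω v = true} ∩ trapL h L := by
    rintro z ⟨⟨hz, h1, h2, h3⟩, h4⟩
    exact ⟨hz, h1, h2, h3, h4⟩
  have haA : a ∈ {v : Site | 2 * v.1 + v.2 ≤ L} := by
    have := hab.left_mem.2.2.1
    simp only [Set.mem_ofPred_eq]
    omega
  rcases hab.stay_or_exit haA with ⟨-, hc⟩ | ⟨p, u, hp, hpu, -, hu⟩
  · exact ⟨a, ha, b, hb, hc.mono hsub⟩
  · refine ⟨a, ha, p, ?_, hp.mono hsub⟩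
    rw [adj_iff] at hpu
    simp only [Set.mem_ofPred_eq] at hu ⊢
    omega

lemma lrEv_mono {c : Bool} {x₀ x₁ x₁' y₀ y₁ y₀' y₁' : ℤ} (h : x₀ ≤ x₁) (hx : x₁ ≤ x₁')
    (hy₀ : y₀' ≤ y₀) (hy₁ : y₁ ≤ y₁') : lrEv c x₀ x₁' y₀ y₁ ⊆ lrEv c x₀ x₁ y₀' y₁' := by
  rintro ω ⟨a, ha, b, hb, hab⟩
  obtain ⟨d, hd, had⟩ := hab.first_hit (fun v => v.1) x₁
    (fun u v huv => by rw [adj_iff] at huv; omega) (by rw [ha]; exact h)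
    (by rw [hb]; exact hx)
  refine ⟨a, ha, d, hd, had.mono ?_⟩
  rintro z ⟨⟨hz, h1, h2, h3, h4⟩, h5⟩
  exact ⟨hz, h1, h5, hy₀.trans h3, h4.trans hy₁⟩

lemma trapCrossEv_subset {h L : ℤ} (hh : 0 ≤ L - h) :
    trapCrossEv h L ⊆ lrEv true 0 (L - h) 0 h := by
  rintro ω ⟨a, ha, b, hb, hab⟩
  have hbT := hab.right_mem.2
  have := hbT.2.1
  simp only [Set.mem_ofPred_eq] at hb
  obtain ⟨d, hd, had⟩ := hab.first_hit (fun v => v.1) (L - h)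
    (fun u v huv => by rw [adj_iff] at huv; omega) (by rw [ha]; exact hh)
    (by omega)
  refine ⟨a, ha, d, hd, had.mono ?_⟩
  rintro z ⟨⟨hz, h1, h2, h3, h4⟩, h5⟩
  exact ⟨hz, h3, h5, h1, h2⟩

lemma trapL_finite (h L : ℤ) : (trapL h L).Finite := (trap_finite h L).subset fun _ => trapL_sub

/-- The lattice automorphism exchanging the coordinates. -/
def swapSite : Site ≃ Site := Equiv.prodComm ℤ ℤ

lemma swapSite_adj (u v : Site) (h : Adj u v) : Adj (swapSite u) (swapSite v) := by
  rw [adj_iff] at *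
  simp only [swapSite, Equiv.prodComm_apply, Prod.fst_swap, Prod.snd_swap]
  omega

/-- Translation of the lattice. -/
def shiftSite (t : Site) : Site ≃ Site := Equiv.addRight t

lemma shiftSite_adj (t u v : Site) (h : Adj u v) : Adj (shiftSite t u) (shiftSite t v) := by
  rw [adj_iff] at *
  simp only [shiftSite, Equiv.coe_addRight, Prod.fst_add, Prod.snd_add]
  omega

/-- Lower bounds for the probabilities of crossing longer and longer rectangles. -/
noncomputable def rswSeq : ℕ → ℝ
  | 0 => 1 / 2
  | k + 1 => (rswSeq k / 2) ^ 2

lemma rswSeq_pos (k : ℕ) : 0 < rswSeq k := by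
  induction k with
  | zero => norm_num [rswSeq]
  | succ k ih => rw [rswSeq]; positivity

section

variable {μ : Measure Config} (hμ : IsBernoulliHalf μ)

include hμ

lemma square_crossing {h : ℤ} (h0 : 0 ≤ h) : 1 / 2 ≤ μ.real (lrEv true 0 h 0 h) := by
  have := hμ.1
  have h1 : μ.real (tbEv false 0 h 0 h) ≤ μ.real (lrEv true 0 h 0 h) := by
    refine joinEv_real_le hμ (rect_finite _ _ _ _) swapSite swapSite_adj ?_ (fun v _ h => h)
      (fun v _ h => h)
    rintro v ⟨h1, h2, h3, h4⟩
    exact ⟨h3, h4, h1, h2⟩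
  have h2 : (Set.univ : Set Config) ⊆ lrEv true 0 h 0 h ∪ tbEv false 0 h 0 h := by
    intro ω _
    rcases hex {v | ω v = true} h0 h0 with ⟨a, b, ha, hb, hab⟩ | ⟨a, b, ha, hb, hab⟩
    · exact .inl ⟨a, ha, b, hb, hab⟩
    · refine .inr ⟨a, ha, b, hb, hab.mono ?_⟩
      rintro z ⟨hz, hz'⟩
      exact ⟨by simpa using hz', hz⟩
  have h3 := (measureReal_mono (μ := μ) h2).trans (measureReal_union_le _ _)
  rw [probReal_univ] at h3
  linarith

lemma trapCross_ge {h L : ℤ} (hL : Even L) (hh : Even h) (h2 : 2 ≤ h) (hhL : h < L) {p : ℝ}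
    (hp0 : 0 ≤ p) (hp : p ≤ μ.real (trapLEv h L)) : (p / 2) ^ 2 ≤ μ.real (trapCrossEv h L) := by
  have := hμ.1
  have h1 : μ.real (trapLEv h L) ≤ 2 * μ.real (trapEv h L) :=
    mix_half hμ expl_stopping (joinEv_isLocal (trapL_finite h L)) (joinEv_isLocal (trap_finite h L))
      (trapRefl L) (trapRefl_invol L) fun ω hω ω' => trapEv_of_mix hL hh h2 hhL hω ω'
  have h3 : μ.real (trapEv h L) ≤ μ.real (joinEv true (trap h L) {v | v.1 + v.2 = L}
      {v | v.1 = 0 ∨ v.2 = h ∧ 2 * v.1 + h ≤ L}) := by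
    refine joinEv_real_le hμ (trap_finite h L) (trapRefl L) (trapRefl_adj L)
      (fun v => trapRefl_mem) (fun v _ hv => ?_) (fun v _ hv => ?_)
    all_goals
      simp only [Set.mem_ofPred_eq, trapRefl_fst, trapRefl_snd] at hv ⊢
      omega
  calc (p / 2) ^ 2 = (p / 2) * (p / 2) := sq _
    _ ≤ μ.real (trapEv h L) * μ.real (joinEv true (trap h L) {v | v.1 + v.2 = L}
      {v | v.1 = 0 ∨ v.2 = h ∧ 2 * v.1 + h ≤ L}) :=
        mul_le_mul (by linarith) (by linarith) (by positivity) (by positivity)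
    _ ≤ _ := fkg_col hμ (joinEv_isLocal (trap_finite h L)) (joinEv_isLocal (trap_finite h L))
        joinEv_colMono joinEv_colMono
    _ ≤ _ := measureReal_mono fun ω hω => trapCross_of_two (by omega) hhL hω.1 hω.2

lemma trapLEv_ge {h : ℤ} (hh : Even h) (h2 : 2 ≤ h) (k : ℕ) :
    rswSeq k ≤ μ.real (trapLEv h ((2 ^ k + 1) * h)) := by
  have := hμ.1
  induction k with
  | zero =>
    refine (square_crossing hμ (by omega : 0 ≤ h)).trans (measureReal_mono ?_)
    rintro ω ⟨a, ha, b, hb, hab⟩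
    refine mem_trapLEv (by omega) (hab.mono ?_) ha ?_
    · rintro z ⟨hz, h1, h2, h3, h4⟩
      exact ⟨hz, h3, h4, h1⟩
    · have := hab.right_mem.2.2.2.1
      simp only [Set.mem_ofPred_eq] at hb
      omega
  | succ k ih =>
    have hk : (1 : ℤ) ≤ 2 ^ k := one_le_pow₀ (by norm_num)
    have hlt : h < (2 ^ k + 1) * h := by nlinarith
    refine (trapCross_ge hμ (hh.mul_left _) hh h2 hlt (rswSeq_pos k).le ih).trans
      (measureReal_mono ?_)
    rintro ω ⟨a, ha, b, hb, hab⟩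
    refine mem_trapLEv (by rw [pow_succ]; nlinarith) (hab.mono ?_) ha ?_
    · rintro z ⟨hz, h1, h2, h3, h4⟩
      exact ⟨hz, h1, h2, h3⟩
    · have := hab.right_mem.2.2.1
      simp only [Set.mem_ofPred_eq] at hb
      rw [pow_succ]
      nlinarith

lemma rsw_lr {c : Bool} {x₀ x₁ y₀ y₁ : ℤ} (hx : x₀ ≤ x₁) (hy : y₀ + 2 ≤ y₁)
    (hxy : x₁ - x₀ ≤ 128 * (y₁ - y₀)) : rswSeq 9 ≤ μ.real (lrEv c x₀ x₁ y₀ y₁) := by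
  have := hμ.1
  set h := 2 * ((y₁ - y₀) / 2) with hh
  have h2 : 2 ≤ h := by omega
  have he : Even h := even_two_mul _
  have h1 := trapLEv_ge hμ he h2 8
  refine (trapCross_ge hμ (he.mul_left _) he h2 (by omega) (rswSeq_pos 8).le h1).trans ?_
  refine (measureReal_mono (trapCrossEv_subset (by omega))).trans ?_
  refine (measureReal_mono (lrEv_mono (x₁ := x₁ - x₀) (y₀' := 0) (y₁' := y₁ - y₀) (by omega)
    (by omega) le_rfl (by omega))).trans ?_
  refine joinEv_real_le hμ (rect_finite _ _ _ _) (shiftSite (x₀, y₀)) (shiftSite_adj _) ?_ ?_ ?_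
  · rintro v ⟨h1, h2, h3, h4⟩
    refine ⟨?_, ?_, ?_, ?_⟩ <;>
    · simp only [shiftSite, Equiv.coe_addRight, Prod.fst_add, Prod.snd_add]
      omega
  all_goals
    intro v _ hv
    simp only [shiftSite, Equiv.coe_addRight, Prod.fst_add, Set.mem_ofPred_eq] at hv ⊢
    omega

lemma rsw_tb {c : Bool} {x₀ x₁ y₀ y₁ : ℤ} (hy : y₀ ≤ y₁) (hx : x₀ + 2 ≤ x₁)
    (hxy : y₁ - y₀ ≤ 128 * (x₁ - x₀)) : rswSeq 9 ≤ μ.real (tbEv c x₀ x₁ y₀ y₁) := by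
  refine (rsw_lr hμ (c := c) hy hx hxy).trans ?_
  refine joinEv_real_le hμ (rect_finite _ _ _ _) swapSite swapSite_adj ?_ (fun v _ h => h)
    (fun v _ h => h)
  rintro v ⟨h1, h2, h3, h4⟩
  exact ⟨h3, h4, h1, h2⟩

end

/-- A left-right path and a bottom-top path are joined to a common site. -/
lemma Conn.meet {S T : Set Site} {a b c d : Site} {x₀ x₁ y₀ y₁ : ℤ} (hab : Conn S a b)
    (hcd : Conn T c d) (hS : ∀ v ∈ S, y₀ ≤ v.2 ∧ v.2 ≤ y₁) (hT : ∀ v ∈ T, x₀ ≤ v.1 ∧ v.1 ≤ x₁)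
    (ha : a.1 ≤ x₀) (hb : x₁ ≤ b.1) (hc : c.2 ≤ y₀) (hd : y₁ ≤ d.2) :
    ∃ z, Conn S a z ∧ Conn T c z :=
  crossing_meet (fun _ h => hS _ (Conn.right_mem h)) (fun _ h => hT _ (Conn.right_mem h))
    hab.comp ha hb hcd.comp hc hd

/-- A left-right crossing and a bottom-top crossing of suitable rectangles are joined. -/
lemma Conn.glue {S O : Set Site} {a b c d : Site} {x₀ x₁ y₀ y₁ x₀' x₁' y₀' y₁' : ℤ}
    (hab : Conn (O ∩ rect x₀ x₁ y₀ y₁) a b) (hcd : Conn (O ∩ rect x₀' x₁' y₀' y₁') c d)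
    (ha : a.1 ≤ x₀') (hb : x₁' ≤ b.1) (hc : c.2 ≤ y₀) (hd : y₁ ≤ d.2)
    (h1 : O ∩ rect x₀ x₁ y₀ y₁ ⊆ S) (h2 : O ∩ rect x₀' x₁' y₀' y₁' ⊆ S) : Conn S a c := by
  obtain ⟨z, hz, hz'⟩ := hab.meet hcd (fun v hv => ⟨hv.2.2.2.1, hv.2.2.2.2⟩)
    (fun v hv => ⟨hv.2.1, hv.2.2.1⟩) ha hb hc hd
  exact (hz.mono h1).trans (hz'.mono h2).symm

/-- A local event favoured by the colour `c` of probability at least `δ ^ k`, where `δ` is the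
lower bound for crossing probabilities. -/
def Likely (μ : Measure Config) (c : Bool) (k : ℕ) (E : Set Config) : Prop :=
  IsLocal E ∧ ColMono c E ∧ rswSeq 9 ^ k ≤ μ.real E

/-- The cone-shaped region of a dyadic arm to the left. -/
def armRegion (J : ℕ) (a : ℤ) : Set Site :=
  {v | -(2 ^ J * (8 * a)) ≤ v.1 ∧ v.1 ≤ 0 ∧ 0 ≤ v.2 ∧ v.2 ≤ 2 ^ J * a ∧
    (4 * v.2 ≤ -v.1 ∨ v.2 ≤ a)}

/-- The arm to the left started at the column `x` above the row `y`. -/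
def leftArm (c : Bool) (x y : ℤ) (J : ℕ) (a : ℤ) : Set Config :=
  joinEv c {v | (v.1 - x, v.2 - y) ∈ armRegion J a} {v | v.1 = x} {v | v.1 = x - 2 ^ J * (8 * a)}

/-- The arm upwards started at the row `y` to the left of the column `x`. -/
def upArm (c : Bool) (x y : ℤ) (J : ℕ) (a : ℤ) : Set Config :=
  joinEv c {v | (y - v.2, x - v.1) ∈ armRegion J a} {v | v.2 = y} {v | v.2 = y + 2 ^ J * (8 * a)}

lemma armRegion_finite (J : ℕ) (a : ℤ) : (armRegion J a).Finite := by
  refine (rect_finite (-(2 ^ J * (8 * a))) 0 0 (2 ^ J * a)).subset ?_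
  rintro v ⟨h1, h2, h3, h4, -⟩
  exact ⟨h1, h2, h3, h4⟩

/-- The lattice automorphism `(p, q) ↦ (x - q, y - p)`. -/
def turnSite (x y : ℤ) : Site ≃ Site where
  toFun v := (x - v.2, y - v.1)
  invFun v := (y - v.2, x - v.1)
  left_inv v := Prod.ext (by dsimp only; ring) (by dsimp only; ring)
  right_inv v := Prod.ext (by dsimp only; ring) (by dsimp only; ring)

lemma turnSite_apply (x y : ℤ) (v : Site) : turnSite x y v = (x - v.2, y - v.1) := rfl

lemma turnSite_adj (x y : ℤ) (u v : Site) (h : Adj u v) :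
    Adj (turnSite x y u) (turnSite x y v) := by
  rw [adj_iff] at *
  simp only [turnSite_apply]
  omega

lemma shiftSite_apply (t v : Site) : shiftSite t v = (v.1 + t.1, v.2 + t.2) := rfl

section

variable {μ : Measure Config} (hμ : IsBernoulliHalf μ)

include hμ

lemma Likely.inter {c : Bool} {k l : ℕ} {E F : Set Config} (hE : Likely μ c k E)
    (hF : Likely μ c l F) : Likely μ c (k + l) (E ∩ F) := by
  refine ⟨hE.1.inter hF.1, hE.2.1.inter hF.2.1, ?_⟩
  refine le_trans ?_ (fkg_col hμ hE.1 hF.1 hE.2.1 hF.2.1)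
  rw [pow_add]
  have := rswSeq_pos 9
  exact mul_le_mul hE.2.2 hF.2.2 (by positivity) (by positivity)

lemma likely_lr {c : Bool} {x₀ x₁ y₀ y₁ : ℤ} (hx : x₀ ≤ x₁) (hy : y₀ + 2 ≤ y₁)
    (hxy : x₁ - x₀ ≤ 128 * (y₁ - y₀)) : Likely μ c 1 (lrEv c x₀ x₁ y₀ y₁) :=
  ⟨joinEv_isLocal (rect_finite _ _ _ _), joinEv_colMono, by
    rw [pow_one]; exact rsw_lr hμ hx hy hxy⟩

lemma likely_tb {c : Bool} {x₀ x₁ y₀ y₁ : ℤ} (hy : y₀ ≤ y₁) (hx : x₀ + 2 ≤ x₁)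
    (hxy : y₁ - y₀ ≤ 128 * (x₁ - x₀)) : Likely μ c 1 (tbEv c x₀ x₁ y₀ y₁) :=
  ⟨joinEv_isLocal (rect_finite _ _ _ _), joinEv_colMono, by
    rw [pow_one]; exact rsw_tb hμ hy hx hxy⟩

lemma likely_arm {c : Bool} {J : ℕ} {a : ℤ} (ha : 2 ≤ a) : Likely μ c (2 * J + 1)
    (joinEv c (armRegion J a) {v | v.1 = 0} {v | v.1 = -(2 ^ J * (8 * a))}) := by
  have := hμ.1
  refine ⟨joinEv_isLocal (armRegion_finite J a), joinEv_colMono, ?_⟩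
  induction J with
  | zero =>
    refine (likely_lr hμ (c := c) (x₀ := -(8 * a)) (x₁ := 0) (y₀ := 0) (y₁ := a) (by omega)
      (by omega) (by omega)).2.2.trans (measureReal_mono ?_)
    rintro ω ⟨u, hu, v, hv, huv⟩
    refine ⟨v, hv, u, by simpa using hu, huv.symm.mono ?_⟩
    rintro z ⟨hz, h1, h2, h3, h4⟩
    exact ⟨hz, by simpa using h1, h2, h3, by simpa using h4, .inr h4⟩
  | succ J ih =>
    set A := 2 ^ J * a with hA
    have hAa : a ≤ A := by
      have : (1 : ℤ) ≤ 2 ^ J := one_le_pow₀ (by norm_num)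
      nlinarith
    have hA8 : (2 : ℤ) ^ J * (8 * a) = 8 * A := by rw [hA]; ring
    have hA16 : (2 : ℤ) ^ (J + 1) * (8 * a) = 16 * A := by rw [hA]; ring
    have hA2 : (2 : ℤ) ^ (J + 1) * a = 2 * A := by rw [hA]; ring
    have h0 : Likely μ c (2 * J + 1) (joinEv c (armRegion J a) {v | v.1 = 0}
      {v | v.1 = -(2 ^ J * (8 * a))}) := ⟨joinEv_isLocal (armRegion_finite J a), joinEv_colMono, ih⟩
    have h1 := (h0.inter hμ (likely_tb hμ (c := c) (x₀ := -(8 * A)) (x₁ := -(4 * A)) (y₀ := 0)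
      (y₁ := A) (by omega) (by omega) (by omega))).inter hμ (likely_lr hμ (c := c) (x₀ := -(16 * A))
      (x₁ := -(4 * A)) (y₀ := 0) (y₁ := A) (by omega) (by omega) (by omega))
    refine (h1.2.2.trans' (le_of_eq (by ring_nf))).trans (measureReal_mono ?_)
    rintro ω ⟨⟨⟨a₁, ha₁, b₁, hb₁, h₁⟩, a₂, ha₂, b₂, hb₂, h₂⟩, a₃, ha₃, b₃, hb₃, h₃⟩
    simp only [Set.mem_ofPred_eq] at ha₁ hb₁ ha₂ hb₂ ha₃ hb₃
    set S : Set Site := {v | ω v = c} ∩ armRegion (J + 1) a with hS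
    have s1 : {v | ω v = c} ∩ armRegion J a ⊆ S := by
      rintro z ⟨hz, h1, h2, h3, h4, h5⟩
      rw [hA8] at h1
      exact ⟨hz, by omega, h2, h3, by omega, h5⟩
    have s2 : {v | ω v = c} ∩ rect (-(8 * A)) (-(4 * A)) 0 A ⊆ S := by
      rintro z ⟨hz, h1, h2, h3, h4⟩
      exact ⟨hz, by omega, by omega, h3, by omega, .inl (by omega)⟩
    have s3 : {v | ω v = c} ∩ rect (-(16 * A)) (-(4 * A)) 0 A ⊆ S := by
      rintro z ⟨hz, h1, h2, h3, h4⟩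
      exact ⟨hz, by omega, by omega, h3, by omega, .inl (by omega)⟩
    obtain ⟨z, hz, hz'⟩ := h₁.symm.meet h₂ (x₀ := -(8 * A)) (x₁ := -(4 * A)) (y₀ := 0) (y₁ := A)
      (fun v hv => ⟨hv.2.2.2.1, hv.2.2.2.2.1⟩) (fun v hv => ⟨hv.2.1, hv.2.2.1⟩) (by omega)
      (by omega) (by omega) (by omega)
    have g1 : Conn S a₁ a₂ := (h₁.mono s1).trans ((hz.mono s1).trans (hz'.mono s2).symm)
    have g2 : Conn S a₃ a₂ := h₃.glue h₂ (by omega) (by omega) (by omega) (by omega) s3 s2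
    exact ⟨a₁, ha₁, a₃, by simp only [Set.mem_ofPred_eq]; omega, g1.trans g2.symm⟩

lemma likely_leftArm {c : Bool} {x y : ℤ} {J : ℕ} {a : ℤ} (ha : 2 ≤ a) :
    Likely μ c (2 * J + 1) (leftArm c x y J a) := by
  refine ⟨joinEv_isLocal ?_, joinEv_colMono, (likely_arm hμ (c := c) ha).2.2.trans ?_⟩
  · refine ((armRegion_finite J a).image (shiftSite (x, y))).subset fun v hv => ⟨_, hv, ?_⟩
    rw [shiftSite_apply]
    exact Prod.ext (by dsimp only; ring) (by dsimp only; ring)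
  · refine joinEv_real_le hμ (armRegion_finite J a) (shiftSite (x, y)) (shiftSite_adj _) ?_ ?_ ?_
    · intro v hv
      simpa [shiftSite_apply] using hv
    all_goals
      intro v _ hv
      simp only [shiftSite_apply, Set.mem_ofPred_eq] at hv ⊢
      omega

lemma likely_upArm {c : Bool} {x y : ℤ} {J : ℕ} {a : ℤ} (ha : 2 ≤ a) :
    Likely μ c (2 * J + 1) (upArm c x y J a) := by
  refine ⟨joinEv_isLocal ?_, joinEv_colMono, (likely_arm hμ (c := c) ha).2.2.trans ?_⟩
  · refine ((armRegion_finite J a).image (turnSite x y)).subset fun v hv => ⟨_, hv, ?_⟩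
    rw [turnSite_apply]
    exact Prod.ext (by dsimp only; ring) (by dsimp only; ring)
  · refine joinEv_real_le hμ (armRegion_finite J a) (turnSite x y) (turnSite_adj x y) ?_ ?_ ?_
    · intro v hv
      simpa [turnSite_apply] using hv
    all_goals
      intro v _ hv
      simp only [turnSite_apply, Set.mem_ofPred_eq] at hv ⊢
      omega

end

section

variable {xa xb y₀ y₁ : ℤ} {ω : Config}

/-- A closed cluster avoids the far side of a rectangle with an open crossing. -/
lemma clus_far {a b k : Site} (hab : Conn ({v | ω v = true} ∩ rect xa xb y₀ y₁) a b)
    (ha : a.1 ≤ xa) (hb : xb ≤ b.1) {yb yt : ℤ} (hy : yb = y₀ ∧ yt = y₁ ∨ yb = y₁ ∧ yt = y₀)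
    (hk : k ∈ clus (rect xa xb y₀ y₁) {v | v.2 = yb} ω) : k.2 ≠ yt := by
  intro hkt
  obtain ⟨t, ht, htk⟩ := clus_conn hk
  have ht : t.2 = yb := ht
  have key : ∃ c d, Conn (clus (rect xa xb y₀ y₁) {v | v.2 = yb} ω) c d ∧ c.2 = y₀ ∧ d.2 = y₁ := by
    rcases hy with ⟨h1, h2⟩ | ⟨h1, h2⟩
    · exact ⟨t, k, htk, by omega, by omega⟩
    · exact ⟨k, t, htk.symm, by omega, by omega⟩
  obtain ⟨c, d, hcd, hc, hd⟩ := key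
  obtain ⟨z, hz, hz'⟩ := crossing_meet (x₀ := xa) (x₁ := xb) (y₀ := y₀) (y₁ := y₁)
    (fun v hv => ⟨hv.2.2.2.1, hv.2.2.2.2⟩)
    (fun v hv => ⟨(clus_sub hv).2.1, (clus_sub hv).2.2.1⟩) hab ha hb hcd hc.le hd.ge
  have h1 : ω z = true := hz.1
  rw [(clus_sub hz').1] at h1
  cases h1

/-- If a closed cluster avoids the far side of a rectangle, then the exploration reveals an open
crossing. -/
lemma expl_crossing (hx : xa ≤ xb) (hy01 : y₀ ≤ y₁) {yb yt : ℤ}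
    (hy : yb = y₀ ∧ yt = y₁ ∨ yb = y₁ ∧ yt = y₀)
    (hfar : ∀ k ∈ clus (rect xa xb y₀ y₁) {v | v.2 = yb} ω, k.2 ≠ yt) :
    ∃ g g' : Site, g.1 = xa ∧ g'.1 = xb ∧
      Conn ({v | ω v = true} ∩ expl (rect xa xb y₀ y₁) {v | v.2 = yb} ω) g g' := by
  set Ex := expl (rect xa xb y₀ y₁) {v | v.2 = yb} ω with hEx
  rcases hex ({v | ω v = true} ∩ Ex) hx hy01 with ⟨a, b, ha, hb, hab⟩ | ⟨a, b, ha, hb, hab⟩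
  · exact ⟨a, b, ha, hb, hab.mono fun z hz => hz.1⟩
  · exfalso
    have key : ∃ c d, Conn (rect xa xb y₀ y₁ \ ({v | ω v = true} ∩ Ex)) c d ∧ c.2 = yb ∧
        d.2 = yt := by
      rcases hy with ⟨h1, h2⟩ | ⟨h1, h2⟩
      · exact ⟨a, b, hab, by omega, by omega⟩
      · exact ⟨b, a, hab.symm, by omega, by omega⟩
    obtain ⟨c, d, hcd, hc, hd⟩ := key
    have hmem : ∀ z, z ∈ rect xa xb y₀ y₁ \ ({v | ω v = true} ∩ Ex) → z ∈ Ex →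
        z ∈ clus (rect xa xb y₀ y₁) {v | v.2 = yb} ω := by
      rintro z ⟨-, hz⟩ hzE
      refine mem_clus_of_expl hzE ?_
      have : ¬ ω z = true := fun h => hz ⟨h, hzE⟩
      simpa using this
    refine hfar d ?_ hd
    clear hd
    induction hcd using Conn.induct with
    | h0 h => exact hmem _ h.left_mem ⟨h.left_mem.1, .inl hc⟩
    | h1 u v hu huv hv ih => exact hmem _ hv ⟨hv.1, .inr ⟨u, ih, huv⟩⟩

/-- A fresh closed path down to the base of an explored rectangle completes the explored closed
cluster to a crossing with exactly one open site `u`. -/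
lemma exists_gap {η : Config} {ka kb y₂ : ℤ} (hx : xa ≤ xb) (hy01 : y₀ ≤ y₁) (hy2 : y₁ < y₂)
    (hka : xa ≤ ka) (hkb : kb ≤ xb) (hω : ω ∈ lrEv true xa xb y₀ y₁)
    (hη : ∀ v ∈ expl (rect xa xb y₀ y₁) {v | v.2 = y₀} ω, η v = ω v) {p q : Site}
    (hp : p.2 = y₀) (hq : q.2 = y₂)
    (hpq : Conn ({v | v ∉ expl (rect xa xb y₀ y₁) {v | v.2 = y₀} ω → η v = false} ∩
      rect ka kb y₀ y₂) p q) :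
    ∃ g g' u b t : Site, g.1 = xa ∧ g'.1 = xb ∧ b.2 = y₀ ∧ t.2 = y₂ ∧
      Conn ({v | η v = true} ∩ rect xa xb y₀ y₁) g g' ∧
      Conn ({v | η v = true} ∩ rect xa xb y₀ y₁) g u ∧
      Conn (insert u ({v | η v = false} ∩ rect xa xb y₀ y₂)) b t := by
  obtain ⟨a, ha, a', ha', haa⟩ := hω
  have hfar : ∀ k ∈ clus (rect xa xb y₀ y₁) {v | v.2 = y₀} ω, k.2 ≠ y₁ :=
    fun k hk => clus_far haa (le_of_eq ha) (ge_of_eq ha') (.inl ⟨rfl, rfl⟩) hk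
  obtain ⟨g, g', hg, hg', hgg⟩ := expl_crossing hx hy01 (.inl ⟨rfl, rfl⟩) hfar
  set Ex := expl (rect xa xb y₀ y₁) {v | v.2 = y₀} ω with hEx
  set K := clus (rect xa xb y₀ y₁) {v | v.2 = y₀} ω with hK
  have hpr := hpq.left_mem.2
  have hqr := hpq.right_mem.2
  have hqE : q ∉ Ex := fun h => by
    obtain ⟨⟨-, -, -, h4⟩, -⟩ := h
    omega
  have hpE : p ∈ Ex := ⟨⟨hka.trans hpr.1, hpr.2.1.trans hkb, hp.ge, by omega⟩, .inl hp⟩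
  obtain ⟨s, u, hs, hsu, hu, huE⟩ := hpq.symm.exit hqE hpE
  have hsE : s ∉ Ex := hs.right_mem.2
  have hsr := hs.right_mem.1.2
  have huK : u ∉ K := fun h => by
    refine hsE ⟨⟨hka.trans hsr.1, hsr.2.1.trans hkb, hsr.2.2.1, ?_⟩, .inr ⟨u, h, hsu.symm⟩⟩
    have h1 := hfar u h
    obtain ⟨-, -, -, h4⟩ := (clus_sub h).2
    have h5 := adj_iff.1 hsu
    omega
  obtain ⟨b, hb, hbu⟩ := expl_conn huE
  have hopen : {v | ω v = true} ∩ Ex ⊆ {v | η v = true} ∩ rect xa xb y₀ y₁ :=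
    fun v hv => ⟨(hη v hv.2).trans hv.1, hv.2.1⟩
  have hfr : Conn (insert u (K ∪ ({v | v ∉ Ex ∧ η v = false} ∩ rect ka kb y₀ y₂))) u q := by
    refine Conn.trans (.single (Set.mem_insert _ _) hsu.symm ?_) (hs.symm.mono ?_)
    · exact .inr (.inr ⟨⟨hsE, hs.right_mem.1.1 hsE⟩, hsr⟩)
    · rintro v ⟨hv, hvE⟩
      exact .inr (.inr ⟨⟨hvE, hv.1 hvE⟩, hv.2⟩)
  have hchain : Conn (insert u (K ∪ ({v | v ∉ Ex ∧ η v = false} ∩ rect ka kb y₀ y₂))) b q :=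
    (hbu.mono (Set.insert_subset_insert Set.subset_union_left)).trans hfr
  have hcx : ∀ v ∈ insert u (K ∪ ({v | v ∉ Ex ∧ η v = false} ∩ rect ka kb y₀ y₂)),
      xa ≤ v.1 ∧ v.1 ≤ xb := by
    rintro v (rfl | hv | ⟨-, hv⟩)
    · exact ⟨huE.1.1, huE.1.2.1⟩
    · exact ⟨(clus_sub hv).2.1, (clus_sub hv).2.2.1⟩
    · exact ⟨hka.trans hv.1, hv.2.1.trans hkb⟩
  refine ⟨g, g', u, b, q, hg, hg', hb, hq, hgg.mono hopen, ?_, hchain.mono ?_⟩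
  · obtain ⟨z, hz, hz'⟩ := crossing_meet (x₀ := xa) (x₁ := xb) (y₀ := y₀) (y₁ := y₁)
      (fun v hv => ⟨(Conn.right_mem hv).2.1.2.2.1, (Conn.right_mem hv).2.1.2.2.2⟩) hcx
      hgg.comp hg.le hg'.ge hchain (le_of_eq hb) (by omega)
    have hzo := (Conn.right_mem hz)
    rcases hz' with rfl | hzK | ⟨⟨hzE, -⟩, -⟩
    · exact Conn.mono hz hopen
    · exfalso
      have h1 : ω z = true := hzo.1
      rw [(clus_sub hzK).1] at h1
      cases h1
    · exact absurd hzo.2 hzE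
  · refine Set.insert_subset_insert ?_
    rintro v (hv | ⟨⟨-, hv⟩, h1, h2, h3, h4⟩)
    · obtain ⟨hv0, h1, h2, h3, h4⟩ := clus_sub hv
      exact ⟨(hη v (clus_sub_expl hv)).trans hv0, h1, h2, h3, by omega⟩
    · exact ⟨hv, hka.trans h1, h2.trans hkb, h3, h4⟩

end

/-- The box `[-5 r, 5 r] × [0, 5 r]` without its lower left and lower right parts. -/
def hub (r : ℤ) : Set Site :=
  {v | v ∈ rect (-(5 * r)) (5 * r) 0 (5 * r) ∧
    (v.2 < 2 * r → -(2 * r) ≤ v.1 ∧ v.1 ≤ 2 * r)}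

section

variable {r : ℤ} {η : Config}

/-- The lowest site of the closed cluster of the top of a box, where the box carries an open
crossing, and two closed paths with one defect each. -/
lemma exists_lowest (hr : 0 < r) {gL gR p₀ q₀ uL bL tL uR bR tR : Site}
    (hg : Conn ({v | η v = true} ∩ hub r) gL gR) (hgL : gL.1 = -(5 * r)) (hgR : gR.1 = 5 * r)
    (hp : Conn ({v | η v = false} ∩ rect (-r + 1) (r - 1) (r + 1) (5 * r)) p₀ q₀)
    (hp₀ : p₀.2 = r + 1) (hq₀ : q₀.2 = 5 * r)
    (hL : Conn (insert uL ({v | η v = false} ∩ rect (-(5 * r)) (-(2 * r) - 1) (2 * r) (5 * r))) bL tL)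
    (huL : uL ∈ rect (-(5 * r)) (-(2 * r) - 1) (2 * r) (5 * r))
    (hbL : bL.2 = 2 * r) (htL : tL.2 = 5 * r)
    (hR : Conn (insert uR ({v | η v = false} ∩ rect (2 * r + 1) (5 * r) (2 * r) (5 * r))) bR tR)
    (huR : uR ∈ rect (2 * r + 1) (5 * r) (2 * r) (5 * r))
    (hbR : bR.2 = 2 * r) (htR : tR.2 = 5 * r) :
    ∃ v t : Site, -(5 * r) ≤ v.1 ∧ v.1 ≤ 5 * r ∧ 1 ≤ v.2 ∧ v.2 ≤ r + 1 ∧ t.2 = 5 * r ∧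
      Conn ({w | η w = false} ∩ rect (-(5 * r)) (5 * r) v.2 (5 * r)) v t ∧
      ∀ b, 0 ≤ b → b < v.2 →
        Conn ({w | η w = true} ∩ rect (-(5 * r)) (5 * r) b (5 * r)) uL uR := by
  set V := rect (-(5 * r)) (5 * r) 0 (5 * r) with hV
  set U : Set Site := {v | η v = true} ∩ hub r with hU
  set C : Set Site := {v | ∃ t : Site, t.2 = 5 * r ∧ Conn (V \ U) t v} with hC
  have hCV : ∀ v ∈ C, v ∈ V := fun v ⟨_, _, h⟩ => h.right_mem.1
  have hlow : ∀ b d : Site, Conn (V \ U) b d → b.2 ≤ 0 → 5 * r ≤ d.2 → False := by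
    intro b d h hb hd
    obtain ⟨z, hz, hz'⟩ := crossing_meet (x₀ := -(5 * r)) (x₁ := 5 * r) (y₀ := 0) (y₁ := 5 * r)
      (fun v hv => ⟨hv.2.1.2.2.1, hv.2.1.2.2.2⟩) (fun v hv => ⟨hv.1.1, hv.1.2.1⟩)
      hg hgL.le hgR.ge h hb hd
    exact hz'.2 hz
  have hCh : ∀ v ∈ C, v ∈ hub r := by
    rintro v ⟨t, ht, h⟩
    refine ⟨h.right_mem.1, fun hv => ?_⟩
    by_contra hcon
    obtain ⟨h1, h2, h3, h4⟩ := h.right_mem.1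
    refine hlow (v.1, 0) t (Conn.trans (Conn.vseg v.1 0 v.2 h3 fun i hi hi' => ?_) h.symm) le_rfl
      ht.ge
    refine ⟨⟨h1, h2, hi, by dsimp only; omega⟩, fun hz => hcon (hz.2.2 ?_)⟩
    dsimp only
    omega
  have hC0 : ∀ v ∈ C, 1 ≤ v.2 := by
    rintro v ⟨t, ht, h⟩
    by_contra hcon
    exact hlow v t h.symm (by omega) ht.ge
  have hCc : ∀ v ∈ C, η v = false := by
    intro v hv
    obtain ⟨t, ht, h⟩ := id hv
    have h1 : ¬ η v = true := fun h' => h.right_mem.2 ⟨h', hCh v hv⟩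
    simpa using h1
  have hpC : p₀ ∈ C := by
    refine ⟨q₀, hq₀, hp.symm.mono ?_⟩
    rintro z ⟨hz, h1, h2, h3, h4⟩
    refine ⟨⟨by omega, by omega, by omega, h4⟩, fun h => ?_⟩
    have h5 : η z = true := h.1
    rw [show η z = false from hz] at h5
    cases h5
  obtain ⟨v, hvC, hvmin⟩ := Set.exists_min_image C (fun v => v.2)
    ((rect_finite _ _ _ _).subset hCV) ⟨p₀, hpC⟩
  obtain ⟨t, ht, htv⟩ := id hvC
  have hvV := hCV v hvC
  have hmeet : ∀ {xa xb : ℤ} {u b t : Site} {π π' : Site} {y : ℤ}, -(5 * r) ≤ xa → xb ≤ 5 * r →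
      (xb < -(2 * r) ∨ 2 * r < xa) → 0 ≤ y →
      Conn (insert u ({v | η v = false} ∩ rect xa xb (2 * r) (5 * r))) b t →
      u ∈ rect xa xb (2 * r) (5 * r) → b.2 = 2 * r → t.2 = 5 * r →
      Conn (U ∩ rect (-(5 * r)) (5 * r) y (5 * r)) π π' → π.1 = -(5 * r) → π'.1 = 5 * r →
      Conn (U ∩ rect (-(5 * r)) (5 * r) y (5 * r)) π u := by
    intro xa xb u b t π π' y hxa hxb hside hy0 hbt hu hb ht hπ hπ1 hπ2
    have hbx : xa ≤ b.1 ∧ b.1 ≤ xb := by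
      rcases hbt.left_mem with h | h
      · rw [h]; exact ⟨hu.1, hu.2.1⟩
      · exact ⟨h.2.1, h.2.2.1⟩
    set T : Set Site := insert u (({v | η v = false} ∩ rect xa xb (2 * r) (5 * r)) ∪
      {v | xa ≤ v.1 ∧ v.1 ≤ xb ∧ v.2 < 2 * r}) with hT
    have h0 : Conn T (b.1, 0) t := by
      have h1 : Conn T (b.1, 0) (b.1, 2 * r - 1) := Conn.vseg _ _ _ (by omega) fun i hi hi' =>
        .inr (.inr ⟨hbx.1, hbx.2, by dsimp only; omega⟩)
      have h2 : Conn T b t := hbt.mono (Set.insert_subset_insert Set.subset_union_left)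
      exact (h1.tail (adj_iff.2 (by dsimp only; omega)) h2.left_mem).trans h2
    have hTx : ∀ v ∈ T, xa ≤ v.1 ∧ v.1 ≤ xb := by
      rintro v (rfl | hv | hv)
      · exact ⟨hu.1, hu.2.1⟩
      · exact ⟨hv.2.1, hv.2.2.1⟩
      · exact ⟨hv.1, hv.2.1⟩
    obtain ⟨z, hz, hz'⟩ := crossing_meet (x₀ := xa) (x₁ := xb) (y₀ := 0) (y₁ := 5 * r)
      (fun v hv => ⟨hy0.trans (Conn.right_mem hv).2.2.2.1, (Conn.right_mem hv).2.2.2.2⟩) hTx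
      hπ.comp (by omega) (by omega) h0 le_rfl ht.ge
    have hzo := (Conn.right_mem hz).1
    rcases hz' with rfl | hz' | hz'
    · exact hz
    · exfalso
      have h1 : η z = true := hzo.1
      rw [show η z = false from hz'.1] at h1
      cases h1
    · exfalso
      have h1 := hzo.2.2 hz'.2.2
      have h2 := hz'.1
      have h3 := hz'.2.1
      omega
  refine ⟨v, t, hvV.1, hvV.2.1, hC0 v hvC, hp₀ ▸ hvmin p₀ hpC, ht, ?_, fun b hb hbv => ?_⟩
  · refine htv.comp.symm.mono fun z hz => ?_
    have hzC : z ∈ C := ⟨t, ht, hz⟩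
    obtain ⟨h1, h2, -, h4⟩ := hCV z hzC
    exact ⟨hCc z hzC, h1, h2, hvmin z hzC, h4⟩
  · obtain ⟨h1, h2, h3, h4⟩ := hvV
    rcases hex (x₀ := -(5 * r)) (x₁ := 5 * r) (y₀ := b) (y₁ := 5 * r) U (by omega) (by omega) with
      ⟨π, π', hπ, hπ', h⟩ | ⟨π, π', hπ, hπ', h⟩
    · refine ((hmeet le_rfl (by omega) (.inl (by omega)) hb hL huL hbL htL h hπ hπ').symm.trans
        (hmeet (by omega) le_rfl (.inr (by omega)) hb hR huR hbR htR h hπ hπ')).mono ?_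
      exact fun z hz => ⟨hz.1.1, hz.2⟩
    · exfalso
      have hπC : π ∈ C := ⟨π', hπ', h.symm.mono fun z hz =>
        ⟨⟨hz.1.1, hz.1.2.1, hb.trans hz.1.2.2.1, hz.1.2.2.2⟩, hz.2⟩⟩
      have := hvmin π hπC
      omega

end

/-- The open crossings used to build a pivotal region of scale `r`. -/
def openFrame (r : ℤ) (J : ℕ) : Set Config :=
  lrEv true (-(5 * r)) (-(2 * r) - 1) (2 * r) (3 * r) ∩
  (lrEv true (2 * r + 1) (5 * r) (2 * r) (3 * r) ∩
  (tbEv true (-(3 * r)) (-(2 * r) - 1) (2 * r) (3 * r) ∩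
  (tbEv true (2 * r + 1) (3 * r) (2 * r) (3 * r) ∩
  (lrEv true (-(3 * r)) (-r) (2 * r) (3 * r) ∩
  (lrEv true r (3 * r) (2 * r) (3 * r) ∩
  (tbEv true (-(2 * r)) (-r) 0 (3 * r) ∩
  (tbEv true r (2 * r) 0 (3 * r) ∩
  (lrEv true (-(2 * r)) (2 * r) 0 r ∩
  (tbEv true (-(5 * r)) (-(4 * r)) (2 * r) (3 * r) ∩
  (tbEv true (4 * r) (5 * r) (2 * r) (3 * r) ∩
  (lrEv true (4 * r) (70 * r) (2 * r) (3 * r) ∩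
  leftArm true (-(4 * r)) (2 * r) J r)))))))))))

/-- The closed crossings used to build a pivotal region of scale `r`. -/
def closedFrame (r : ℤ) (J : ℕ) : Set Config :=
  lrEv false (-(5 * r)) (5 * r) (4 * r) (5 * r) ∩
  (tbEv false (-r + 1) (r - 1) (r + 1) (5 * r) ∩
  (tbEv false (-(4 * r) + 1) (-(3 * r) - 1) (2 * r) (5 * r) ∩
  (tbEv false (3 * r + 1) (4 * r - 1) (2 * r) (5 * r) ∩
  upArm false 0 (4 * r) J r)))

/-- The sites on which `closedFrame` depends. -/
def closedZone (r : ℤ) (J : ℕ) : Set Site :=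
  rect (-(5 * r)) (5 * r) (4 * r) (5 * r) ∪ rect (-r + 1) (r - 1) (r + 1) (5 * r) ∪
  rect (-(4 * r) + 1) (-(3 * r) - 1) (2 * r) (5 * r) ∪ rect (3 * r + 1) (4 * r - 1) (2 * r) (5 * r) ∪
  {v | (4 * r - v.2, 0 - v.1) ∈ armRegion J r}

/-- The site `v` near the origin is joined upwards to distance `2 ^ J * (8 * r)` by a closed path
not going below `v`, and strictly below `v` there is an open left-right crossing above every row. -/
def pivotEv (r : ℤ) (J : ℕ) : Set Config :=
  {η | ∃ v : Site, -(5 * r) ≤ v.1 ∧ v.1 ≤ 5 * r ∧ 1 ≤ v.2 ∧ v.2 ≤ r + 1 ∧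
    (∃ t : Site, t.2 = 4 * r + 2 ^ J * (8 * r) ∧
      Conn ({w | η w = false} ∩ rect (-(2 ^ J * r)) (5 * r) v.2 (4 * r + 2 ^ J * (8 * r))) v t) ∧
    ∀ b, 0 ≤ b → b < v.2 → ∃ a a' : Site, a.1 = -(4 * r) - 2 ^ J * (8 * r) ∧ a'.1 = 70 * r ∧
      Conn ({w | η w = true} ∩ rect (-(4 * r) - 2 ^ J * (8 * r)) (70 * r) b (2 * r + 2 ^ J * r))
        a a'}

lemma pivotEv_isLocal {r : ℤ} {J : ℕ} : IsLocal (pivotEv r J) := by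
  have hfin := (rect_finite (-(2 ^ J * r)) (5 * r) 1 (4 * r + 2 ^ J * (8 * r))).union
    (rect_finite (-(4 * r) - 2 ^ J * (8 * r)) (70 * r) 0 (2 * r + 2 ^ J * r))
  refine ⟨hfin.toFinset, fun ω ω' h => ?_⟩
  have h' : ∀ v ∈ rect (-(2 ^ J * r)) (5 * r) 1 (4 * r + 2 ^ J * (8 * r)) ∪
      rect (-(4 * r) - 2 ^ J * (8 * r)) (70 * r) 0 (2 * r + 2 ^ J * r), ω v = ω' v :=
    fun v hv => h v (by simpa using hv)
  rintro ⟨v, h1, h2, h3, h4, ⟨t, ht, h5⟩, h6⟩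
  refine ⟨v, h1, h2, h3, h4, ⟨t, ht, h5.mono ?_⟩, fun b hb hbv => ?_⟩
  · rintro w ⟨hw, k1, k2, k3, k4⟩
    exact ⟨(h' w (.inl ⟨k1, k2, h3.trans k3, k4⟩)).symm.trans hw, k1, k2, k3, k4⟩
  · obtain ⟨a, a', ha, ha', h7⟩ := h6 b hb hbv
    refine ⟨a, a', ha, ha', h7.mono ?_⟩
    rintro w ⟨hw, k1, k2, k3, k4⟩
    exact ⟨(h' w (.inr ⟨k1, k2, hb.trans k3, k4⟩)).symm.trans hw, k1, k2, k3, k4⟩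

section

variable {r : ℤ} {J : ℕ}

lemma pivotEv_of_mix (hr : 4 ≤ r) (hJ : 16 ≤ (2 : ℤ) ^ J) {ω ω' η : Config}
    (hω : ω ∈ openFrame r J) (hω' : ω' ∈ closedFrame r J)
    (hη : ∀ v, v ∉ closedZone r J ∨
      v ∈ expl (rect (-(5 * r)) (-(2 * r) - 1) (2 * r) (3 * r)) {v | v.2 = 2 * r} ω ∨
      v ∈ expl (rect (2 * r + 1) (5 * r) (2 * r) (3 * r)) {v | v.2 = 2 * r} ω → η v = ω v)
    (hη' : ∀ v, v ∈ closedZone r J →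
      v ∉ expl (rect (-(5 * r)) (-(2 * r) - 1) (2 * r) (3 * r)) {v | v.2 = 2 * r} ω →
      v ∉ expl (rect (2 * r + 1) (5 * r) (2 * r) (3 * r)) {v | v.2 = 2 * r} ω → η v = ω' v) :
    η ∈ pivotEv r J := by
  have h8 : (2 : ℤ) ^ J * (8 * r) = 8 * (2 ^ J * r) := by ring
  have hA : 16 * r ≤ 2 ^ J * r := by nlinarith
  have hZ : ∀ v ∈ closedZone r J,
      (-(5 * r) ≤ v.1 ∧ v.1 ≤ 5 * r ∧ 4 * r ≤ v.2 ∧ v.2 ≤ 5 * r) ∨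
      (-r + 1 ≤ v.1 ∧ v.1 ≤ r - 1 ∧ r + 1 ≤ v.2) ∨
      (-(4 * r) + 1 ≤ v.1 ∧ v.1 ≤ -(3 * r) - 1 ∧ 2 * r ≤ v.2) ∨
      (3 * r + 1 ≤ v.1 ∧ v.1 ≤ 4 * r - 1 ∧ 2 * r ≤ v.2) ∨
      (4 * r ≤ v.2 ∧ v.1 ≤ 0 ∧ (4 * (-v.1) ≤ v.2 - 4 * r ∨ -v.1 ≤ r)) := by
    rintro v ((((h | h) | h) | h) | ⟨h1, h2, h3, h4, h5⟩)
    · exact .inl h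
    · exact .inr (.inl ⟨h.1, h.2.1, h.2.2.1⟩)
    · exact .inr (.inr (.inl ⟨h.1, h.2.1, h.2.2.1⟩))
    · exact .inr (.inr (.inr (.inl ⟨h.1, h.2.1, h.2.2.1⟩)))
    · exact .inr (.inr (.inr (.inr ⟨by omega, by omega, by omega⟩)))
  have hO : ∀ {X : Set Site} {a b : Site}, Conn ({v | ω v = true} ∩ X) a b →
      (∀ v ∈ X, v ∉ closedZone r J) → Conn ({v | η v = true} ∩ X) a b := fun h hX =>
    h.mono fun v hv => ⟨(hη v (.inl (hX v hv.2))).trans hv.1, hv.2⟩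
  have hC : ∀ {X : Set Site} {a b : Site}, (∀ v ∈ X, v ∈ closedZone r J ∧
      (v.2 ≤ 3 * r → -(2 * r) ≤ v.1 ∧ v.1 ≤ 2 * r)) →
      Conn ({v | ω' v = false} ∩ X) a b → Conn ({v | η v = false} ∩ X) a b := fun hX h => by
    refine h.mono fun v hv => ⟨(hη' v (hX v hv.2).1 ?_ ?_).trans hv.1, hv.2⟩ <;>
    · rintro ⟨⟨h1, h2, h3, h4⟩, -⟩
      have := (hX v hv.2).2 h4
      omega
  obtain ⟨hXL, hXR, ⟨βL, hβL1, βL', hβL2, hβL⟩, ⟨βR, hβR1, βR', hβR2, hβR⟩,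
    ⟨OL, hOL1, OL', hOL2, hOL⟩, ⟨OR, hOR1, OR', hOR2, hOR⟩, ⟨lL, hlL1, lL', hlL2, hlL⟩,
    ⟨lR, hlR1, lR', hlR2, hlR⟩, ⟨O, hO1, O', hO2, hOO⟩, ⟨αL, hαL1, αL', hαL2, hαL⟩,
    ⟨αR, hαR1, αR', hαR2, hαR⟩, ⟨AR, hAR1, AR', hAR2, hAR⟩, ⟨AL, hAL1, AL', hAL2, hAL⟩⟩ := hω
  obtain ⟨⟨S, hS1, S', hS2, hS⟩, ⟨M, hM1, M', hM2, hM⟩, ⟨κL, hκL1, κL', hκL2, hκL⟩,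
    ⟨κR, hκR1, κR', hκR2, hκR⟩, ⟨U, hU1, U', hU2, hU⟩⟩ := hω'
  obtain ⟨gL, gL', uL, bL, tL, hgL, hgL', hbL, htL, hgg, hgu, hbt⟩ := exists_gap (η := η)
    (ka := -(4 * r) + 1) (kb := -(3 * r) - 1) (y₂ := 5 * r) (by omega) (by omega) (by omega)
    (by omega) (by omega) hXL (fun v hv => hη v (.inr (.inl hv))) hκL1 hκL2 (hκL.mono (by
      rintro v ⟨hv, hvr⟩
      refine ⟨fun hvE => (hη' v (.inl (.inl (.inr hvr))) hvE ?_).trans hv, hvr⟩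
      rintro ⟨⟨h1, h2, h3, h4⟩, -⟩
      have := hvr.2.1
      omega))
  obtain ⟨gR, gR', uR, bR, tR, hgR, hgR', hbR, htR, hgg', hgu', hbt'⟩ := exists_gap (η := η)
    (ka := 3 * r + 1) (kb := 4 * r - 1) (y₂ := 5 * r) (by omega) (by omega) (by omega)
    (by omega) (by omega) hXR (fun v hv => hη v (.inr (.inr hv))) hκR1 hκR2 (hκR.mono (by
      rintro v ⟨hv, hvr⟩
      refine ⟨fun hvE => (hη' v (.inl (.inr hvr)) ?_ hvE).trans hv, hvr⟩
      rintro ⟨⟨h1, h2, h3, h4⟩, -⟩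
      have := hvr.1
      omega))
  replace hβL := hO hβL (fun v ⟨h1, h2, h3, h4⟩ h => by have := hZ v h; omega)
  replace hβR := hO hβR (fun v ⟨h1, h2, h3, h4⟩ h => by have := hZ v h; omega)
  replace hOL := hO hOL (fun v ⟨h1, h2, h3, h4⟩ h => by have := hZ v h; omega)
  replace hOR := hO hOR (fun v ⟨h1, h2, h3, h4⟩ h => by have := hZ v h; omega)
  replace hlL := hO hlL (fun v ⟨h1, h2, h3, h4⟩ h => by have := hZ v h; omega)
  replace hlR := hO hlR (fun v ⟨h1, h2, h3, h4⟩ h => by have := hZ v h; omega)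
  replace hOO := hO hOO (fun v ⟨h1, h2, h3, h4⟩ h => by have := hZ v h; omega)
  replace hαL := hO hαL (fun v ⟨h1, h2, h3, h4⟩ h => by have := hZ v h; omega)
  replace hαR := hO hαR (fun v ⟨h1, h2, h3, h4⟩ h => by have := hZ v h; omega)
  replace hAR := hO hAR (fun v ⟨h1, h2, h3, h4⟩ h => by have := hZ v h; omega)
  replace hAL := hO hAL (fun v ⟨h1, h2, h3, h4, h5⟩ h => by have := hZ v h; omega)
  replace hS := hC (fun v hv => ⟨.inl (.inl (.inl (.inl hv))), by
    obtain ⟨h1, h2, h3, h4⟩ := hv; omega⟩) hS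
  replace hM := hC (fun v hv => ⟨.inl (.inl (.inl (.inr hv))), by
    obtain ⟨h1, h2, h3, h4⟩ := hv; omega⟩) hM
  replace hU := hC (fun v hv => ⟨.inr hv, by
    obtain ⟨h1, h2, h3, h4, h5⟩ := hv; omega⟩) hU
  simp only [Set.mem_ofPred_eq] at hβL1 hβL2 hβR1 hβR2 hOL1 hOL2 hOR1 hOR2 hlL1 hlL2 hlR1 hlR2
  simp only [Set.mem_ofPred_eq] at hO1 hO2 hαL1 hαL2 hαR1 hαR2 hAR1 hAR2 hAL1 hAL2 hS1 hS2 hM1 hM2 hU1 hU2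
  have hγ : Conn ({v | η v = true} ∩ hub r) gL gR' := by
    have hh : ∀ {xa xb ya yb : ℤ}, -(5 * r) ≤ xa → xb ≤ 5 * r → 0 ≤ ya → yb ≤ 5 * r →
        (2 * r ≤ ya ∨ -(2 * r) ≤ xa ∧ xb ≤ 2 * r) →
        {v | η v = true} ∩ rect xa xb ya yb ⊆ {v | η v = true} ∩ hub r := by
      rintro xa xb ya yb k1 k2 k3 k4 k5 v ⟨hv, h1, h2, h3, h4⟩
      exact ⟨hv, ⟨by omega, by omega, by omega, by omega⟩, by omega⟩
    have e1 := hgg.glue hβL (by omega) (by omega) (by omega) (by omega)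
      (hh (by omega) (by omega) (by omega) (by omega) (by omega))
      (hh (by omega) (by omega) (by omega) (by omega) (by omega))
    have e2 := hOL.glue hβL (by omega) (by omega) (by omega) (by omega)
      (hh (by omega) (by omega) (by omega) (by omega) (by omega))
      (hh (by omega) (by omega) (by omega) (by omega) (by omega))
    have e3 := hOL.glue hlL (by omega) (by omega) (by omega) (by omega)
      (hh (by omega) (by omega) (by omega) (by omega) (by omega))
      (hh (by omega) (by omega) (by omega) (by omega) (by omega))
    have e4 := hOO.glue hlL (by omega) (by omega) (by omega) (by omega)
      (hh (by omega) (by omega) (by omega) (by omega) (by omega))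
      (hh (by omega) (by omega) (by omega) (by omega) (by omega))
    have e5 := hOO.glue hlR (by omega) (by omega) (by omega) (by omega)
      (hh (by omega) (by omega) (by omega) (by omega) (by omega))
      (hh (by omega) (by omega) (by omega) (by omega) (by omega))
    have e6 := hOR.glue hlR (by omega) (by omega) (by omega) (by omega)
      (hh (by omega) (by omega) (by omega) (by omega) (by omega))
      (hh (by omega) (by omega) (by omega) (by omega) (by omega))
    have e7 := hOR.glue hβR (by omega) (by omega) (by omega) (by omega)
      (hh (by omega) (by omega) (by omega) (by omega) (by omega))
      (hh (by omega) (by omega) (by omega) (by omega) (by omega))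
    have e8 := hgg'.glue hβR (by omega) (by omega) (by omega) (by omega)
      (hh (by omega) (by omega) (by omega) (by omega) (by omega))
      (hh (by omega) (by omega) (by omega) (by omega) (by omega))
    have e9 := hgg'.mono (hh (by omega) (by omega) (by omega) (by omega) (by omega))
    exact e1.trans (e2.symm.trans (e3.trans (e4.symm.trans (e5.trans (e6.symm.trans
      (e7.trans (e8.symm.trans e9)))))))
  have huL : uL ∈ rect (-(5 * r)) (-(2 * r) - 1) (2 * r) (5 * r) := by
    obtain ⟨-, h1, h2, h3, h4⟩ := hgu.right_mem
    exact ⟨h1, h2, h3, by omega⟩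
  have huR : uR ∈ rect (2 * r + 1) (5 * r) (2 * r) (5 * r) := by
    obtain ⟨-, h1, h2, h3, h4⟩ := hgu'.right_mem
    exact ⟨h1, h2, h3, by omega⟩
  obtain ⟨v, t, hv1, hv2, hv3, hv4, ht, hvt, hlow⟩ := exists_lowest (by omega) hγ hgL hgR' hM hM1 hM2
    hbt huL hbL htL hbt' huR hbR htR
  refine ⟨v, hv1, hv2, hv3, hv4, ⟨U', by omega, ?_⟩, fun b hb hbv => ⟨AL', AR', hAL2, hAR2, ?_⟩⟩
  · have hsub : ∀ w, w ∈ {w | η w = false} ∩ {v | (4 * r - v.2, 0 - v.1) ∈ armRegion J r} →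
        w ∈ {w | η w = false} ∩ rect (-(2 ^ J * r)) (5 * r) v.2 (4 * r + 2 ^ J * (8 * r)) := by
      rintro w ⟨hw, h1, h2, h3, h4, -⟩
      exact ⟨hw, by omega, by omega, by omega, by omega⟩
    obtain ⟨c, hc, hUc⟩ := hU.first_hit (fun v => v.2) (5 * r)
      (fun u v h => by have := adj_iff.1 h; omega) (by omega) (by omega)
    obtain ⟨z, hz, hz'⟩ := hS.meet hUc (fun v hv => ⟨hv.2.2.2.1, hv.2.2.2.2⟩)
      (fun w ⟨⟨_, h1, h2, h3, h4, h5⟩, h6⟩ => by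
        simp only [Set.mem_ofPred_eq] at h6; omega) hS1.le hS2.ge (by omega) (by omega)
    obtain ⟨y, hy, hy'⟩ := hS.meet hvt (fun v hv => ⟨hv.2.2.2.1, hv.2.2.2.2⟩)
      (fun w hw => ⟨hw.2.1, hw.2.2.1⟩) hS1.le hS2.ge (by omega) (by omega)
    have hsS : ∀ w, w ∈ {w | η w = false} ∩ rect (-(5 * r)) (5 * r) (4 * r) (5 * r) →
        w ∈ {w | η w = false} ∩ rect (-(2 ^ J * r)) (5 * r) v.2 (4 * r + 2 ^ J * (8 * r)) := by
      rintro w ⟨hw, h1, h2, h3, h4⟩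
      exact ⟨hw, by omega, by omega, by omega, by omega⟩
    have hsV : ∀ w, w ∈ {w | η w = false} ∩ rect (-(5 * r)) (5 * r) v.2 (5 * r) →
        w ∈ {w | η w = false} ∩ rect (-(2 ^ J * r)) (5 * r) v.2 (4 * r + 2 ^ J * (8 * r)) := by
      rintro w ⟨hw, h1, h2, h3, h4⟩
      exact ⟨hw, by omega, by omega, by omega, by omega⟩
    exact (hy'.mono hsV).trans ((hy.mono hsS).symm.trans ((hz.mono hsS).trans
      ((hz'.mono fun w hw => hsub w hw.1).symm.trans (hU.mono hsub))))
  · set T : Set Site := {w | η w = true} ∩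
      rect (-(4 * r) - 2 ^ J * (8 * r)) (70 * r) b (2 * r + 2 ^ J * r) with hT
    have hh : ∀ {xa xb ya yb : ℤ}, -(5 * r) ≤ xa → xb ≤ 70 * r → b ≤ ya → yb ≤ 5 * r →
        {v | η v = true} ∩ rect xa xb ya yb ⊆ T := by
      rintro xa xb ya yb k1 k2 k3 k4 v ⟨hv, h1, h2, h3, h4⟩
      exact ⟨hv, by omega, by omega, by omega, by omega⟩
    have hsub : ∀ w, w ∈ {w | η w = true} ∩
        {v | (v.1 - -(4 * r), v.2 - 2 * r) ∈ armRegion J r} → w ∈ T := by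
      rintro w ⟨hw, h1, h2, h3, h4, -⟩
      exact ⟨hw, by omega, by omega, by omega, by omega⟩
    obtain ⟨c, hc, hALc⟩ := hAL.first_hit (fun v => -v.1) (5 * r)
      (fun u v h => by have := adj_iff.1 h; omega) (by omega) (by omega)
    obtain ⟨z, hz, hz'⟩ := hALc.symm.meet hαL (y₀ := 2 * r) (y₁ := 3 * r)
      (fun w ⟨⟨_, h1, h2, h3, h4, h5⟩, h6⟩ => by
        simp only [Set.mem_ofPred_eq] at h6; omega) (fun w hw => ⟨hw.2.1, hw.2.2.1⟩)
      (by omega) (by omega) (by omega) (by omega)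
    have e1 : Conn T AL' αL := (hAL.mono hsub).symm.trans
      ((hALc.mono fun w hw => hsub w hw.1).trans ((hz.mono fun w hw => hsub w hw.1).trans
        (hz'.mono (hh (by omega) (by omega) (by omega) (by omega))).symm))
    have e2 := hgg.glue hαL (by omega) (by omega) (by omega) (by omega)
      (hh (by omega) (by omega) (by omega) (by omega))
      (hh (by omega) (by omega) (by omega) (by omega))
    have e3 := hgu.mono (hh (by omega) (by omega) (by omega) (by omega))
    have e4 := (hlow b hb hbv).mono (hh (by omega) (by omega) (by omega) (by omega))
    have e5 := hgu'.mono (hh (by omega) (by omega) (by omega) (by omega))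
    have e6 := hgg'.glue hαR (by omega) (by omega) (by omega) (by omega)
      (hh (by omega) (by omega) (by omega) (by omega))
      (hh (by omega) (by omega) (by omega) (by omega))
    have e7 := hAR.glue hαR (by omega) (by omega) (by omega) (by omega)
      (hh (by omega) (by omega) (by omega) (by omega))
      (hh (by omega) (by omega) (by omega) (by omega))
    have e8 := hAR.mono (hh (by omega) (by omega) (by omega) (by omega))
    exact e1.trans (e2.symm.trans (e3.trans (e4.trans (e5.symm.trans (e6.trans
      (e7.symm.trans e8))))))

variable {μ : Measure Config} (hμ : IsBernoulliHalf μ)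

include hμ

lemma pivotEv_ge (hr : 4 ≤ r) (hJ : 16 ≤ (2 : ℤ) ^ J) :
    rswSeq 9 ^ (4 * J + 18) ≤ μ.real (pivotEv r J) := by
  have hI : Likely μ true (2 * J + 13) (openFrame r J) := by
    have h := (likely_lr hμ (c := true) (x₀ := -(5 * r)) (x₁ := -(2 * r) - 1) (y₀ := 2 * r)
      (y₁ := 3 * r) (by omega) (by omega) (by omega)).inter hμ
      ((likely_lr hμ (x₀ := 2 * r + 1) (x₁ := 5 * r) (y₀ := 2 * r) (y₁ := 3 * r) (by omega)
      (by omega) (by omega)).inter hμ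
      ((likely_tb hμ (x₀ := -(3 * r)) (x₁ := -(2 * r) - 1) (y₀ := 2 * r) (y₁ := 3 * r) (by omega)
      (by omega) (by omega)).inter hμ
      ((likely_tb hμ (x₀ := 2 * r + 1) (x₁ := 3 * r) (y₀ := 2 * r) (y₁ := 3 * r) (by omega)
      (by omega) (by omega)).inter hμ
      ((likely_lr hμ (x₀ := -(3 * r)) (x₁ := -r) (y₀ := 2 * r) (y₁ := 3 * r) (by omega)
      (by omega) (by omega)).inter hμ
      ((likely_lr hμ (x₀ := r) (x₁ := 3 * r) (y₀ := 2 * r) (y₁ := 3 * r) (by omega)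
      (by omega) (by omega)).inter hμ
      ((likely_tb hμ (x₀ := -(2 * r)) (x₁ := -r) (y₀ := 0) (y₁ := 3 * r) (by omega)
      (by omega) (by omega)).inter hμ
      ((likely_tb hμ (x₀ := r) (x₁ := 2 * r) (y₀ := 0) (y₁ := 3 * r) (by omega)
      (by omega) (by omega)).inter hμ
      ((likely_lr hμ (x₀ := -(2 * r)) (x₁ := 2 * r) (y₀ := 0) (y₁ := r) (by omega)
      (by omega) (by omega)).inter hμ
      ((likely_tb hμ (x₀ := -(5 * r)) (x₁ := -(4 * r)) (y₀ := 2 * r) (y₁ := 3 * r) (by omega)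
      (by omega) (by omega)).inter hμ
      ((likely_tb hμ (x₀ := 4 * r) (x₁ := 5 * r) (y₀ := 2 * r) (y₁ := 3 * r) (by omega)
      (by omega) (by omega)).inter hμ
      ((likely_lr hμ (x₀ := 4 * r) (x₁ := 70 * r) (y₀ := 2 * r) (y₁ := 3 * r) (by omega)
      (by omega) (by omega)).inter hμ
      (likely_leftArm hμ (x := -(4 * r)) (y := 2 * r) (J := J) (a := r) (by omega)))))))))))))
    rw [openFrame]
    convert h using 1
    omega
  have hF : Likely μ false (2 * J + 5) (closedFrame r J) := by
    have h := (likely_lr hμ (c := false) (x₀ := -(5 * r)) (x₁ := 5 * r) (y₀ := 4 * r)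
      (y₁ := 5 * r) (by omega) (by omega) (by omega)).inter hμ
      ((likely_tb hμ (x₀ := -r + 1) (x₁ := r - 1) (y₀ := r + 1) (y₁ := 5 * r) (by omega)
      (by omega) (by omega)).inter hμ
      ((likely_tb hμ (x₀ := -(4 * r) + 1) (x₁ := -(3 * r) - 1) (y₀ := 2 * r) (y₁ := 5 * r)
      (by omega) (by omega) (by omega)).inter hμ
      ((likely_tb hμ (x₀ := 3 * r + 1) (x₁ := 4 * r - 1) (y₀ := 2 * r) (y₁ := 5 * r) (by omega)
      (by omega) (by omega)).inter hμ
      (likely_upArm hμ (x := 0) (y := 4 * r) (J := J) (a := r) (by omega)))))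
    rw [closedFrame]
    convert h using 1
    omega
  set R : Config → Set Site := fun ω => (closedZone r J \
    (expl (rect (-(5 * r)) (-(2 * r) - 1) (2 * r) (3 * r)) {v | v.2 = 2 * r} ω ∪
     expl (rect (2 * r + 1) (5 * r) (2 * r) (3 * r)) {v | v.2 = 2 * r} ω))ᶜ with hR
  have hRs : Stopping R := by
    intro ω ω' h
    have h1 : expl (rect (-(5 * r)) (-(2 * r) - 1) (2 * r) (3 * r)) {v | v.2 = 2 * r} ω' =
        expl (rect (-(5 * r)) (-(2 * r) - 1) (2 * r) (3 * r)) {v | v.2 = 2 * r} ω :=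
      expl_congr fun v hv => h v fun hc => hc.2 (.inl hv)
    have h2 : expl (rect (2 * r + 1) (5 * r) (2 * r) (3 * r)) {v | v.2 = 2 * r} ω' =
        expl (rect (2 * r + 1) (5 * r) (2 * r) (3 * r)) {v | v.2 = 2 * r} ω :=
      expl_congr fun v hv => h v fun hc => hc.2 (.inr hv)
    simp only [hR, h1, h2]
  refine le_trans ?_ (mix_le hμ hRs hI.1 hF.1 pivotEv_isLocal fun ω hω ω' hω' =>
    pivotEv_of_mix hr hJ hω hω' (fun v hv => mixCfg_mem fun hc => ?_)
      fun v h1 h2 h3 => mixCfg_not_mem fun hc => hc ⟨h1, fun h => h.elim h2 h3⟩)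
  · rw [show 4 * J + 18 = (2 * J + 13) + (2 * J + 5) by ring, pow_add]
    have := rswSeq_pos 9
    exact mul_le_mul hI.2.2 hF.2.2 (by positivity) (by positivity)
  · rcases hv with h | h | h
    · exact h hc.1
    · exact hc.2 (.inl h)
    · exact hc.2 (.inr h)

end

/-- A path from the left of `x₀` to the right of `x₁` contains a crossing of the strip. -/
lemma Conn.clip {S : Set Site} {a b : Site} {x₀ x₁ : ℤ} (h : Conn S a b) (hx : x₀ ≤ x₁)
    (ha : a.1 ≤ x₀) (hb : x₁ ≤ b.1) :
    ∃ a' b' : Site, a'.1 = x₀ ∧ b'.1 = x₁ ∧ Conn (S ∩ {v | x₀ ≤ v.1 ∧ v.1 ≤ x₁}) a' b' := by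
  obtain ⟨c, hc, hac⟩ := h.first_hit (fun v => v.1) x₁
    (fun u v h => by have := adj_iff.1 h; omega) (by omega) hb
  obtain ⟨c', hc', hcc⟩ := hac.symm.first_hit (fun v => -v.1) (-x₀)
    (fun u v h => by have := adj_iff.1 h; omega) (by omega) (by omega)
  refine ⟨c', c, by omega, hc, hcc.symm.mono ?_⟩
  rintro z ⟨⟨hz, hz1⟩, hz2⟩
  simp only [Set.mem_ofPred_eq] at hz1 hz2
  exact ⟨hz, by omega, hz1⟩

/-- The box `B(n)` without its bottom row has an open left-right crossing, and a closed path joins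
the top to the `s × s` square whose lower left corner is `(x₀, -n+2)`. -/
def descentEv (n x₀ s : ℤ) : Set Config :=
  lrEv true (-n) n (-n + 1) n ∩
  joinEv false (rect (-n) n (-n + 1) n) (rect x₀ (x₀ + s - 1) (-n + 2) (-n + 1 + s)) {v | v.2 = n}

lemma descentEv_isLocal {n x₀ s : ℤ} : IsLocal (descentEv n x₀ s) :=
  (joinEv_isLocal (rect_finite _ _ _ _)).inter (joinEv_isLocal (rect_finite _ _ _ _))

section

variable {r s q n x₀ : ℤ} {J : ℕ}

lemma descentEv_of_pivotEv (hr : 4 ≤ r) (hJ : 16 ≤ (2 : ℤ) ^ J) (hn : n = 4 * (2 ^ J * r))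
    (hs : 1 ≤ s) (hrs : r = s * q) (hx : n - 64 * r < x₀) (hx' : x₀ ≤ n - 32 * r) {η : Config}
    (hη : η ∈ pivotEv r J) :
    ∃ a b : ℤ, -(5 * q) ≤ a ∧ a ≤ 5 * q ∧ 0 ≤ b ∧ b ≤ q ∧
      (fun w => η (shiftSite (s * a - x₀, n - 1 + s * b) w)) ∈ descentEv n x₀ s := by
  obtain ⟨v, hv1, hv2, hv3, hv4, ⟨t, ht, hvt⟩, hlow⟩ := hη
  have h8 : (2 : ℤ) ^ J * (8 * r) = 8 * (2 ^ J * r) := by ring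
  have hA : 16 * r ≤ 2 ^ J * r := by nlinarith
  have hq : 0 < q := by
    by_contra hq
    nlinarith
  have hsr : s ≤ r := by nlinarith
  have ha1 := Int.mul_ediv_add_emod v.1 s
  have ha2 := Int.emod_nonneg v.1 (show s ≠ 0 by omega)
  have ha3 := Int.emod_lt_of_pos v.1 (show 0 < s by omega)
  have hb1 := Int.mul_ediv_add_emod (v.2 - 1) s
  have hb2 := Int.emod_nonneg (v.2 - 1) (show s ≠ 0 by omega)
  have hb3 := Int.emod_lt_of_pos (v.2 - 1) (show 0 < s by omega)
  set a := v.1 / s with ha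
  set b := (v.2 - 1) / s with hb
  have hb0 : 0 ≤ b := Int.ediv_nonneg (by omega) (by omega)
  have hsb : 0 ≤ s * b := by positivity
  refine ⟨a, b, ?_, ?_, hb0, ?_, ?_⟩
  · rw [ha, Int.le_ediv_iff_mul_le (by omega)]
    nlinarith
  · rw [← Int.lt_add_one_iff, ha, Int.ediv_lt_iff_lt_mul (by omega)]
    nlinarith
  · rw [← Int.lt_add_one_iff, hb, Int.ediv_lt_iff_lt_mul (by omega)]
    nlinarith
  set σ := shiftSite (s * a - x₀, n - 1 + s * b) with hσ
  set τ := shiftSite (x₀ - s * a, -n + 1 - s * b) with hτ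
  have hστ : ∀ w, σ (τ w) = w := fun w => by
    simp only [hσ, hτ, shiftSite_apply]
    ext <;> dsimp only <;> ring
  have hτ1 : ∀ w, (τ w).1 = w.1 + (x₀ - s * a) := fun w => rfl
  have hτ2 : ∀ w, (τ w).2 = w.2 + (-n + 1 - s * b) := fun w => rfl
  constructor
  · obtain ⟨c, c', hc, hc', hcc⟩ := hlow (s * b) hsb (by omega)
    have h1 : Conn ({w | η (σ w) = true} ∩ {w | -n + 1 ≤ w.2 ∧ w.2 ≤ n}) (τ c) (τ c') :=
      hcc.map τ (shiftSite_adj _) (by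
        rintro w ⟨hw, k1, k2, k3, k4⟩
        have e2 := hτ2 w
        refine ⟨?_, by omega, by omega⟩
        simp only [Set.mem_ofPred_eq, hστ]
        exact hw)
    have e1 := hτ1 c
    have e2 := hτ1 c'
    obtain ⟨g, g', hg, hg', hgg⟩ := h1.clip (x₀ := -n) (x₁ := n) (by omega) (by omega) (by omega)
    exact ⟨g, hg, g', hg', hgg.mono fun w hw => ⟨hw.1.1, hw.2.1, hw.2.2, hw.1.2.1, hw.1.2.2⟩⟩
  · have e1 := hτ1 v
    have e2 := hτ2 v
    have e3 := hτ2 t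
    have h1 : Conn ({w | η (σ w) = false} ∩ {w | -n ≤ w.1 ∧ w.1 ≤ n ∧ -n + 1 ≤ w.2}) (τ v) (τ t) :=
      hvt.map τ (shiftSite_adj _) (by
        rintro w ⟨hw, k1, k2, k3, k4⟩
        have e1 := hτ1 w
        have e2 := hτ2 w
        refine ⟨?_, by omega, by omega, by omega⟩
        simp only [Set.mem_ofPred_eq, hστ]
        exact hw)
    obtain ⟨c, hc, hvc⟩ := h1.first_hit (fun w => w.2) n
      (fun u v h => by have := adj_iff.1 h; omega) (by omega) (by omega)
    exact ⟨τ v, ⟨by omega, by omega, by omega, by omega⟩, c, hc,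
      hvc.mono fun w hw => ⟨hw.1.1, hw.1.2.1, hw.1.2.2.1, hw.1.2.2.2, hw.2⟩⟩

variable {μ : Measure Config} (hμ : IsBernoulliHalf μ)

include hμ

lemma descentEv_ge (hr : 4 ≤ r) (hJ : 16 ≤ (2 : ℤ) ^ J) (hn : n = 4 * (2 ^ J * r))
    (hs : 1 ≤ s) (hrs : r = s * q) (hx : n - 64 * r < x₀) (hx' : x₀ ≤ n - 32 * r) :
    rswSeq 9 ^ (4 * J + 18) ≤ 22 * (q : ℝ) ^ 2 * μ.real (descentEv n x₀ s) := by
  have := hμ.1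
  have hq : 1 ≤ q := by
    by_contra hq
    nlinarith
  set F := Finset.Icc (-(5 * q)) (5 * q) ×ˢ Finset.Icc 0 q with hF
  refine (pivotEv_ge hμ hr hJ).trans ?_
  have hsub : pivotEv r J ⊆ ⋃ i ∈ F, {ω | (fun w => ω (shiftSite (s * i.1 - x₀, n - 1 + s * i.2) w)
      ^^ false) ∈ descentEv n x₀ s} := by
    intro η hη
    obtain ⟨a, b, h1, h2, h3, h4, h5⟩ := descentEv_of_pivotEv hr hJ hn hs hrs hx hx' hη
    refine Set.mem_biUnion (x := (a, b)) ?_ ?_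
    · simp only [hF, Finset.coe_product, Finset.coe_Icc, Set.mem_prod, Set.mem_Icc]
      exact ⟨⟨h1, h2⟩, h3, h4⟩
    · simpa using h5
  refine (measureReal_mono hsub (measure_ne_top _ _)).trans ?_
  refine (measureReal_biUnion_finset_le _ _).trans ?_
  simp only [descentEv_isLocal.real_sym hμ, Finset.sum_const, nsmul_eq_mul]
  refine mul_le_mul_of_nonneg_right ?_ measureReal_nonneg
  have h2 : ((F.card : ℤ)) = (10 * q + 1) * (q + 1) := by
    simp only [hF, Finset.card_product, Int.card_Icc, Nat.cast_mul]
    rw [Int.toNat_of_nonneg (by omega), Int.toNat_of_nonneg (by omega)]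
    ring
  have h3 : (F.card : ℤ) ≤ 22 * q ^ 2 := by
    rw [h2]
    nlinarith
  exact_mod_cast h3

end

lemma conn_of_isChain {a : Site} {l : List Site} (h : (a :: l).IsChain Adj) :
    ∀ v ∈ a :: l, Conn {z | z ∈ a :: l} a v := by
  induction l generalizing a with
  | nil =>
    intro v hv
    rw [List.mem_singleton.1 hv]
    exact .refl (by simp)
  | cons b l ih =>
    intro v hv
    have hab := List.isChain_cons_cons.1 h
    rcases List.mem_cons.1 hv with rfl | hv
    · exact .refl (by simp)
    · exact Conn.trans (.single (by simp) hab.1 (by simp))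
        ((ih hab.2 v hv).mono fun z hz => List.mem_cons_of_mem _ hz)

/-- Connected sites are joined by a self-avoiding path. -/
lemma Conn.exists_isPath {S : Set Site} {a b : Site} (h : Conn S a b) :
    ∃ p : List Site, PathIn S p ∧ p.head? = some a ∧ p.getLast? = some b := by
  induction h using Conn.induct with
  | h0 h => exact ⟨[a], ⟨⟨by simp, by simp, List.isChain_singleton a⟩, by simpa using h.left_mem⟩, rfl, rfl⟩
  | h1 u v hu huv hv ih =>
    obtain ⟨p, ⟨⟨hp0, hpn, hpc⟩, hpS⟩, hpa, hpu⟩ := ih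
    by_cases hvp : v ∈ p
    · obtain ⟨s, t, rfl⟩ := List.append_of_mem hvp
      have hst : s ++ v :: t = (s ++ [v]) ++ t := by simp
      rw [hst] at hpn hpc hpS
      refine ⟨s ++ [v], ⟨⟨by simp, (List.nodup_append.1 hpn).1, ?_⟩, fun z hz => hpS z
        (List.mem_append_left _ hz)⟩, ?_, by simp⟩
      · exact hpc.left_of_append
      · cases s with
        | nil => simpa using hpa
        | cons x s => simpa using hpa
    · refine ⟨p ++ [v], ⟨⟨by simp, ?_, ?_⟩, ?_⟩, ?_, by simp⟩
      · rw [List.nodup_append]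
        refine ⟨hpn, by simp, ?_⟩
        rintro x hx y hy rfl
        exact hvp (List.mem_singleton.1 hy ▸ hx)
      · refine List.IsChain.append hpc (by simp) ?_
        intro x hx y hy
        rw [hpu] at hx
        simp only [Option.mem_def, Option.some.injEq, List.head?_cons] at hx hy
        rw [← hx, ← hy]
        exact huv
      · intro z hz
        rcases List.mem_append.1 hz with hz | hz
        · exact hpS z hz
        · rw [List.mem_singleton.1 hz]; exact hv
      · cases p with
        | nil => simp at hp0
        | cons x s => simpa using hpa

lemma PathIn.conn {S : Set Site} {p : List Site} (hp : PathIn S p) {a v : Site}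
    (ha : p.head? = some a) (hv : v ∈ p) : Conn {z | z ∈ p} a v := by
  cases p with
  | nil => simp at ha
  | cons x l =>
    have hx : x = a := by simpa using ha
    subst hx
    exact conn_of_isChain hp.1.2.2 v hv

/-- A site joining closed paths to the top and to the bottom of a box with an open crossing is
pivotal. -/
lemma pivotal_of_conn {n : ℤ} {ω : Config} {a b w c₁ c₂ t₁ t₂ : Site}
    (hab : Conn ({v | ω v = true} ∩ rect (-n) n (-n) n) a b) (ha : a.1 = -n) (hb : b.1 = n)
    (hw : w ∈ rect (-n) n (-n) n) (hc₁ : Adj w c₁) (hc₂ : Adj w c₂)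
    (h₁ : Conn ({v | ω v = false} ∩ rect (-n) n (-n) n) c₁ t₁) (ht₁ : t₁.2 = n)
    (h₂ : Conn ({v | ω v = false} ∩ rect (-n) n (-n) n) c₂ t₂) (ht₂ : t₂.2 = -n) :
    Pivotal n ω w := by
  obtain ⟨p, hp, hpa, hpb⟩ := hab.exists_isPath
  obtain ⟨q₁, hq₁, hqc₁, hqt₁⟩ := h₁.exists_isPath
  obtain ⟨q₂, hq₂, hqc₂, hqt₂⟩ := h₂.exists_isPath
  have hcw : Conn (insert w ({v | ω v = false} ∩ rect (-n) n (-n) n)) t₂ t₁ := by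
    have k₁ := h₁.mono (Set.subset_insert w _)
    have k₂ := h₂.mono (Set.subset_insert w _)
    exact (k₂.symm.tail hc₂.symm (Set.mem_insert _ _)).trans
      (Conn.trans (.single (Set.mem_insert _ _) hc₁ k₁.left_mem) k₁)
  have hbp : b ∈ p := List.mem_of_getLast? hpb
  have hwp : w ∈ p := by
    obtain ⟨z, hz, hz'⟩ := crossing_meet (x₀ := -n) (x₁ := n) (y₀ := -n) (y₁ := n)
      (S := {z | z ∈ p}) (fun v hv => ⟨(hp.2 v hv).2.2.2.1, (hp.2 v hv).2.2.2.2⟩) (by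
        rintro v (rfl | hv)
        · exact ⟨hw.1, hw.2.1⟩
        · exact ⟨hv.2.1, hv.2.2.1⟩) (hp.conn hpa hbp) ha.le hb.ge hcw ht₂.le ht₁.ge
    rcases hz' with rfl | hz'
    · exact hz
    · have h3 : ω z = true := (hp.2 z hz).1
      rw [show ω z = false from hz'.1] at h3
      cases h3
  refine ⟨⟨p, ⟨⟨hp.1, fun v hv => (hp.2 v hv).2⟩, fun v hv => (hp.2 v hv).1,
    ⟨a, ⟨hab.left_mem.2, ha⟩, hpa⟩, ⟨b, ⟨hab.right_mem.2, hb⟩, hpb⟩⟩, hwp⟩, q₁, q₂,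
    ⟨hq₁.1, fun v hv => (hq₁.2 v hv).2⟩, fun v hv => (hq₁.2 v hv).1, ⟨c₁, hc₁, hqc₁⟩,
    ⟨t₁, ⟨h₁.right_mem.2, ht₁⟩, hqt₁⟩, ⟨hq₂.1, fun v hv => (hq₂.2 v hv).2⟩,
    fun v hv => (hq₂.2 v hv).1, ⟨c₂, hc₂, hqc₂⟩, ⟨t₂, ⟨h₂.right_mem.2, ht₂⟩, hqt₂⟩, ?_⟩
  intro z hz₁ hz₂
  have k₁ := (hq₁.conn hqc₁ hz₁).symm.trans (hq₁.conn hqc₁ (List.mem_of_getLast? hqt₁))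
  have k₂ := (hq₂.conn hqc₂ hz₂).symm.trans (hq₂.conn hqc₂ (List.mem_of_getLast? hqt₂))
  obtain ⟨y, hy, hy'⟩ := crossing_meet (x₀ := -n) (x₁ := n) (y₀ := -n) (y₁ := n)
    (fun v hv => ⟨hv.2.2.2.1, hv.2.2.2.2⟩) (fun v hv => ⟨hv.2.1, hv.2.2.1⟩) hab ha.le hb.ge
    ((k₂.mono hq₂.2).symm.trans (k₁.mono hq₁.2)) ht₂.le ht₁.ge
  have h3 : ω y = true := hy.1
  rw [show ω y = false from hy'.1] at h3
  cases h3

/-- Some site of `A` is pivotal. -/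
def pivotIn (n : ℤ) (A : Set Site) : Set Config := {ω | ∃ w ∈ A, Pivotal n ω w}

lemma pivotIn_isLocal {n : ℤ} {A : Set Site} : IsLocal (pivotIn n A) := by
  refine ⟨(rect_finite (-n) n (-n) n).toFinset, fun ω ω' h => ?_⟩
  have key : ∀ {p : List Site} {c : Bool}, (∀ v ∈ p, v ∈ rect (-n) n (-n) n) →
      (∀ v ∈ p, ω v = c) → ∀ v ∈ p, ω' v = c := fun hp hc v hv => by
    rw [← h v (by simpa using hp v hv)]; exact hc v hv
  rintro ⟨w, hw, ⟨p, ⟨hp, hpo, hpf, hpl⟩, hwp⟩, q₁, q₂, h₁, hc₁, hf₁, hl₁, h₂, hc₂, hf₂, hl₂, hd⟩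
  exact ⟨w, hw, ⟨p, ⟨hp, key hp.2 hpo, hpf, hpl⟩, hwp⟩, q₁, q₂, h₁, key h₁.2 hc₁, hf₁, hl₁, h₂,
    key h₂.2 hc₂, hf₂, hl₂, hd⟩

/-- After exploring the closed cluster of the top side, a fresh closed path from the bottom side to
the explored set makes the site at which it meets this set pivotal. -/
lemma pivotIn_of_expl {n : ℤ} (hn : 1 ≤ n) {ω η : Config} {a b c y : Site} {A : Set Site}
    (hab : Conn ({v | ω v = true} ∩ rect (-n) n (-n + 1) n) a b) (ha : a.1 = -n) (hb : b.1 = n)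
    (hA : ∀ v ∈ A, v ∈ rect (-n) n (-n) (n - 1))
    (hAη : ∀ v ∈ A, v ∉ expl (rect (-n) n (-n + 1) n) {v | v.2 = n} ω → η v = false)
    (hcy : Conn A c y) (hc : c.2 = -n) (hy : y ∈ expl (rect (-n) n (-n + 1) n) {v | v.2 = n} ω) :
    mixCfg (expl (rect (-n) n (-n + 1) n) {v | v.2 = n}) ω η ∈ pivotIn n A := by
  set R := expl (rect (-n) n (-n + 1) n) {v | v.2 = n} with hR
  have hRX : ∀ v ∈ R ω, v ∈ rect (-n) n (-n + 1) n := fun v hv => hv.1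
  have hfar : ∀ k ∈ clus (rect (-n) n (-n + 1) n) {v | v.2 = n} ω, k.2 ≠ -n + 1 := fun k hk =>
    clus_far hab ha.le hb.ge (.inr ⟨rfl, rfl⟩) hk
  obtain ⟨g, g', hg, hg', hgg⟩ := expl_crossing (by omega) (by omega) (.inr ⟨rfl, rfl⟩) hfar
  have hcR : c ∉ R ω := fun h => by have := (hRX c h).2.2.1; omega
  obtain ⟨p, w, hcp, hpw, hwA, hwR⟩ := hcy.exit hcR hy
  refine ⟨w, hwA, ?_⟩
  have hwn := hA w hwA
  obtain ⟨hwX, hwn' | ⟨k, hk, hkw⟩⟩ := hwR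
  · have h1 : w.2 = n := hwn'
    have := hwn.2.2.2
    omega
  obtain ⟨t, ht, htk⟩ := clus_conn hk
  refine pivotal_of_conn (hgg.mono ?_) hg hg' ⟨hwn.1, hwn.2.1, hwn.2.2.1, by
    have := hwn.2.2.2; omega⟩ hkw.symm hpw.symm (htk.symm.mono ?_) ht (hcp.symm.mono ?_) hc
  · rintro v ⟨hv, hvR⟩
    have h1 := hRX v hvR
    refine ⟨?_, h1.1, h1.2.1, by have := h1.2.2.1; omega, h1.2.2.2⟩
    rw [Set.mem_ofPred_eq, mixCfg_mem hvR]
    exact hv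
  · intro v hv
    have hvR := clus_sub_expl hv
    have h1 := hRX v hvR
    refine ⟨?_, h1.1, h1.2.1, by have := h1.2.2.1; omega, h1.2.2.2⟩
    rw [Set.mem_ofPred_eq, mixCfg_mem hvR]
    exact (clus_sub hv).1
  · rintro v ⟨hvA, hvR⟩
    have h1 := hA v hvA
    refine ⟨?_, h1.1, h1.2.1, h1.2.2.1, by have := h1.2.2.2; omega⟩
    rw [Set.mem_ofPred_eq, mixCfg_not_mem hvR]
    exact hAη v hvA hvR

/-- A closed arch in the strip of height `3 s + 2` above the bottom row, around the `s × s` square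
at `(x₀, -n + 2)`. -/
def archEv (n x₀ s : ℤ) : Set Config :=
  tbEv false (x₀ - 2 * s - 1) (x₀ - 1) (-n) (-n + 3 * s + 2) ∩
    tbEv false (x₀ + s) (x₀ + 3 * s) (-n) (-n + 3 * s + 2) ∩
    lrEv false (x₀ - 2 * s - 1) (x₀ + 3 * s) (-n + s + 2) (-n + 3 * s + 2)

section

variable {n x₀ s : ℤ} {A : Set Site}

lemma mix_descentEv_archEv (hs : 1 ≤ s) (hx : -n ≤ x₀ - 2 * s - 1) (hx' : x₀ + 3 * s ≤ n)
    (hA : ∀ v ∈ rect (x₀ - 2 * s - 1) (x₀ + 3 * s) (-n) (-n + 3 * s + 2), v ∈ A)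
    {ω η : Config} (hω : ω ∈ descentEv n x₀ s) (hη : η ∈ archEv n x₀ s) :
    mixCfg (expl (rect (-n) n (-n + 1) n) {v | v.2 = n}) ω η ∈ pivotIn n A := by
  obtain ⟨⟨a, ha, b, hb, hab⟩, z, hz, t, ht, hzt⟩ := hω
  obtain ⟨⟨⟨c, hc, d, hd, hcd⟩, c', hc', d', hd', hcd'⟩, e, he, e', he', hee⟩ := hη
  simp only [Set.mem_ofPred_eq] at hc hd hc' hd' he he' ha hb ht
  obtain ⟨hz1, hz2, hz3, hz4⟩ := hz
  set O : Set Site := {v | η v = false} ∩ {v | v ∈ rect (x₀ - 2 * s - 1) (x₀ + 3 * s) (-n)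
    (-n + 3 * s + 2) ∧ (v.1 < x₀ ∨ x₀ + s ≤ v.1 ∨ -n + s + 2 ≤ v.2)} with hO
  have hcr := hcd.left_mem.2
  have hcr' := hcd'.left_mem.2
  obtain ⟨hcr1, hcr2, -, -⟩ := hcr
  obtain ⟨hcr1', hcr2', -, -⟩ := hcr'
  have k0 : {v | η v = false} ∩ rect (x₀ - 2 * s - 1) (x₀ + 3 * s) (-n + s + 2) (-n + 3 * s + 2)
      ⊆ O := by
    rintro v ⟨hv, h1, h2, h3, h4⟩
    exact ⟨hv, ⟨h1, h2, by omega, h4⟩, .inr (.inr h3)⟩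
  have k1 : Conn O e c := hee.glue hcd (by omega) (by omega) (by omega) (by omega) k0 (by
    rintro v ⟨hv, h1, h2, h3, h4⟩
    exact ⟨hv, ⟨h1, by omega, h3, h4⟩, .inl (by omega)⟩)
  have k2 : Conn O e c' := hee.glue hcd' (by omega) (by omega) (by omega) (by omega) k0 (by
    rintro v ⟨hv, h1, h2, h3, h4⟩
    exact ⟨hv, ⟨by omega, h2, h3, h4⟩, .inr (.inl h1)⟩)
  have k3 : Conn O c c' := k1.symm.trans k2
  have hbn := hab.right_mem.2
  obtain ⟨hbn1, hbn2, hbn3, hbn4⟩ := hbn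
  obtain ⟨-, hzn1, hzn2, hzn3, hzn4⟩ := hzt.left_mem
  have htn := hzt.right_mem.2.2.2.1
  set S : Set Site := {v | Conn O c v} ∪ {v | v.2 = -n ∧ (v.1 ≤ c.1 ∨ c'.1 ≤ v.1)} with hS
  have m1 : Conn S (-n, -n) c := by
    have := Conn.hseg (S := S) (-n) c.1 (-n) (by omega) fun x h1 h2 =>
      .inr ⟨rfl, .inl h2⟩
    rwa [show ((c.1, -n) : Site) = c from Prod.ext rfl hc.symm] at this
  have m2 : Conn S c' (n, -n) := by
    have := Conn.hseg (S := S) c'.1 n (-n) (by omega) fun x h1 h2 =>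
      .inr ⟨rfl, .inr h1⟩
    rwa [show ((c'.1, -n) : Site) = c' from Prod.ext rfl hc'.symm] at this
  set C := clus (rect (-n) n (-n + 1) n) {v | v.2 = n} ω with hC
  set T : Set Site := C ∪ {v | v.1 = z.1 ∧ v.2 < z.2} with hT
  have hzC : z ∈ C := ⟨t, ht, hzt.symm⟩
  have m3 : Conn T (z.1, -n) t := by
    have h1 := Conn.vseg (S := T) z.1 (-n) z.2 (by omega) fun y h1 h2 => by
      rcases h2.lt_or_eq with h2 | rfl
      · exact .inr ⟨rfl, h2⟩
      · exact .inl hzC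
    refine h1.trans (hzt.symm.comp.symm.mono fun v hv => .inl ⟨t, ht, hv⟩)
  obtain ⟨y, hyS, hyT⟩ := crossing_meet (x₀ := -n) (x₁ := n) (y₀ := -n) (y₁ := n) (S := S)
    (T := T) (by
      rintro v (h | ⟨h1, -⟩)
      · obtain ⟨-, ⟨h1, h2, h3, h4⟩, -⟩ := Conn.right_mem h
        omega
      · omega) (by
      rintro v (hv | ⟨h1, -⟩)
      · exact ⟨(clus_sub hv).2.1, (clus_sub hv).2.2.1⟩
      · omega) (m1.trans ((k3.comp.mono Set.subset_union_left).trans m2)) le_rfl le_rfl m3 le_rfl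
      (by omega)
  have hy : Conn O c y ∧ y ∈ C := by
    rcases hyS with hy | ⟨hy1, hy2⟩ <;> rcases hyT with hy' | ⟨h1, h2⟩
    · exact ⟨hy, hy'⟩
    · obtain ⟨-, ⟨-, -, -, -⟩, h3⟩ := Conn.right_mem hy
      omega
    · have := (clus_sub hy').2.2.2.1
      omega
    · omega
  obtain ⟨w, hw, hw'⟩ := pivotIn_of_expl (by omega) hab ha hb (A := O) (η := η) (by
    rintro v ⟨-, ⟨h1, h2, h3, h4⟩, -⟩
    exact ⟨by omega, by omega, h3, by omega⟩) (fun v hv _ => hv.1) hy.1 hc (clus_sub_expl hy.2)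
  exact ⟨w, hA w hw.2.1, hw'⟩

lemma mix_descentEv_closed (hx : -n ≤ x₀) (hx' : x₀ ≤ n) (hn : 2 ≤ n)
    (hA : ∀ v ∈ rect x₀ x₀ (-n) (-n + 1), v ∈ A) {ω η : Config} (hω : ω ∈ descentEv n x₀ 1)
    (hη : η (x₀, -n) = false) :
    mixCfg (expl (rect (-n) n (-n + 1) n) {v | v.2 = n}) ω η ∈ pivotIn n A := by
  obtain ⟨⟨a, ha, b, hb, hab⟩, z, ⟨hz1, hz2, hz3, hz4⟩, t, ht, hzt⟩ := hω
  have hy : ((x₀, -n + 1) : Site) ∈ expl (rect (-n) n (-n + 1) n) {v | v.2 = n} ω :=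
    ⟨⟨hx, hx', le_rfl, by dsimp only; omega⟩, .inr ⟨z, ⟨t, ht, hzt.symm⟩,
      adj_iff.2 (by dsimp only; omega)⟩⟩
  have hcy : Conn ({(x₀, -n), (x₀, -n + 1)} : Set Site) (x₀, -n) (x₀, -n + 1) :=
    .single (by simp) (adj_iff.2 (by dsimp only; omega)) (by simp)
  obtain ⟨w, hw, hw'⟩ := pivotIn_of_expl (by omega) hab ha hb
    (A := {(x₀, -n), (x₀, -n + 1)}) (η := η) (by
      rintro v (rfl | rfl) <;> refine ⟨?_, ?_, ?_, ?_⟩ <;> dsimp only <;> omega) (by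
      rintro v (rfl | rfl) hv
      · exact hη
      · exact absurd hy hv) hcy rfl hy
  refine ⟨w, hA w ?_, hw'⟩
  rcases hw with rfl | rfl <;> refine ⟨?_, ?_, ?_, ?_⟩ <;> dsimp only <;> omega

lemma rswSeq_le_half (k : ℕ) : rswSeq k ≤ 1 / 2 := by
  induction k with
  | zero => rfl
  | succ k ih =>
    have := rswSeq_pos k
    simp only [rswSeq]
    nlinarith

variable {μ : Measure Config} (hμ : IsBernoulliHalf μ)

include hμ

lemma pivotIn_ge_of_descentEv (hs : 1 ≤ s) (hx : -n ≤ x₀ - 2 * s - 1) (hx' : x₀ + 3 * s ≤ n)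
    (hA : ∀ v ∈ rect (x₀ - 2 * s - 1) (x₀ + 3 * s) (-n) (-n + 3 * s + 2), v ∈ A) :
    rswSeq 9 ^ 3 * μ.real (descentEv n x₀ s) ≤ μ.real (pivotIn n A) := by
  have hL : Likely μ false 3 (archEv n x₀ s) :=
    ((likely_tb hμ (by omega) (by omega) (by omega)).inter hμ
      (likely_tb hμ (by omega) (by omega) (by omega))).inter hμ
      (likely_lr hμ (by omega) (by omega) (by omega))
  refine le_trans ?_ (mix_le hμ expl_stopping descentEv_isLocal hL.1 pivotIn_isLocal
    fun ω hω η hη => mix_descentEv_archEv hs hx hx' hA hω hη)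
  rw [mul_comm]
  exact mul_le_mul_of_nonneg_left hL.2.2 measureReal_nonneg

lemma pivotIn_ge_of_descentEv_one (hx : -n ≤ x₀) (hx' : x₀ ≤ n) (hn : 2 ≤ n)
    (hA : ∀ v ∈ rect x₀ x₀ (-n) (-n + 1), v ∈ A) :
    rswSeq 9 ^ 3 * μ.real (descentEv n x₀ 1) ≤ μ.real (pivotIn n A) := by
  have hE : IsLocal {ω : Config | ω (x₀, -n) = false} :=
    ⟨{(x₀, -n)}, fun ω ω' h hω => by
      rw [Set.mem_ofPred_eq, ← h _ (Finset.mem_singleton_self _)]; exact hω⟩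
  have h1 : μ.real {ω : Config | ω (x₀, -n) = false} = 1 / 2 := by
    have := hμ.2 {(x₀, -n)} fun _ => false
    simp only [Finset.mem_singleton, forall_eq, Finset.card_singleton, pow_one] at this
    simp [measureReal_def, this]
  refine le_trans ?_ (mix_le hμ expl_stopping descentEv_isLocal hE pivotIn_isLocal
    fun ω hω η hη => mix_descentEv_closed hx hx' hn hA hω hη)
  rw [h1, mul_comm]
  refine mul_le_mul_of_nonneg_left ?_ measureReal_nonneg
  have h2 := rswSeq_le_half 9
  exact (pow_le_of_le_one (rswSeq_pos 9).le (h2.trans (by norm_num)) (by norm_num)).trans h2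

end

/-- The sites of `S` have the prescribed states. -/
def patchEv (f : Site → Bool) (S : Finset Site) : Set Config := {ω | ∀ v ∈ S, ω v = f v}

section

variable {μ : Measure Config} (hμ : IsBernoulliHalf μ)

include hμ

lemma patchEv_ge {f : Site → Bool} {S : Finset Site} {N : ℕ} (hS : S.card ≤ N) :
    rswSeq 9 ^ N ≤ μ.real (patchEv f S) := by
  have h1 : μ.real (patchEv f S) = (1 / 2) ^ S.card := by
    rw [measureReal_def, patchEv, hμ.2 S f]
    simp
  have h2 := rswSeq_le_half 9
  rw [h1]
  exact (pow_le_pow_left₀ (rswSeq_pos 9).le h2 N).trans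
    (pow_le_pow_of_le_one (by norm_num) (by norm_num) hS)

lemma likely_patchEv {c : Bool} {S : Finset Site} {N : ℕ} (hS : S.card ≤ N) :
    Likely μ c N (patchEv (fun _ => c) S) :=
  ⟨⟨S, fun _ _ h hω v hv => (h v hv).symm.trans (hω v hv)⟩,
    fun _ _ h hω v hv => h v (hω v hv), patchEv_ge hμ hS⟩

omit hμ in
lemma pivotIn_of_rows {n x : ℤ} (hn : 1 ≤ n) (hx : -n ≤ x) (hx' : x ≤ n) {ω : Config}
    (ho : ∀ y, -n ≤ y → y ≤ n → ω (y, -n + 1) = true) (hc : ω (x, -n) = false)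
    (hc' : ∀ y, -n + 2 ≤ y → y ≤ n → ω (x, y) = false) : ω ∈ pivotIn n {(x, -n + 1)} := by
  refine ⟨(x, -n + 1), rfl, pivotal_of_conn (a := (-n, -n + 1)) (b := (n, -n + 1))
    (c₁ := (x, -n + 2)) (c₂ := (x, -n)) (t₁ := (x, n)) (t₂ := (x, -n))
    (Conn.hseg _ _ _ (by omega) fun y h1 h2 => ⟨ho y h1 h2, h1, h2, ?_, ?_⟩) rfl rfl
    ⟨hx, hx', ?_, ?_⟩ (adj_iff.2 ?_) (adj_iff.2 ?_)
    (Conn.vseg _ _ _ (by omega) fun y h1 h2 => ⟨hc' y h1 h2, hx, hx', ?_, h2⟩) rfl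
    (.refl ⟨hc, hx, hx', le_rfl, ?_⟩) rfl⟩ <;> dsimp only <;> omega

lemma pivotIn_ge_of_le {n x : ℤ} (hn : 1 ≤ n) (hn' : n ≤ 128) (hx : -n ≤ x) (hx' : x ≤ n) :
    rswSeq 9 ^ (257 * 257) ≤ μ.real (pivotIn n {(x, -n + 1)}) := by
  have := hμ.1
  refine (patchEv_ge hμ (f := fun v => decide (v.2 = -n + 1))
    (S := Finset.Icc (-n) n ×ˢ Finset.Icc (-n) n) ?_).trans (measureReal_mono fun ω hω => ?_)
  · rw [Finset.card_product, Int.card_Icc]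
    have : (n + 1 - -n).toNat ≤ 257 := by omega
    exact Nat.mul_le_mul this this
  · have key : ∀ y z, -n ≤ y → y ≤ n → -n ≤ z → z ≤ n → ω (y, z) = decide (z = -n + 1) :=
      fun y z h1 h2 h3 h4 => hω (y, z) (by simp only [Finset.mem_product, Finset.mem_Icc]; omega)
    refine pivotIn_of_rows hn hx hx' (fun y h1 h2 => ?_) ?_ fun y h1 h2 => ?_
    · rw [key y _ h1 h2 (by omega) (by omega)]
      simp
    · rw [key x _ hx hx' (by omega) (by omega)]
      simp
    · rw [key x _ hx hx' (by omega) (by omega), decide_eq_false_iff_not]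
      omega

/-- The corner strip, of length `128` and height `3`. -/
noncomputable def cornerStrip (n : ℤ) : Finset Site := Finset.Icc (n - 128) n ×ˢ Finset.Icc (-n) (-n + 3)

omit hμ in
lemma mem_cornerStrip {n : ℤ} {v : Site} :
    v ∈ cornerStrip n ↔ (n - 128 ≤ v.1 ∧ v.1 ≤ n) ∧ -n ≤ v.2 ∧ v.2 ≤ -n + 3 := by
  simp only [cornerStrip, Finset.mem_product, Finset.mem_Icc]

omit hμ in
lemma cornerStrip_card (n : ℤ) : (cornerStrip n).card = 516 := by
  rw [cornerStrip, Finset.card_product, Int.card_Icc, Int.card_Icc,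
    show (n + 1 - (n - 128)).toNat = 129 by omega, show (-n + 3 + 1 - -n).toNat = 4 by omega]

/-- The open sites prescribed near the corner. -/
noncomputable def openCorner (n : ℤ) : Finset Site :=
  (cornerStrip n).filter fun v => v.2 = -n + 1 ∨ v.1 = n - 128 ∧ -n + 1 ≤ v.2

/-- The closed sites prescribed near the corner. -/
noncomputable def closedCorner (n : ℤ) : Finset Site :=
  (cornerStrip n).filter fun v => n - 128 < v.1 ∧ (v.2 = -n ∨ v.2 = -n + 2)

lemma pivotIn_ge_of_corner {n x : ℤ} {J : ℕ} (hn : n = 2 ^ J * 8) (hn' : 128 ≤ n)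
    (hx : n - 128 < x) (hx' : x ≤ n) :
    rswSeq 9 ^ (4 * J + 1034) ≤ μ.real (pivotIn n {(x, -n + 1)}) := by
  have hO := (likely_patchEv hμ (c := true) (S := openCorner n)
    ((Finset.card_filter_le _ _).trans (cornerStrip_card n).le)).inter hμ
    (likely_leftArm hμ (x := n - 128) (y := -n + 1) (J := J) le_rfl)
  have hC := (likely_patchEv hμ (c := false) (S := closedCorner n)
    ((Finset.card_filter_le _ _).trans (cornerStrip_card n).le)).inter hμ
    (likely_upArm hμ (x := n) (y := -n + 2) (J := J) le_rfl)
  have h16 : (2 : ℤ) ^ J * (8 * 2) = 2 * n := by rw [hn]; ring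
  have h2 : 4 * ((2 : ℤ) ^ J * 2) = n := by rw [hn]; ring
  set R : Set Site := {v | v ∈ openCorner n ∨ (v.1 - (n - 128), v.2 - (-n + 1)) ∈ armRegion J 2}
    with hR
  refine le_trans ?_ (mix_le hμ (R := fun _ => R) (fun _ _ _ => rfl) hO.1 hC.1 pivotIn_isLocal ?_)
  · rw [show 4 * J + 1034 = (516 + (2 * J + 1)) + (516 + (2 * J + 1)) by ring, pow_add]
    have := rswSeq_pos 9
    exact mul_le_mul hO.2.2 hC.2.2 (by positivity) (by positivity)
  rintro ω ⟨hω, a, ha, b, hb, hab⟩ η ⟨hη, c, hc, d, hd, hcd⟩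
  set ζ := mixCfg (fun _ => R) ω η with hζ
  simp only [Set.mem_ofPred_eq, h16] at ha hb hc hd
  have ho : ∀ y, n - 128 ≤ y → y ≤ n → ζ (y, -n + 1) = true := fun y h1 h2 => by
    have h3 : ((y, -n + 1) : Site) ∈ openCorner n := by
      simp only [openCorner, Finset.mem_filter, mem_cornerStrip, true_or, and_true]
      omega
    rw [hζ, mixCfg_mem (.inl h3)]
    exact hω _ h3
  have ho' : ∀ y, -n + 1 ≤ y → y ≤ -n + 3 → ζ (n - 128, y) = true := fun y h1 h2 => by
    have h3 : ((n - 128, y) : Site) ∈ openCorner n := by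
      simp only [openCorner, Finset.mem_filter, mem_cornerStrip, true_and]
      omega
    rw [hζ, mixCfg_mem (.inl h3)]
    exact hω _ h3
  have hc0 : ∀ y z, n - 128 < y → y ≤ n → (z = -n ∨ z = -n + 2) → ζ (y, z) = false :=
    fun y z h1 h2 h3 => by
      have h4 : ((y, z) : Site) ∈ closedCorner n := by
        simp only [closedCorner, Finset.mem_filter, mem_cornerStrip]; omega
      rw [hζ, mixCfg_not_mem]
      · exact hη _ h4
      · rintro (h | h)
        · simp only [openCorner, Finset.mem_filter, mem_cornerStrip] at h
          omega
        · have := h.2.1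
          dsimp only at this
          omega
  have hab' : Conn ({v | ζ v = true} ∩ {v | v.1 ≤ n ∧ -n ≤ v.2 ∧ v.2 ≤ n}) a b := hab.mono (by
    rintro v ⟨hv, hvR⟩
    refine ⟨?_, ?_⟩
    · rw [Set.mem_ofPred_eq, hζ, mixCfg_mem (.inr hvR)]; exact hv
    · obtain ⟨-, h2, h3, h4, -⟩ := hvR
      dsimp only at h2 h3 h4
      exact ⟨by omega, by omega, by omega⟩)
  have har := hab.left_mem.2
  obtain ⟨-, -, ha1, -, ha2⟩ := har
  dsimp only at ha1 ha2
  have hcd' : Conn ({v | ζ v = false} ∩ {v | v.1 ≤ n ∧ -n ≤ v.1 ∧ -n + 2 ≤ v.2}) c d := hcd.mono (by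
    rintro v ⟨hv, h1, h2, h3, h4, h5⟩
    dsimp only at h1 h2 h3 h4 h5
    refine ⟨?_, by omega, by omega, by omega⟩
    rw [Set.mem_ofPred_eq, hζ, mixCfg_not_mem]
    · exact hv
    · rintro (h | ⟨-, h6, h7, -, h8⟩)
      · simp only [openCorner, Finset.mem_filter, mem_cornerStrip] at h
        omega
      · dsimp only at h6 h7 h8
        omega)
  have hcr := hcd.left_mem.2
  obtain ⟨-, -, hc1, -, hc2⟩ := hcr
  dsimp only at hc1 hc2
  obtain ⟨e, he, hae⟩ := hab'.first_hit (fun v => -v.1) n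
    (fun u v h => by have := adj_iff.1 h; omega) (by omega) (by omega)
  obtain ⟨f, hf, hcf⟩ := hcd'.first_hit (fun v => v.2) n
    (fun u v h => by have := adj_iff.1 h; omega) (by omega) (by omega)
  set X := rect (-n) n (-n) n with hX
  have k1 : Conn ({v | ζ v = true} ∩ X) (n - 128, -n + 1) (n, -n + 1) :=
    Conn.hseg _ _ _ (by omega) fun y h1 h2 =>
      ⟨ho y h1 h2, by dsimp only; omega, h2, by dsimp only; omega, by dsimp only; omega⟩
  have k2 : Conn ({v | ζ v = true} ∩ X) (n - 128, -n + 1) a := by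
    have := Conn.vseg (S := {v | ζ v = true} ∩ X) (n - 128) (-n + 1) a.2 (by omega) fun y h1 h2 =>
      ⟨ho' y h1 (by omega), by dsimp only; omega, by dsimp only; omega, by dsimp only; omega,
        by dsimp only; omega⟩
    rwa [show ((n - 128, a.2) : Site) = a from Prod.ext ha.symm rfl] at this
  have k3 : Conn ({v | ζ v = true} ∩ X) a e := hae.mono (by
    rintro v ⟨⟨hv, h1, h2, h3⟩, h4⟩
    simp only [Set.mem_ofPred_eq] at h4
    exact ⟨hv, by omega, h1, h2, h3⟩)
  have k4 : Conn ({v | ζ v = false} ∩ X) (x, -n + 2) c := by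
    have key : ∀ y z, n - 128 < y → y ≤ z → z ≤ n →
        Conn ({v | ζ v = false} ∩ X) (y, -n + 2) (z, -n + 2) := fun y z h1 h2 h3 =>
      Conn.hseg _ _ _ h2 fun y' h4 h5 => ⟨hc0 _ _ (by omega) (by omega) (.inr rfl),
        by dsimp only; omega, by dsimp only; omega, by dsimp only; omega, by dsimp only; omega⟩
    rw [show c = (c.1, -n + 2) from Prod.ext rfl hc]
    rcases le_total x c.1 with h | h
    · exact key _ _ hx h (by omega)
    · exact (key _ _ (by omega) h hx').symm
  have k5 : Conn ({v | ζ v = false} ∩ X) c f := hcf.mono (by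
    rintro v ⟨⟨hv, h1, h2, h3⟩, h4⟩
    simp only [Set.mem_ofPred_eq] at h4
    exact ⟨hv, h2, h1, by omega, h4⟩)
  exact ⟨(x, -n + 1), rfl, pivotal_of_conn (k3.symm.trans (k2.symm.trans k1)) (by omega) rfl
    ⟨by dsimp only; omega, hx', by dsimp only; omega, by dsimp only; omega⟩
    (adj_iff.2 (by dsimp only; omega)) (c₂ := (x, -n)) (adj_iff.2 (by dsimp only; omega))
    (k4.trans k5) hf (.refl ⟨hc0 _ _ hx hx' (.inl rfl), by dsimp only; omega, hx', le_rfl,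
      by dsimp only; omega⟩) rfl⟩

end

section

variable {μ : Measure Config} (hμ : IsBernoulliHalf μ) {n m L r : ℤ} {J : ℕ} {A : Set Site}

include hμ

lemma pivotIn_ge_of_dvd (hr : 4 ≤ r) (hJ : 16 ≤ (2 : ℤ) ^ J) (hn : n = 4 * (2 ^ J * r)) {s q : ℤ}
    (hs : 1 ≤ s) (hm : m = 64 * s) (hrs : r = s * q) (hL : n - 64 * r ≤ L) (hL' : L + m ≤ n)
    (hLr : L + m ≤ n - 32 * r ∨ m = 64 * r)
    (hA : ∀ v : Site, L < v.1 → v.1 ≤ L + m → -n ≤ v.2 → v.2 ≤ -n + m → v ∈ A) :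
    rswSeq 9 ^ (4 * J + 21) ≤ 22 * (q : ℝ) ^ 2 * μ.real (pivotIn n A) := by
  have hA16 : 16 * r ≤ 2 ^ J * r := by nlinarith
  have h1 := descentEv_ge hμ hr hJ hn hs hrs (x₀ := L + 2 * s + 2) (by omega) (by omega)
  have h2 := pivotIn_ge_of_descentEv hμ hs (n := n) (x₀ := L + 2 * s + 2) (A := A) (by omega)
    (by omega) fun v ⟨h3, h4, h5, h6⟩ => hA v (by omega) (by omega) h5 (by omega)
  have h3 := rswSeq_pos 9
  calc rswSeq 9 ^ (4 * J + 21) = rswSeq 9 ^ 3 * rswSeq 9 ^ (4 * J + 18) := by ring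
    _ ≤ rswSeq 9 ^ 3 * (22 * (q : ℝ) ^ 2 * μ.real (descentEv n (L + 2 * s + 2) s)) := by gcongr
    _ = 22 * (q : ℝ) ^ 2 * (rswSeq 9 ^ 3 * μ.real (descentEv n (L + 2 * s + 2) s)) := by ring
    _ ≤ _ := by gcongr

lemma pivotIn_ge_of_pos (hr : 4 ≤ r) (hJ : 16 ≤ (2 : ℤ) ^ J) (hn : n = 4 * (2 ^ J * r))
    (hm : 1 ≤ m) (hL : n - 64 * r ≤ L) (hLr : L + m ≤ n - 32 * r)
    (hA : ∀ v : Site, L < v.1 → v.1 ≤ L + m → -n ≤ v.2 → v.2 ≤ -n + m → v ∈ A) :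
    rswSeq 9 ^ (4 * J + 21) ≤ 22 * (r : ℝ) ^ 2 * μ.real (pivotIn n A) := by
  have hA16 : 16 * r ≤ 2 ^ J * r := by nlinarith
  have h1 := descentEv_ge hμ hr hJ hn le_rfl (one_mul r).symm (x₀ := L + 1) (by omega) (by omega)
  have h2 := pivotIn_ge_of_descentEv_one hμ (n := n) (x₀ := L + 1) (A := A) (by omega)
    (by omega) (by omega) fun v ⟨h3, h4, h5, h6⟩ => hA v (by omega) (by omega) h5 (by omega)
  have h3 := rswSeq_pos 9
  calc rswSeq 9 ^ (4 * J + 21) = rswSeq 9 ^ 3 * rswSeq 9 ^ (4 * J + 18) := by ring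
    _ ≤ rswSeq 9 ^ 3 * (22 * (r : ℝ) ^ 2 * μ.real (descentEv n (L + 1) 1)) := by gcongr
    _ = 22 * (r : ℝ) ^ 2 * (rswSeq 9 ^ 3 * μ.real (descentEv n (L + 1) 1)) := by ring
    _ ≤ _ := by gcongr

/-- The lower bound for a block at the scale `2 ^ (j₀ - j)` to the left of the right side. -/
lemma pivotIn_ge {j₀ i₀ j : ℕ} (hi : i₀ ≤ j₀) (hj : j ≤ i₀) (hn : n = 2 ^ j₀)
    (hm : m = 2 ^ (j₀ - i₀)) (hL : Set.Ioc L (L + m) ⊆ Iset j₀ i₀ j)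
    (hA : ∀ v : Site, L < v.1 → v.1 ≤ L + m → -n ≤ v.2 → v.2 ≤ -n + m → v ∈ A) :
    rswSeq 9 ^ (257 * 257) / 22 * (4 * rswSeq 9 ^ 4) ^ j / 4 ^ i₀ ≤ μ.real (pivotIn n A) := by
  have := hμ.1
  have hδ := rswSeq_pos 9
  have hδ1 : rswSeq 9 ≤ 1 := (rswSeq_le_half 9).trans (by norm_num)
  have hm1 : 1 ≤ m := hm ▸ one_le_pow₀ (by norm_num)
  have hLm : n - 2 ^ (j₀ - j) ≤ L ∧ L + m ≤ n ∧
      (j = i₀ ∨ j < i₀ ∧ L + m ≤ n - 2 ^ (j₀ - j - 1)) := by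
    have h1 := hL (show L + 1 ∈ Set.Ioc L (L + m) from ⟨by omega, by omega⟩)
    have h2 := hL (show L + m ∈ Set.Ioc L (L + m) from ⟨by omega, le_rfl⟩)
    have h3 : (0 : ℤ) < 2 ^ (j₀ - j - 1) := by positivity
    unfold Iset at h1 h2
    split_ifs at h1 h2 with hji
    · subst hji
      exact ⟨by have := h1.1; omega, by have := h2.2; omega, .inl rfl⟩
    · have := h1.1
      have := h2.2
      exact ⟨by omega, by omega, .inr ⟨by omega, by omega⟩⟩
  obtain ⟨hL1, hL2, hL3⟩ := hLm
  set c := rswSeq 9 ^ (257 * 257) with hc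
  have hc0 : 0 < c := by positivity
  have hcle : ∀ N, N ≤ 257 * 257 → c ≤ rswSeq 9 ^ N := fun N hN =>
    pow_le_pow_of_le_one hδ.le hδ1 hN
  have h4 : (4 * rswSeq 9 ^ 4) ^ j = 4 ^ j * rswSeq 9 ^ (4 * j) := by rw [mul_pow, ← pow_mul]
  have h4i : (4 : ℝ) ^ i₀ = 4 ^ j * 4 ^ (i₀ - j) := by rw [← pow_add]; congr 1; omega
  have hlhs : c / 22 * (4 * rswSeq 9 ^ 4) ^ j / 4 ^ i₀ =
      c * rswSeq 9 ^ (4 * j) / (22 * 4 ^ (i₀ - j)) := by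
    rw [h4, h4i]; field_simp
  have hone : (1 : ℝ) ≤ 22 * 4 ^ (i₀ - j) := by
    have : (1 : ℝ) ≤ 4 ^ (i₀ - j) := one_le_pow₀ (by norm_num)
    linarith
  rw [hlhs]
  have hmem : (L + m, -n + 1) ∈ A := hA _ (by dsimp only; omega) le_rfl (by dsimp only; omega)
    (by dsimp only; omega)
  have hmono : μ.real (pivotIn n {(L + m, -n + 1)}) ≤ μ.real (pivotIn n A) :=
    measureReal_mono fun ω ⟨w, hw, hw'⟩ => ⟨w, (show w = _ from hw) ▸ hmem, hw'⟩
  have hn1 : 1 ≤ n := hn ▸ one_le_pow₀ (by norm_num)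
  have hdn : (2 : ℤ) ^ (j₀ - j) ≤ n := hn ▸ pow_le_pow_right₀ (by norm_num) (by omega)
  rcases Nat.lt_or_ge (j₀ - j) 8 with hd | hd
  · refine (div_le_self (by positivity) hone).trans (le_trans ?_ hmono)
    rcases Nat.lt_or_ge j₀ 7 with h7 | h7
    · refine le_trans ?_ (pivotIn_ge_of_le hμ hn1 ?_ (by omega) hL2)
      · exact mul_le_of_le_one_right hc0.le (pow_le_one₀ hδ.le hδ1)
      · rw [hn]
        exact (pow_le_pow_right₀ (by norm_num) h7.le).trans (by norm_num)
    · have hd128 : (2 : ℤ) ^ (j₀ - j) ≤ 128 :=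
        (pow_le_pow_right₀ (by norm_num) (Nat.lt_succ_iff.1 hd)).trans (by norm_num)
      have hn8 : n = 2 ^ (j₀ - 3) * 8 := by
        rw [hn, show (8 : ℤ) = 2 ^ 3 by norm_num, ← pow_add]; congr 1; omega
      have hn128 : 128 ≤ n := by
        rw [hn]
        exact le_trans (by norm_num) (pow_le_pow_right₀ (by norm_num) h7)
      refine le_trans ?_ (pivotIn_ge_of_corner hμ hn8 hn128 (by omega) hL2)
      refine (mul_le_mul_of_nonneg_right (hcle 1050 (by norm_num)) (by positivity)).trans ?_
      rw [← pow_add]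
      exact pow_le_pow_of_le_one hδ.le hδ1 (by omega)
  · have hr : (4 : ℤ) ≤ 2 ^ (j₀ - j - 6) :=
      le_trans (by norm_num) (pow_le_pow_right₀ (by norm_num) (show 2 ≤ j₀ - j - 6 by omega))
    have h64 : 64 * (2 : ℤ) ^ (j₀ - j - 6) = 2 ^ (j₀ - j) := by
      rw [show (64 : ℤ) = 2 ^ 6 by norm_num, ← pow_add]; congr 1; omega
    have h32 : 32 * (2 : ℤ) ^ (j₀ - j - 6) = 2 ^ (j₀ - j - 1) := by
      rw [show (32 : ℤ) = 2 ^ 5 by norm_num, ← pow_add]; congr 1; omega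
    have hJ : (16 : ℤ) ≤ 2 ^ (j + 4) :=
      le_trans (by norm_num) (pow_le_pow_right₀ (by norm_num) (show 4 ≤ j + 4 by omega))
    have hnr : n = 4 * (2 ^ (j + 4) * 2 ^ (j₀ - j - 6)) := by
      rw [hn, show (4 : ℤ) = 2 ^ 2 by norm_num, ← pow_add, ← pow_add]; congr 1; omega
    obtain ⟨q, hq, hqm⟩ : ∃ q : ℤ, (q : ℝ) ^ 2 ≤ 4 ^ (i₀ - j) ∧
        rswSeq 9 ^ (4 * (j + 4) + 21) ≤ 22 * (q : ℝ) ^ 2 * μ.real (pivotIn n A) := by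
      rcases Nat.lt_or_ge (j₀ - i₀) 6 with h6 | h6
      · refine ⟨_, ?_, pivotIn_ge_of_pos hμ hr hJ hnr hm1 (by omega) ?_ hA⟩
        · push_cast
          rw [← pow_mul, mul_comm, pow_mul]
          norm_num
          exact pow_le_pow_right₀ (by norm_num) (by omega)
        · rcases hL3 with h | h <;> omega
      · refine ⟨2 ^ (i₀ - j), ?_, pivotIn_ge_of_dvd hμ hr hJ hnr (s := 2 ^ (j₀ - i₀ - 6))
          (one_le_pow₀ (by norm_num)) ?_ ?_ (by omega) hL2 ?_ hA⟩
        · push_cast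
          rw [← pow_mul, mul_comm, pow_mul]
          norm_num
        · rw [hm, show (64 : ℤ) = 2 ^ 6 by norm_num, ← pow_add]; congr 1; omega
        · rw [← pow_add]; congr 1; omega
        · rcases hL3 with rfl | h
          · exact .inr (hm.trans h64.symm)
          · exact .inl (by omega)
    rw [div_le_iff₀ (by positivity)]
    calc c * rswSeq 9 ^ (4 * j) ≤ rswSeq 9 ^ 37 * rswSeq 9 ^ (4 * j) := by
          gcongr
          exact hcle 37 (by norm_num)
      _ = rswSeq 9 ^ (4 * (j + 4) + 21) := by ring
      _ ≤ 22 * (q : ℝ) ^ 2 * μ.real (pivotIn n A) := hqm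
      _ ≤ 22 * 4 ^ (i₀ - j) * μ.real (pivotIn n A) := by gcongr
      _ = _ := by ring

end

/-- There exist constants `0 < β < ∞` and `c > 0` such that for all `n = 2^{j₀}`,
`m = 2^{-i₀}n`, and all `k` with `n/m ≤ k ≤ 2n/m`, if `j` is the index with
the `x`-coordinates of `H_k` contained in `I_j`, then
`P(Q_n ∩ H_k ≠ ∅) ≥ c·2^{(1-β)j}·m²·n^{-2}`. -/
theorem statement7 :
    ∃ β : ℝ, 0 < β ∧ ∃ c : ℝ≥0∞, 0 < c ∧ c < ⊤ ∧
      ∀ μ : Measure Config, IsBernoulliHalf μ →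
        ∀ j₀ i₀ : ℕ, i₀ ≤ j₀ →
          ∀ n m : ℕ, n = 2 ^ j₀ → m = 2 ^ (j₀ - i₀) →
            ∀ k j : ℕ, j ≤ i₀ → 2 ^ i₀ ≤ k → k ≤ 2 ^ (i₀ + 1) →
              Set.Ioc (-(n : ℤ) + ((k : ℤ) - 1) * (m : ℤ))
                  (-(n : ℤ) + (k : ℤ) * (m : ℤ)) ⊆ Iset j₀ i₀ j →
              c * (2 : ℝ≥0∞) ^ ((1 - β) * (j : ℝ)) *
                  (m : ℝ≥0∞) ^ 2 / (n : ℝ≥0∞) ^ 2 ≤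
                μ {ω | (Qset (n : ℤ) ω ∩ Hblock (n : ℤ) (m : ℤ) k).Nonempty} := by
  have hδ := rswSeq_pos 9
  have hδ2 := rswSeq_le_half 9
  set δ := rswSeq 9 with hδ_def
  have hκ : 0 < 4 * δ ^ 4 := by positivity
  have hκ1 : 4 * δ ^ 4 < 1 := by
    have : δ ^ 4 ≤ (1 / 2) ^ 4 := pow_le_pow_left₀ hδ.le hδ2 4
    norm_num at this
    linarith
  have hc : 0 < δ ^ (257 * 257) / 22 := by positivity
  refine ⟨1 - Real.logb 2 (4 * δ ^ 4), ?_, ENNReal.ofReal (δ ^ (257 * 257) / 22),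
    ENNReal.ofReal_pos.2 hc, ENNReal.ofReal_lt_top, ?_⟩
  · have := Real.logb_neg (b := 2) (by norm_num) hκ hκ1
    linarith
  intro μ hμ j₀ i₀ hi n m hn hm k j hj _ _ hI
  have := hμ.1
  have hE : {ω | (Qset (n : ℤ) ω ∩ Hblock (n : ℤ) (m : ℤ) k).Nonempty} =
      pivotIn n (Hblock n m k) := by
    ext ω
    exact ⟨fun ⟨w, h, h'⟩ => ⟨w, h', h⟩, fun ⟨w, h, h'⟩ => ⟨w, h', h⟩⟩
  have hkm : -(n : ℤ) + ((k : ℤ) - 1) * m + m = -n + k * m := by ring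
  have key := pivotIn_ge hμ (n := n) (m := m) (L := -(n : ℤ) + ((k : ℤ) - 1) * m)
    (A := Hblock n m k) hi hj (by rw [hn]; push_cast; rfl) (by rw [hm]; push_cast; rfl)
    (by rwa [hkm]) fun v h1 h2 h3 h4 => ⟨h1, h2.trans_eq hkm, h3, h4⟩
  have h2 : (2 : ℝ≥0∞) ^ ((1 - (1 - Real.logb 2 (4 * δ ^ 4))) * (j : ℝ)) =
      ENNReal.ofReal ((4 * δ ^ 4) ^ j) := by
    rw [sub_sub_cancel, show (2 : ℝ≥0∞) = ENNReal.ofReal 2 by simp,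
      ENNReal.ofReal_rpow_of_pos (by norm_num), Real.rpow_mul (by norm_num),
      Real.rpow_logb (by norm_num) (by norm_num) hκ, Real.rpow_natCast]
  have hn0 : (0 : ℝ) < n := by rw [hn]; positivity
  have hmn : (m : ℝ) ^ 2 / (n : ℝ) ^ 2 = 1 / 4 ^ i₀ := by
    have : (n : ℝ) = m * 2 ^ i₀ := by
      rw [hn, hm]; push_cast; rw [← pow_add]; congr 1; omega
    have hm0 : (0 : ℝ) < m := by rw [hm]; positivity
    rw [this, mul_pow, ← pow_mul, mul_comm i₀ 2, pow_mul]
    norm_num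
    field_simp
  have h3 : (m : ℝ≥0∞) ^ 2 / (n : ℝ≥0∞) ^ 2 = ENNReal.ofReal ((m : ℝ) ^ 2 / (n : ℝ) ^ 2) := by
    rw [ENNReal.ofReal_div_of_pos (by positivity), ENNReal.ofReal_pow (by positivity),
      ENNReal.ofReal_pow (by positivity), ENNReal.ofReal_natCast, ENNReal.ofReal_natCast]
  rw [hE, h2, mul_div_assoc, h3, hmn, ← ENNReal.ofReal_mul hc.le, ← ENNReal.ofReal_mul (by positivity),
    ← ofReal_measureReal]
  refine ENNReal.ofReal_le_ofReal ?_
  rwa [mul_one_div]
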